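/- arXiv:2108.07475 — 3 statements merged into one kernel-verified Lean document; each statement's English description precedes it below -/
import Mathlib

section
/- Let c > 0 and let f be an automorphism of Ω_c. Then f(K⁺) = K⁺, G⁺_H ∘ f = G⁺_H on Ω_c, and f(Ω_b) = Ω_b for every 0 < b < c. In particular, the restriction of f to Ω'_c is an automorphism of Ω'_c. -/
open Filter Topology Set

noncomputable section

/-- `f : U → V` and `g : V → U` are mutually inverse holomorphic maps, i.e.
`f` is a biholomorphism from `U` onto `V` with inverse `g`. -/
def IsBiholoOn (f g : ℂ × ℂ → ℂ × ℂ) (U V : Set (ℂ × ℂ)) : Prop :=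
  DifferentiableOn ℂ f U ∧ DifferentiableOn ℂ g V ∧
    Set.MapsTo f U V ∧ Set.MapsTo g V U ∧
    (∀ z ∈ U, g (f z) = z) ∧ (∀ w ∈ V, f (g w) = w)


set_option linter.unusedSectionVars false

/-- Bundled hypotheses. -/
structure HD (d : ℕ) (a : ℂ) (p : Polynomial ℂ) (H : ℂ × ℂ → ℂ × ℂ) (G : ℂ × ℂ → ℝ) : Prop where
  hd : 2 ≤ d
  ha : a ≠ 0
  hpm : p.Monic
  hpd : p.natDegree = d
  hH : ∀ z : ℂ × ℂ, H z = (z.2, p.eval z.2 - a * z.1)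
  hGcont : Continuous G
  hGnonneg : ∀ z, 0 ≤ G z
  hGlim : ∀ z : ℂ × ℂ,
      Tendsto (fun n : ℕ => Real.log (max ‖H^[n] z‖ 1) / (d : ℝ) ^ n) atTop (𝓝 (G z))
  hKG : ∀ z : ℂ × ℂ, Bornology.IsBounded (Set.range fun n : ℕ => H^[n] z) ↔ G z = 0

/-- inverse Henon map -/
def Hinv (a : ℂ) (p : Polynomial ℂ) (z : ℂ × ℂ) : ℂ × ℂ := ((p.eval z.1 - z.2) / a, z.1)

/-- approximations to the Green function -/
def Lk (d : ℕ) (H : ℂ × ℂ → ℂ × ℂ) (k : ℕ) (z : ℂ × ℂ) : ℝ :=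
  Real.log (max ‖H^[k] z‖ 1) / (d : ℝ) ^ k

section basic

variable {d : ℕ} {a : ℂ} {p : Polynomial ℂ} {H : ℂ × ℂ → ℂ × ℂ} {G : ℂ × ℂ → ℝ}

lemma poly_upper (p : Polynomial ℂ) : ∃ C : ℝ, 1 ≤ C ∧ ∀ (y : ℂ) (t : ℝ), 1 ≤ t → ‖y‖ ≤ t →
    ‖p.eval y‖ ≤ C * t ^ p.natDegree := by
  refine ⟨1 + ∑ i ∈ Finset.range (p.natDegree + 1), ‖p.coeff i‖, ?_, ?_⟩
  · have : 0 ≤ ∑ i ∈ Finset.range (p.natDegree + 1), ‖p.coeff i‖ :=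
      Finset.sum_nonneg fun i _ => norm_nonneg _
    linarith
  · intro y t ht hy
    rw [Polynomial.eval_eq_sum_range]
    refine (norm_sum_le _ _).trans ?_
    have h1 : ∑ i ∈ Finset.range (p.natDegree + 1), ‖p.coeff i * y ^ i‖ ≤
        (∑ i ∈ Finset.range (p.natDegree + 1), ‖p.coeff i‖) * t ^ p.natDegree := by
      rw [Finset.sum_mul]
      refine Finset.sum_le_sum fun i hi => ?_
      rw [norm_mul, norm_pow]
      have hi' : i ≤ p.natDegree := by simpa [Nat.lt_succ_iff] using hi
      have : ‖y‖ ^ i ≤ t ^ p.natDegree :=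
        (pow_le_pow_left₀ (norm_nonneg _) hy i).trans (pow_le_pow_right₀ ht hi')
      gcongr
    have h2 : 0 ≤ t ^ p.natDegree := by positivity
    nlinarith

lemma poly_dom {d : ℕ} {p : Polynomial ℂ} (hd : 2 ≤ d) (hpm : p.Monic) (hpd : p.natDegree = d)
    (a : ℂ) : ∃ R : ℝ, 4 ≤ R ∧ ∀ x y : ℂ, R ≤ ‖y‖ → ‖x‖ ≤ ‖y‖ →
    ‖p.eval y - a * x - y ^ d‖ ≤ ‖y‖ ^ d / 2 := by
  set S := ∑ i ∈ Finset.range d, ‖p.coeff i‖ with hS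
  have hS0 : 0 ≤ S := Finset.sum_nonneg fun i _ => norm_nonneg _
  refine ⟨4 + 2 * (S + ‖a‖), by nlinarith [norm_nonneg a], ?_⟩
  intro x y hy hx
  have hev : p.eval y = ∑ i ∈ Finset.range d, p.coeff i * y ^ i + y ^ d := by
    rw [Polynomial.eval_eq_sum_range, hpd, Finset.sum_range_succ]
    have : p.coeff d = 1 := by rw [← hpd]; exact hpm
    rw [this, one_mul]
  have hy1 : 1 ≤ ‖y‖ := by nlinarith [norm_nonneg a]
  obtain ⟨e, rfl⟩ : ∃ e, d = e + 2 := ⟨d - 2, by omega⟩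
  have h1 : ‖∑ i ∈ Finset.range (e + 2), p.coeff i * y ^ i‖ ≤ S * ‖y‖ ^ (e + 1) := by
    refine (norm_sum_le _ _).trans ?_
    rw [hS, Finset.sum_mul]
    refine Finset.sum_le_sum fun i hi => ?_
    rw [norm_mul, norm_pow]
    have hi' : i ≤ e + 1 := by simp at hi; omega
    have : ‖y‖ ^ i ≤ ‖y‖ ^ (e + 1) := pow_le_pow_right₀ hy1 hi'
    gcongr
  have h2 : ‖a * x‖ ≤ ‖a‖ * ‖y‖ ^ (e + 1) := by
    rw [norm_mul]
    have : ‖y‖ ≤ ‖y‖ ^ (e + 1) := le_self_pow₀ hy1 (by omega)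
    gcongr
    exact hx.trans this
  have h3 : p.eval y - a * x - y ^ (e + 2) =
      ∑ i ∈ Finset.range (e + 2), p.coeff i * y ^ i - a * x := by rw [hev]; ring
  rw [h3]
  refine (norm_sub_le _ _).trans ?_
  have h4 : 0 ≤ ‖y‖ ^ (e + 1) := by positivity
  have h5 : ‖y‖ ^ (e + 2) = ‖y‖ * ‖y‖ ^ (e + 1) := by ring
  rw [h5]
  nlinarith

namespace HD

variable (h : HD d a p H G)
include h

lemma d_pos : (0 : ℝ) < d := by have := h.hd; positivity

lemma one_lt_d : (1 : ℝ) < d := by have := h.hd; exact_mod_cast (by omega : 1 < d)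

lemma H_diff : Differentiable ℂ H := by
  have : H = fun z => (z.2, p.eval z.2 - a * z.1) := funext h.hH
  rw [this]
  have h1 : Differentiable ℂ fun z : ℂ × ℂ => p.eval z.2 := p.differentiable.comp differentiable_snd
  fun_prop

lemma Hit_diff (n : ℕ) : Differentiable ℂ (H^[n]) := h.H_diff.iterate n

lemma Hi_diff : Differentiable ℂ (Hinv a p) := by
  unfold Hinv
  have h1 : Differentiable ℂ fun z : ℂ × ℂ => p.eval z.1 := p.differentiable.comp differentiable_fst
  fun_prop

lemma Hiit_diff (n : ℕ) : Differentiable ℂ ((Hinv a p)^[n]) := h.Hi_diff.iterate n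

lemma Hi_H (z : ℂ × ℂ) : Hinv a p (H z) = z := by
  have := h.ha
  ext
  · simp only [Hinv, h.hH]; field_simp; ring
  · simp [Hinv, h.hH]

lemma H_Hi (z : ℂ × ℂ) : H (Hinv a p z) = z := by
  have := h.ha
  rw [h.hH]
  ext
  · simp [Hinv]
  · simp only [Hinv]; field_simp; ring

lemma Hi_H_it (n : ℕ) (z : ℂ × ℂ) : (Hinv a p)^[n] (H^[n] z) = z :=
  (Function.LeftInverse.iterate h.Hi_H n) z

lemma H_Hi_it (n : ℕ) (z : ℂ × ℂ) : H^[n] ((Hinv a p)^[n] z) = z :=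
  (Function.LeftInverse.iterate h.H_Hi n) z

lemma Lk_tendsto (z : ℂ × ℂ) : Tendsto (fun k => Lk d H k z) atTop (𝓝 (G z)) := h.hGlim z

lemma G_H (z : ℂ × ℂ) : G (H z) = d * G z := by
  have h1 := (h.hGlim z).comp (tendsto_add_atTop_nat 1)
  have h2 := h.hGlim (H z)
  have h3 := h1.const_mul (d : ℝ)
  refine tendsto_nhds_unique h2 (h3.congr fun n => ?_)
  simp only [Function.comp, Function.iterate_succ_apply]
  have := h.d_pos
  rw [pow_succ]
  field_simp

lemma G_Hit (n : ℕ) (z : ℂ × ℂ) : G (H^[n] z) = d ^ n * G z := by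
  induction n with
  | zero => simp
  | succ n ih => rw [Function.iterate_succ_apply', h.G_H, ih]; ring

lemma G_Hiit (n : ℕ) (z : ℂ × ℂ) : G ((Hinv a p)^[n] z) = G z / d ^ n := by
  have h1 := h.G_Hit n ((Hinv a p)^[n] z)
  rw [h.H_Hi_it] at h1
  have := h.d_pos
  rw [h1]; field_simp

lemma Lk_cont (k : ℕ) : Continuous (Lk d H k) := by
  unfold Lk
  have h1 : Continuous (H^[k]) := (h.Hit_diff k).continuous
  refine Continuous.div_const ?_ _
  refine Continuous.log (by fun_prop) fun x => ?_
  have : (1 : ℝ) ≤ max ‖H^[k] x‖ 1 := le_max_right _ _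
  positivity

lemma upper_step : ∃ C : ℝ, 1 ≤ C ∧ ∀ z, max ‖H z‖ 1 ≤ C * (max ‖z‖ 1) ^ d := by
  obtain ⟨C, hC1, hC⟩ := poly_upper p
  refine ⟨C + ‖a‖, by linarith [norm_nonneg a], fun z => ?_⟩
  set t := max ‖z‖ 1 with ht
  have ht1 : 1 ≤ t := le_max_right _ _
  have hz : ‖z‖ ≤ t := le_max_left _ _
  have hz1 : ‖z.1‖ ≤ t := (norm_fst_le z).trans hz
  have hz2 : ‖z.2‖ ≤ t := (norm_snd_le z).trans hz
  have htd : t ≤ t ^ d := le_self_pow₀ ht1 (by have := h.hd; omega)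
  have hCa : 1 ≤ C + ‖a‖ := by linarith [norm_nonneg a]
  have ht2 : t ^ d ≤ (C + ‖a‖) * t ^ d := le_mul_of_one_le_left (by positivity) hCa
  refine max_le ?_ (by linarith)
  rw [h.hH, Prod.norm_mk]
  refine max_le (by linarith) ?_
  have h1 := hC z.2 t ht1 hz2
  rw [h.hpd] at h1
  refine (norm_sub_le _ _).trans ?_
  rw [norm_mul]
  have : ‖a‖ * ‖z.1‖ ≤ ‖a‖ * t ^ d := by gcongr; linarith
  linarith

lemma antitone_bound : ∃ C1 : ℝ, 0 ≤ C1 ∧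
    ∀ z, Antitone fun k => Lk d H k z + C1 / (d : ℝ) ^ k := by
  obtain ⟨C, hC1, hC⟩ := h.upper_step
  have hC0 : 0 ≤ Real.log C := Real.log_nonneg hC1
  refine ⟨Real.log C, hC0, fun z => antitone_nat_of_succ_le fun k => ?_⟩
  have hdp := h.d_pos
  have h2 : (2 : ℝ) ≤ d := by exact_mod_cast h.hd
  simp only [Lk, Function.iterate_succ_apply']
  set w := H^[k] z
  have hw1 : 1 ≤ max ‖w‖ 1 := le_max_right _ _
  have h3 : Real.log (max ‖H w‖ 1) ≤ Real.log C + d * Real.log (max ‖w‖ 1) := by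
    have h4 := Real.log_le_log (by have : 1 ≤ max ‖H w‖ 1 := le_max_right _ _
                                   linarith) (hC w)
    rwa [Real.log_mul (by positivity) (by positivity), Real.log_pow] at h4
  rw [← add_div, ← add_div, div_le_div_iff₀ (by positivity) (by positivity), pow_succ]
  have : 0 < (d : ℝ) ^ k := by positivity
  have h5 : Real.log (max ‖H w‖ 1) + Real.log C ≤ d * (Real.log (max ‖w‖ 1) + Real.log C) := by
    nlinarith
  calc _ ≤ d * (Real.log (max ‖w‖ 1) + Real.log C) * d ^ k := by gcongr
    _ = _ := by ring

lemma bound_tendsto (C1 : ℝ) (z : ℂ × ℂ) :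
    Tendsto (fun k => Lk d H k z + C1 / (d : ℝ) ^ k) atTop (𝓝 (G z)) := by
  have h1 : Tendsto (fun k : ℕ => C1 / (d : ℝ) ^ k) atTop (𝓝 0) :=
    tendsto_const_nhds.div_atTop (tendsto_pow_atTop_atTop_of_one_lt h.one_lt_d)
  simpa using (h.Lk_tendsto z).add h1

lemma unif {S : Set (ℂ × ℂ)} (hS : IsCompact S) {ε : ℝ} (hε : 0 < ε) :
    ∀ᶠ k in atTop, ∀ z ∈ S, |Lk d H k z - G z| < ε := by
  obtain ⟨C1, hC1, hanti⟩ := h.antitone_bound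
  have h1 : TendstoUniformlyOn (fun k z => Lk d H k z + C1 / (d : ℝ) ^ k) G atTop S := by
    refine Antitone.tendstoUniformlyOn_of_forall_tendsto hS ?_ ?_ h.hGcont.continuousOn ?_
    · intro k; exact ((h.Lk_cont k).add continuous_const).continuousOn
    · intro x _; exact hanti x
    · intro x _; exact h.bound_tendsto C1 x
  have h2 : Tendsto (fun k : ℕ => C1 / (d : ℝ) ^ k) atTop (𝓝 0) :=
    tendsto_const_nhds.div_atTop (tendsto_pow_atTop_atTop_of_one_lt h.one_lt_d)
  rw [Metric.tendstoUniformlyOn_iff] at h1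
  filter_upwards [h1 (ε / 2) (by positivity), h2.eventually (gt_mem_nhds (half_pos hε))]
    with k hk1 hk2 z hz
  have h3 := hk1 z hz
  rw [Real.dist_eq] at h3
  have h4 : 0 ≤ C1 / (d : ℝ) ^ k := by have := h.d_pos; positivity
  rw [abs_lt] at h3 ⊢
  constructor <;> linarith

lemma G_upper : ∃ C1 : ℝ, 0 ≤ C1 ∧ ∀ z, G z ≤ Real.log (max ‖z‖ 1) + C1 := by
  obtain ⟨C1, hC1, hanti⟩ := h.antitone_bound
  refine ⟨C1, hC1, fun z => ?_⟩
  have := (hanti z).le_of_tendsto (h.bound_tendsto C1 z) 0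
  simpa [Lk] using this

/-- growth of `‖H^n z‖`. -/
lemma orbit_growth (z : ℂ × ℂ) {β : ℝ} (hβ : G z < β) :
    ∀ᶠ n : ℕ in atTop, ‖H^[n] z‖ ≤ Real.exp (β * d ^ n) := by
  filter_upwards [(h.Lk_tendsto z).eventually (gt_mem_nhds hβ)] with n hn
  have := h.d_pos
  rw [Lk, div_lt_iff₀ (by positivity)] at hn
  have h1 : 1 ≤ max ‖H^[n] z‖ 1 := le_max_right _ _
  rw [Real.log_lt_iff_lt_exp (by positivity)] at hn
  exact (le_max_left _ _).trans hn.le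

end HD

end basic

section region

/-- the escape region -/
def VR (R : ℝ) : Set (ℂ × ℂ) := {z | R < ‖z.2‖ ∧ ‖z.1‖ < ‖z.2‖}

/-- domination by the leading term -/
def Dom (d : ℕ) (a : ℂ) (p : Polynomial ℂ) (R : ℝ) : Prop := 4 ≤ R ∧ ∀ x y : ℂ, R ≤ ‖y‖ → ‖x‖ ≤ ‖y‖ →
    ‖p.eval y - a * x - y ^ d‖ ≤ ‖y‖ ^ d / 2

variable {d : ℕ} {a : ℂ} {p : Polynomial ℂ} {H : ℂ × ℂ → ℂ × ℂ} {G : ℂ × ℂ → ℝ} {R : ℝ}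

lemma isOpen_VR (R : ℝ) : IsOpen (VR R) := by
  unfold VR
  have h1 : Continuous fun z : ℂ × ℂ => ‖z.1‖ := by fun_prop
  have h2 : Continuous fun z : ℂ × ℂ => ‖z.2‖ := by fun_prop
  exact (isOpen_lt continuous_const h2).inter (isOpen_lt h1 h2)

namespace HD

variable (h : HD d a p H G)
include h

lemma exists_dom : ∃ R : ℝ, Dom d a p R := by
  obtain ⟨R, hR, hR'⟩ := poly_dom h.hd h.hpm h.hpd a
  exact ⟨R, hR, hR'⟩

variable (hR : Dom d a p R)
include hR

lemma V_lower {z : ℂ × ℂ} (hz : z ∈ VR R) : ‖z.2‖ ^ d / 2 ≤ ‖(H z).2‖ := by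
  have h1 := hR.2 z.1 z.2 hz.1.le hz.2.le
  rw [h.hH]
  have h2 := norm_sub_norm_le (z.2 ^ d) (z.2 ^ d - (p.eval z.2 - a * z.1))
  rw [sub_sub_cancel, norm_sub_rev, norm_pow] at h2
  show _ ≤ ‖p.eval z.2 - a * z.1‖
  have : ‖p.eval z.2 - a * z.1 - z.2 ^ d‖ = ‖p.eval z.2 - a * z.1 - z.2 ^ d‖ := rfl
  linarith

lemma V_step {z : ℂ × ℂ} (hz : z ∈ VR R) : H z ∈ VR R := by
  have h1 := h.V_lower hR hz
  have h4 : 4 < ‖z.2‖ := lt_of_le_of_lt hR.1 hz.1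
  have h2 : ‖z.2‖ ^ 2 ≤ ‖z.2‖ ^ d := pow_le_pow_right₀ (by linarith) h.hd
  have h3 : ‖z.2‖ < ‖(H z).2‖ := by nlinarith
  refine ⟨hz.1.trans h3, ?_⟩
  have : (H z).1 = z.2 := by rw [h.hH]
  rw [this]; exact h3

lemma V_it {z : ℂ × ℂ} (hz : z ∈ VR R) (n : ℕ) : H^[n] z ∈ VR R := by
  induction n with
  | zero => exact hz
  | succ n ih => rw [Function.iterate_succ_apply']; exact h.V_step hR ih

omit h in
lemma V_norm {z : ℂ × ℂ} (hz : z ∈ VR R) : max ‖z‖ 1 = ‖z.2‖ := by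
  have h4 : 4 < ‖z.2‖ := lt_of_le_of_lt hR.1 hz.1
  have : ‖z‖ = ‖z.2‖ := by rw [Prod.norm_def]; exact max_eq_right hz.2.le
  rw [this]; exact max_eq_left (by linarith)

lemma V_Lk {z : ℂ × ℂ} {k : ℕ} (hz : H^[k] z ∈ VR R) :
    Lk d H k z = Real.log ‖(H^[k] z).2‖ / d ^ k := by
  rw [Lk, V_norm hR hz]

lemma G_lower {z : ℂ × ℂ} (hz : z ∈ VR R) : Real.log ‖z.2‖ - Real.log 2 ≤ G z := by
  have hdp := h.d_pos
  have hmono : Monotone fun k => Lk d H k z + (-Real.log 2) / (d : ℝ) ^ k := by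
    refine monotone_nat_of_le_succ fun k => ?_
    have hk := h.V_it hR hz k
    have hk1 := h.V_it hR hz (k + 1)
    simp only [h.V_Lk hR hk, h.V_Lk hR hk1]
    rw [← add_div, ← add_div, div_le_div_iff₀ (by positivity) (by positivity), pow_succ]
    rw [Function.iterate_succ_apply'] at hk1 ⊢
    set w := H^[k] z
    have h1 := h.V_lower hR hk
    have h4 : 4 < ‖w.2‖ := lt_of_le_of_lt hR.1 hk.1
    have h2 := Real.log_le_log (by positivity) h1
    rw [Real.log_div (by positivity) (by norm_num), Real.log_pow] at h2
    have hl2 : 0 < Real.log 2 := Real.log_pos (by norm_num)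
    have hd2 : (2 : ℝ) ≤ d := by exact_mod_cast h.hd
    have h5 : (Real.log ‖w.2‖ + -Real.log 2) * d ≤ Real.log ‖(H w).2‖ + -Real.log 2 := by nlinarith
    calc _ = (Real.log ‖w.2‖ + -Real.log 2) * d * d ^ k := by ring
      _ ≤ _ := by gcongr
  have := hmono.ge_of_tendsto (h.bound_tendsto (-Real.log 2) z) 0
  have h0 : Lk d H 0 z = Real.log ‖z.2‖ / d ^ 0 := h.V_Lk hR (by simpa using hz)
  rw [h0] at this
  simp at this
  linarith

lemma G_pos_V {z : ℂ × ℂ} (hz : z ∈ VR R) : 0 < G z := by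
  have h1 := h.G_lower hR hz
  have h4 : 4 < ‖z.2‖ := lt_of_le_of_lt hR.1 hz.1
  have : Real.log 2 < Real.log ‖z.2‖ := Real.log_lt_log (by norm_num) (by linarith)
  linarith

lemma slice_bound (z : ℂ × ℂ) : ‖z.2‖ ≤ max (max R ‖z.1‖) (2 * Real.exp (G z)) := by
  by_contra! hcon
  rw [max_lt_iff, max_lt_iff] at hcon
  obtain ⟨⟨h1, h2⟩, h3⟩ := hcon
  have h4 := h.G_lower hR (z := z) ⟨h1, h2⟩
  have hpos : 0 < ‖z.2‖ := lt_of_le_of_lt (by have := hR.1; linarith) h1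
  have h5 := Real.log_lt_log (by positivity) h3
  rw [Real.log_mul (by norm_num) (by positivity), Real.log_exp] at h5
  linarith

lemma exists_V {z : ℂ × ℂ} (hz : 0 < G z) : ∃ n, H^[n] z ∈ VR R := by
  by_contra! hcon
  have hb : ∀ n, ‖H^[n] z‖ ≤ max R ‖z‖ := by
    intro n
    induction n with
    | zero => exact le_max_right _ _
    | succ n ih =>
      have h1 := hcon (n + 1)
      rw [Function.iterate_succ_apply'] at h1 ⊢
      set w := H^[n] z
      have h2 : ‖w.2‖ ≤ ‖w‖ := norm_snd_le w
      have h3 : (H w).1 = w.2 := by rw [h.hH]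
      have h4 : ‖(H w).2‖ ≤ max R ‖w.2‖ := by
        by_contra! h5
        rw [max_lt_iff] at h5
        exact h1 ⟨h5.1, by rw [h3]; exact h5.2⟩
      rw [Prod.norm_def, h3]
      refine max_le (h2.trans ih) (h4.trans (max_le (le_max_left _ _) (h2.trans ih)))
  have : Bornology.IsBounded (Set.range fun n : ℕ => H^[n] z) := by
    rw [isBounded_iff_forall_norm_le]
    exact ⟨_, by rintro _ ⟨n, rfl⟩; exact hb n⟩
  have := (h.hKG z).1 this
  linarith

lemma compact_V {S : Set (ℂ × ℂ)} (hS : IsCompact S) (hpos : ∀ z ∈ S, 0 < G z) :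
    ∀ᶠ k in atTop, ∀ z ∈ S, H^[k] z ∈ VR R := by
  have hcov : S ⊆ ⋃ n, (H^[n]) ⁻¹' VR R := fun z hz => by
    simpa using h.exists_V hR (hpos z hz)
  have hmono : Monotone fun n => (H^[n]) ⁻¹' VR R := by
    refine monotone_nat_of_le_succ fun n z hz => ?_
    simp only [mem_preimage, Function.iterate_succ_apply'] at hz ⊢
    exact h.V_step hR hz
  obtain ⟨n, hn⟩ := hS.elim_directed_cover _
    (fun n => (isOpen_VR R).preimage (h.Hit_diff n).continuous) hcov hmono.directed_le
  filter_upwards [eventually_ge_atTop n] with k hk z hz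
  exact hmono hk (hn hz)

omit hR
lemma exists_K : ∃ z, G z = 0 := by
  have hdeg : (p - Polynomial.C (1 + a) * Polynomial.X).natDegree = d := by
    rw [Polynomial.natDegree_sub_eq_left_of_natDegree_lt, h.hpd]
    rw [h.hpd]
    have := (Polynomial.natDegree_C_mul_le (1 + a) Polynomial.X).trans Polynomial.natDegree_X_le
    have := h.hd
    omega
  obtain ⟨y, hy⟩ := Complex.exists_root (f := p - Polynomial.C (1 + a) * Polynomial.X) (by
    apply Polynomial.natDegree_pos_iff_degree_pos.1
    have := h.hd
    omega)
  have hfix : H (y, y) = (y, y) := by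
    rw [h.hH]
    simp [Polynomial.IsRoot] at hy
    ext
    · rfl
    · simp; linear_combination hy
  refine ⟨(y, y), (h.hKG _).1 ?_⟩
  have : ∀ n, H^[n] (y, y) = (y, y) := fun n => Function.iterate_fixed hfix n
  simp [this]

end HD

end region

section hadamard

variable {d : ℕ} {a : ℂ} {p : Polynomial ℂ} {H : ℂ × ℂ → ℂ × ℂ} {G : ℂ × ℂ → ℝ}

namespace HD

variable (h : HD d a p H G)
include h

lemma exp_Lk (k : ℕ) (z : ℂ × ℂ) : max ‖H^[k] z‖ 1 = Real.exp (d ^ k * Lk d H k z) := by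
  have := h.d_pos
  have h1 : 1 ≤ max ‖H^[k] z‖ 1 := le_max_right _ _
  rw [Lk, mul_div_cancel₀ _ (by positivity), Real.exp_log (by positivity)]

lemma hadamard {F : ℂ → ℂ × ℂ} {r Rr m c : ℝ} (hr : 0 < r) (hrR : r < Rr)
    (hF : ∀ s ∈ Metric.closedBall (0 : ℂ) Rr, DifferentiableAt ℂ F s)
    (h1 : ∀ s, ‖s‖ = r → G (F s) ≤ m) (h2 : ∀ s, ‖s‖ = Rr → G (F s) ≤ c)
    {s : ℂ} (hs1 : r ≤ ‖s‖) (hs2 : ‖s‖ ≤ Rr) :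
    G (F s) ≤ (1 - (Real.log ‖s‖ - Real.log r) / (Real.log Rr - Real.log r)) * m +
      (Real.log ‖s‖ - Real.log r) / (Real.log Rr - Real.log r) * c := by
  have hRr : 0 < Rr := hr.trans hrR
  have hs0 : 0 < ‖s‖ := hr.trans_le hs1
  have hlog : Real.log r < Real.log Rr := Real.log_lt_log hr hrR
  set τ := (Real.log ‖s‖ - Real.log r) / (Real.log Rr - Real.log r) with hτ
  have hcontF : ContinuousOn F (Metric.closedBall (0 : ℂ) Rr) := fun z hz =>
    (hF z hz).continuousAt.continuousWithinAt
  have hcomp : IsCompact (F '' Metric.closedBall (0 : ℂ) Rr) :=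
    (isCompact_closedBall _ _).image_of_continuousOn hcontF
  refine le_of_forall_pos_le_add fun ε hε => ?_
  obtain ⟨k, hk⟩ := (h.unif hcomp (half_pos hε)).exists
  have hk' : ∀ s ∈ Metric.closedBall (0 : ℂ) Rr, |Lk d H k (F s) - G (F s)| < ε / 2 :=
    fun s hs => hk _ (mem_image_of_mem F hs)
  have hdk : (0 : ℝ) < d ^ k := by have := h.d_pos; positivity
  let Φ : ℂ → (ℂ × ℂ) × ℂ := fun z => (H^[k] (F (Complex.exp z)), 1)
  have hΦ : ∀ z, ‖Φ z‖ = Real.exp (d ^ k * Lk d H k (F (Complex.exp z))) := by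
    intro z
    rw [← h.exp_Lk, Prod.norm_mk]; simp
  have hmem : ∀ z : ℂ, z.re ≤ Real.log Rr → Complex.exp z ∈ Metric.closedBall (0 : ℂ) Rr := by
    intro z hz
    rw [mem_closedBall_zero_iff, Complex.norm_exp]
    rwa [← Real.le_log_iff_exp_le hRr]
  have hdiffat : ∀ z : ℂ, z.re ≤ Real.log Rr → DifferentiableAt ℂ Φ z := by
    intro z hz
    have := (hF _ (hmem z hz)).comp z Complex.differentiableAt_exp
    exact (((h.Hit_diff k) _).comp z this).prodMk (differentiableAt_const _)
  have hsexp : Complex.exp (Complex.log s) = s := Complex.exp_log (norm_pos_iff.1 hs0)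
  have hlogre : (Complex.log s).re = Real.log ‖s‖ := Complex.log_re s
  have key := Complex.HadamardThreeLines.norm_le_interp_of_mem_verticalClosedStrip' (f := Φ)
    (z := Complex.log s) (a := Real.exp (d ^ k * (m + ε / 2))) (b := Real.exp (d ^ k * (c + ε / 2)))
    hlog ?_ ?_ ?_ ?_ ?_
  · rw [hΦ, hsexp, hlogre, ← hτ, ← Real.exp_mul, ← Real.exp_mul, ← Real.exp_add,
      Real.exp_le_exp] at key
    have h3 := hk' s (by simpa using hs2)
    rw [abs_lt] at h3
    have h4 : Lk d H k (F s) ≤ (1 - τ) * m + τ * c + ε / 2 := by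
      refine le_of_mul_le_mul_left (a := (d : ℝ) ^ k) (key.trans (le_of_eq ?_)) hdk
      ring
    linarith
  · simp only [Complex.HadamardThreeLines.verticalClosedStrip, mem_preimage, mem_Icc, hlogre]
    exact ⟨Real.log_le_log hr hs1, Real.log_le_log hs0 hs2⟩
  · refine DifferentiableOn.diffContOnCl fun z hz => (hdiffat z ?_).differentiableWithinAt
    have hcl : closure (Complex.HadamardThreeLines.verticalStrip (Real.log r) (Real.log Rr)) ⊆
        Complex.HadamardThreeLines.verticalClosedStrip (Real.log r) (Real.log Rr) := by
      refine closure_minimal ?_ (isClosed_Icc.preimage Complex.continuous_re)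
      exact preimage_mono Ioo_subset_Icc_self
    exact (hcl hz).2
  · have hb : BddAbove ((fun w => max ‖H^[k] (F w)‖ 1) '' Metric.closedBall (0 : ℂ) Rr) := by
      refine (isCompact_closedBall _ _).bddAbove_image ?_
      exact ((h.Hit_diff k).continuous.comp_continuousOn hcontF).norm.sup continuousOn_const
    refine hb.mono ?_
    rintro _ ⟨z, hz, rfl⟩
    refine ⟨Complex.exp z, hmem z hz.2, ?_⟩
    simp only [Function.comp, hΦ, h.exp_Lk]
  · intro z hz
    have hn : ‖Complex.exp z‖ = r := by
      rw [Complex.norm_exp, show z.re = Real.log r from hz, Real.exp_log hr]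
    have h3 := hk' (Complex.exp z) (by simp [hn]; linarith)
    rw [hΦ, Real.exp_le_exp]
    have := h1 _ hn
    rw [abs_lt] at h3
    gcongr; linarith
  · intro z hz
    have hn : ‖Complex.exp z‖ = Rr := by
      rw [Complex.norm_exp, show z.re = Real.log Rr from hz, Real.exp_log hRr]
    have h3 := hk' (Complex.exp z) (by simp [hn])
    rw [hΦ, Real.exp_le_exp]
    have := h2 _ hn
    rw [abs_lt] at h3
    gcongr; linarith

end HD

end hadamard

section constK

variable {d : ℕ} {a : ℂ} {p : Polynomial ℂ} {H : ℂ × ℂ → ℂ × ℂ} {G : ℂ × ℂ → ℝ}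

lemma Hinv_lip (a : ℂ) (p : Polynomial ℂ) (B : ℝ) : ∃ Λ : ℝ, 1 ≤ Λ ∧ ∀ x y : ℂ × ℂ, ‖x‖ ≤ B → ‖y‖ ≤ B →
    ‖Hinv a p x - Hinv a p y‖ ≤ Λ * ‖x - y‖ := by
  have h1 : ContDiff ℂ 1 (Hinv a p) := by
    unfold Hinv
    have h0 : ContDiff ℂ 1 fun z : ℂ => p.eval z := by
      simpa using p.contDiff_aeval (𝕜 := ℂ) (R := ℂ) 1
    have h2 : ContDiff ℂ 1 fun z : ℂ × ℂ => p.eval z.1 := h0.comp contDiff_fst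
    exact ((h2.sub contDiff_snd).div_const a).prodMk contDiff_fst
  have h2 : ContDiff ℝ 1 (Hinv a p) := h1.restrict_scalars ℝ
  obtain ⟨C, hC⟩ := (h2.contDiffOn (s := Metric.closedBall (0 : ℂ × ℂ) B)).exists_lipschitzOnWith
    one_ne_zero (convex_closedBall _ _) (isCompact_closedBall _ _)
  refine ⟨max C 1, le_max_right _ _, fun x y hx hy => ?_⟩
  have := hC.norm_sub_le (x := x) (y := y) (by simpa using hx) (by simpa using hy)
  refine this.trans ?_
  gcongr
  exact le_max_left _ _

namespace HD

variable (h : HD d a p H G)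
include h

lemma isOpen_Om (c : ℝ) : IsOpen {z | G z < c} := isOpen_lt h.hGcont continuous_const

lemma orbit_bdd {z : ℂ × ℂ} (hz : G z = 0) : ∃ B : ℝ, ∀ n, ‖H^[n] z‖ ≤ B := by
  have := (h.hKG z).2 hz
  rw [isBounded_iff_forall_norm_le] at this
  obtain ⟨B, hB⟩ := this
  exact ⟨B, fun n => hB _ ⟨n, rfl⟩⟩

lemma pullback_ball {z : ℂ × ℂ} {B Λ : ℝ} (hB : ∀ n, ‖H^[n] z‖ ≤ B) (hΛ1 : 1 ≤ Λ)
    (hΛ : ∀ x y : ℂ × ℂ, ‖x‖ ≤ B + 1 → ‖y‖ ≤ B + 1 →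
      ‖Hinv a p x - Hinv a p y‖ ≤ Λ * ‖x - y‖) (n : ℕ) (q : ℂ × ℂ)
    (hq : ‖q - H^[n] z‖ * Λ ^ n ≤ 1) :
    ‖(Hinv a p)^[n] q - z‖ ≤ ‖q - H^[n] z‖ * Λ ^ n := by
  induction n generalizing q with
  | zero => simp
  | succ n ih =>
    have hL : 1 ≤ Λ ^ (n + 1) := one_le_pow₀ hΛ1
    have hq1 : ‖q - H^[n + 1] z‖ ≤ 1 := (le_mul_of_one_le_right (norm_nonneg _) hL).trans hq
    have h1 : ‖q‖ ≤ B + 1 := by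
      have := norm_le_norm_add_norm_sub (H^[n + 1] z) q
      rw [norm_sub_rev] at this
      have := hB (n + 1)
      linarith
    have h2 := hΛ q (H^[n + 1] z) h1 (by have := hB (n + 1); linarith)
    rw [Function.iterate_succ_apply' H, h.Hi_H, ← Function.iterate_succ_apply' H] at h2
    have hLn : 0 ≤ Λ ^ n := by positivity
    have h3 : ‖Hinv a p q - H^[n] z‖ * Λ ^ n ≤ ‖q - H^[n + 1] z‖ * Λ ^ (n + 1) := by
      calc _ ≤ (Λ * ‖q - H^[n + 1] z‖) * Λ ^ n := by gcongr
        _ = _ := by ring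
    rw [Function.iterate_succ_apply]
    exact (ih _ (h3.trans hq)).trans h3

lemma const_K {c : ℝ} (hc : 0 < c) {f : ℂ × ℂ → ℂ × ℂ} (hfd : DifferentiableOn ℂ f {z | G z < c})
    (hmaps : MapsTo f {z | G z < c} {z | G z < c}) {z z' : ℂ × ℂ} (hz : G z = 0) (hz' : G z' = 0) :
    G (f z') ≤ G (f z) := by
  refine le_of_forall_pos_le_add fun ε hε => ?_
  have hzO : z ∈ {z | G z < c} := by simpa [hz] using hc
  have hfc : ContinuousAt f z := hfd.continuousOn.continuousAt ((h.isOpen_Om c).mem_nhds hzO)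
  have hev : ∀ᶠ q in 𝓝 z, G (f q) < G (f z) + ε :=
    (h.hGcont.continuousAt.comp hfc).eventually (gt_mem_nhds (by simp [hε]))
  obtain ⟨ρ, hρ, hball⟩ := Metric.eventually_nhds_iff.1 hev
  obtain ⟨B1, hB1⟩ := h.orbit_bdd hz
  obtain ⟨B2, hB2⟩ := h.orbit_bdd hz'
  set B := max 1 (max B1 B2) with hBdef
  have hB1' : ∀ n, ‖H^[n] z‖ ≤ B := fun n =>
    (hB1 n).trans ((le_max_left _ _).trans (le_max_right _ _))
  have hB2' : ∀ n, ‖H^[n] z'‖ ≤ B := fun n =>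
    (hB2 n).trans ((le_max_right _ _).trans (le_max_right _ _))
  have hB0 : 1 ≤ B := le_max_left _ _
  obtain ⟨Λ, hΛ1, hΛ⟩ := Hinv_lip a p (B + 1)
  obtain ⟨C1, hC1, hG⟩ := h.G_upper
  set ρ' := min (ρ / 2) 1 with hρ'
  have hρ'0 : 0 < ρ' := by positivity
  have hρ'1 : ρ' ≤ 1 := min_le_right _ _
  have hρ'2 : ρ' < ρ := lt_of_le_of_lt (min_le_left _ _) (by linarith)
  have hdn : Tendsto (fun n : ℕ => (d : ℝ) ^ n) atTop atTop :=
    tendsto_pow_atTop_atTop_of_one_lt h.one_lt_d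
  -- the main estimate
  have main : ∀ᶠ n : ℕ in atTop, G (f z') ≤ G (f z) + ε +
      (Real.log (2 * B / ρ') + n * Real.log Λ) / (d ^ n * (c / 2)) * c := by
    filter_upwards [(hdn.atTop_mul_const (half_pos hc)).eventually_gt_atTop
      (Real.log (3 * B) + C1)] with n hn
    set w := H^[n] z with hw
    set w' := H^[n] z' with hw'
    let ℓ : ℂ → ℂ × ℂ := fun s => w + s • (w' - w)
    let F : ℂ → ℂ × ℂ := fun s => f ((Hinv a p)^[n] (ℓ s))
    have hdn0 : (0 : ℝ) < d ^ n := by have := h.d_pos; positivity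
    have hww : ‖w' - w‖ ≤ 2 * B := by
      have := norm_sub_le w' w
      have := hB1' n
      have := hB2' n
      linarith
    set r := ρ' / (2 * B * Λ ^ n) with hr
    have hΛn : 1 ≤ Λ ^ n := one_le_pow₀ hΛ1
    have hr0 : 0 < r := by positivity
    have hr1 : r < 1 := by
      rw [hr, div_lt_one (by positivity)]
      nlinarith
    have hlogr : - Real.log r = Real.log (2 * B / ρ') + n * Real.log Λ := by
      rw [hr, ← Real.log_inv, inv_div, mul_div_right_comm, Real.log_mul (by positivity)
        (by positivity), Real.log_pow]
    set Rr := Real.exp (d ^ n * (c / 2)) with hRr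
    have hRr1 : 1 < Rr := Real.one_lt_exp_iff.2 (by positivity)
    have hℓ : ∀ s : ℂ, ‖s‖ ≤ Rr → (Hinv a p)^[n] (ℓ s) ∈ {z | G z < c} := by
      intro s hs
      have h1 : ‖ℓ s‖ ≤ 3 * B * Rr := by
        calc ‖ℓ s‖ ≤ ‖w‖ + ‖s‖ * ‖w' - w‖ := by
              refine (norm_add_le _ _).trans ?_
              rw [norm_smul]
          _ ≤ B + Rr * (2 * B) := by gcongr; exact hB1' n
          _ ≤ _ := by nlinarith
      have h2 : max ‖ℓ s‖ 1 ≤ 3 * B * Rr := max_le h1 (by nlinarith)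
      have h3 := hG (ℓ s)
      have h4 : Real.log (max ‖ℓ s‖ 1) ≤ Real.log (3 * B) + d ^ n * (c / 2) := by
        refine (Real.log_le_log (by have : 1 ≤ max ‖ℓ s‖ 1 := le_max_right _ _
                                    linarith) h2).trans ?_
        rw [Real.log_mul (by positivity) (by positivity), hRr, Real.log_exp]
      show G _ < c
      rw [h.G_Hiit, div_lt_iff₀ hdn0]
      nlinarith
    have hFd : ∀ s ∈ Metric.closedBall (0 : ℂ) Rr, DifferentiableAt ℂ F s := by
      intro s hs
      have h1 : DifferentiableAt ℂ f ((Hinv a p)^[n] (ℓ s)) :=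
        hfd.differentiableAt ((h.isOpen_Om c).mem_nhds (hℓ s (by simpa using hs)))
      have h2 : DifferentiableAt ℂ ℓ s := by fun_prop
      exact h1.comp s (((h.Hiit_diff n) _).comp s h2)
    have hs1 : ∀ s : ℂ, ‖s‖ = r → G (F s) ≤ G (f z) + ε := by
      intro s hs
      have h1 : ‖ℓ s - H^[n] z‖ * Λ ^ n ≤ ρ' := by
        have : ℓ s - H^[n] z = s • (w' - w) := by simp [ℓ, hw]
        rw [this, norm_smul, hs]
        calc r * ‖w' - w‖ * Λ ^ n ≤ r * (2 * B) * Λ ^ n := by gcongr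
          _ = ρ' := by rw [hr]; field_simp
      have h2 := h.pullback_ball hB1' hΛ1 hΛ n (ℓ s) (h1.trans hρ'1)
      refine (hball ?_).le
      rw [dist_eq_norm]
      linarith
    have hs2 : ∀ s : ℂ, ‖s‖ = Rr → G (F s) ≤ c := fun s hs => (hmaps (hℓ s hs.le)).le
    have key := h.hadamard hr0 (hr1.trans hRr1) hFd hs1 hs2 (s := 1) (by simpa using hr1.le)
      (by simpa using hRr1.le)
    have hF1 : F 1 = f z' := by
      simp only [F, ℓ, one_smul, add_sub_cancel, hw', h.Hi_H_it]
    rw [hF1] at key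
    simp only [norm_one, Real.log_one, zero_sub] at key
    have hlr : 0 < - Real.log r := by
      have := Real.log_neg hr0 hr1
      linarith
    have hlR : Real.log Rr = d ^ n * (c / 2) := by rw [hRr, Real.log_exp]
    rw [hlR] at key
    rw [← hlogr]
    have hD : 0 < (d : ℝ) ^ n * (c / 2) := by positivity
    have hτ : - Real.log r / (d ^ n * (c / 2) - Real.log r) ≤ - Real.log r / (d ^ n * (c / 2)) := by
      apply div_le_div_of_nonneg_left hlr.le hD
      linarith
    have hτ0 : 0 ≤ - Real.log r / (d ^ n * (c / 2) - Real.log r) := by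
      apply div_nonneg hlr.le; linarith
    have := h.hGnonneg (f z)
    nlinarith
  refine ge_of_tendsto ?_ main
  have hlim : Tendsto (fun n : ℕ => (Real.log (2 * B / ρ') + n * Real.log Λ) / (d ^ n * (c / 2)) * c)
      atTop (𝓝 0) := by
    have h1 : Tendsto (fun n : ℕ => (n : ℝ) ^ 1 / (d : ℝ) ^ n) atTop (𝓝 0) :=
      tendsto_pow_const_div_const_pow_of_one_lt 1 h.one_lt_d
    have h2 : Tendsto (fun n : ℕ => Real.log (2 * B / ρ') / (d : ℝ) ^ n) atTop (𝓝 0) :=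
      tendsto_const_nhds.div_atTop hdn
    have h3 := (h2.add (h1.mul_const (Real.log Λ))).mul_const 2
    simp only [zero_mul, add_zero] at h3
    refine h3.congr fun n => ?_
    have := h.d_pos
    field_simp
  simpa using hlim.const_add (G (f z) + ε)

end HD

end constK

section caseone

variable {d : ℕ} {a : ℂ} {p : Polynomial ℂ} {H : ℂ × ℂ → ℂ × ℂ} {G : ℂ × ℂ → ℝ}

namespace HD

variable (h : HD d a p H G)
include h

lemma slice_compact (x : ℂ) (c' : ℝ) : IsCompact {y : ℂ | G (x, y) ≤ c'} := by
  obtain ⟨R, hR⟩ := h.exists_dom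
  have hcont : Continuous fun y : ℂ => G (x, y) := h.hGcont.comp (by fun_prop)
  refine Metric.isCompact_of_isClosed_isBounded (isClosed_le hcont continuous_const) ?_
  rw [isBounded_iff_forall_norm_le]
  refine ⟨max (max R ‖x‖) (2 * Real.exp c'), fun y hy => ?_⟩
  refine (h.slice_bound hR (x, y)).trans ?_
  have : Real.exp (G (x, y)) ≤ Real.exp c' := Real.exp_le_exp.2 hy
  exact max_le_max le_rfl (by linarith)

lemma le_of_K {c : ℝ} {f : ℂ × ℂ → ℂ × ℂ} (hfd : DifferentiableOn ℂ f {z | G z < c})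
    (hmaps : MapsTo f {z | G z < c} {z | G z < c}) (hK0 : ∀ z, G z = 0 → G (f z) = 0)
    {z : ℂ × ℂ} (hz : G z < c) : G (f z) ≤ G z := by
  obtain ⟨R, hR⟩ := h.exists_dom
  obtain ⟨x, y0⟩ := z
  have hcont : Continuous fun y : ℂ => G (x, y) := h.hGcont.comp (by fun_prop)
  have claim : ∀ c', G (x, y0) < c' → c' < c → G (f (x, y0)) - G (x, y0) ≤ c - c' := by
    intro c' hc1 hc2
    by_contra! hcon
    let φ : ℂ → ℝ := fun y => G (f (x, y)) - G (x, y)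
    have hS := h.slice_compact x c'
    have hpd : ∀ y : ℂ, DifferentiableAt ℂ (fun y : ℂ => (x, y)) y := fun y =>
      (differentiableAt_const _).prodMk differentiableAt_id
    have hFd : ∀ y, G (x, y) ≤ c' → DifferentiableAt ℂ (fun y => f (x, y)) y := by
      intro y hy
      have h1 : DifferentiableAt ℂ f (x, y) :=
        hfd.differentiableAt ((h.isOpen_Om c).mem_nhds (show G (x, y) < c by linarith))
      exact h1.comp y (hpd y)
    have hFc : ContinuousOn (fun y => f (x, y)) {y : ℂ | G (x, y) ≤ c'} := fun y hy =>
      (hFd y hy).continuousAt.continuousWithinAt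
    have hφc : ContinuousOn φ {y : ℂ | G (x, y) ≤ c'} :=
      (h.hGcont.comp_continuousOn hFc).sub hcont.continuousOn
    obtain ⟨s', hs1, hs2⟩ := exists_between hcon
    have hT : IsCompact ({y : ℂ | G (x, y) ≤ c'} ∩ φ ⁻¹' Ici s') :=
      hS.of_isClosed_subset (hφc.preimage_isClosed_of_isClosed hS.isClosed isClosed_Ici)
        inter_subset_left
    have hy0T : y0 ∈ {y : ℂ | G (x, y) ≤ c'} ∩ φ ⁻¹' Ici s' := ⟨hc1.le, hs2.le⟩
    obtain ⟨y1, hy1T, hy1⟩ := hT.exists_isMinOn ⟨y0, hy0T⟩ hcont.continuousOn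
    have hy1pos : 0 < G (x, y1) := by
      refine lt_of_le_of_ne (h.hGnonneg _) fun h0 => ?_
      have h1 : s' ≤ φ y1 := hy1T.2
      have h2 := hK0 _ h0.symm
      simp only [φ, h2, ← h0] at h1
      linarith
    set δ := G (x, y1) / 2 with hδ
    have hδT : ∀ y, G (x, y) ≤ c' → G (x, y) ≤ δ → φ y < s' := by
      intro y hy hyδ
      by_contra! hc
      have : G (x, y1) ≤ G (x, y) := hy1 ⟨hy, hc⟩
      linarith
    have hδy0 : δ < G (x, y0) := by
      have : G (x, y1) ≤ G (x, y0) := hy1 hy0T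
      linarith
    let U : Set ℂ := {y | δ < G (x, y) ∧ G (x, y) < c'}
    have hUo : IsOpen U := (isOpen_lt continuous_const hcont).inter (isOpen_lt hcont continuous_const)
    have hcl : closure U ⊆ {y | δ ≤ G (x, y) ∧ G (x, y) ≤ c'} :=
      closure_minimal (fun y hy => ⟨hy.1.le, hy.2.le⟩)
        ((isClosed_le continuous_const hcont).inter (isClosed_le hcont continuous_const))
    have hclS : closure U ⊆ {y | G (x, y) ≤ c'} := fun y hy => (hcl hy).2
    have hUc : IsCompact (closure U) := hS.of_isClosed_subset isClosed_closure hclS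
    have hUb : Bornology.IsBounded U := hUc.isBounded.subset subset_closure
    have hfr : ∀ y ∈ frontier U, φ y ≤ s' := by
      intro y hy
      have hy1 := hcl hy.1
      rcases eq_or_lt_of_le hy1.1 with h1 | h1
      · exact (hδT y hy1.2 h1.symm.le).le
      rcases eq_or_lt_of_le hy1.2 with h2 | h2
      · have : G (f (x, y)) < c := hmaps (show G (x, y) < c by linarith)
        simp only [φ]
        linarith
      · exact absurd (show y ∈ U from ⟨h1, h2⟩) (by rw [hUo.frontier_eq] at hy; exact hy.2)
    set ε := (φ y0 - s') / 5 with hε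
    have hε0 : 0 < ε := by have : s' < φ y0 := hs2; simp only [hε]; linarith
    have hC1 : IsCompact ((fun y : ℂ => (x, y)) '' closure U) :=
      hUc.image (by fun_prop)
    have hC2 : IsCompact ((fun y : ℂ => f (x, y)) '' closure U) :=
      hUc.image_of_continuousOn (hFc.mono hclS)
    obtain ⟨k, hk1, hk2, hk3⟩ := ((h.unif hC1 hε0).and ((h.unif hC2 hε0).and
      (h.compact_V hR hC1 (by
        rintro _ ⟨y, hy, rfl⟩
        have := (hcl hy).1
        show 0 < G (x, y)
        linarith)))).exists
    have hdk : (0 : ℝ) < d ^ k := by have := h.d_pos; positivity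
    let Ψ : ℂ → (ℂ × ℂ) × ℂ := fun y =>
      ((H^[k] (x, y)).2)⁻¹ • (H^[k] (f (x, y)), (1 : ℂ))
    have hV : ∀ y ∈ closure U, H^[k] (x, y) ∈ VR R := fun y hy => hk3 _ ⟨y, hy, rfl⟩
    have hne : ∀ y ∈ closure U, (H^[k] (x, y)).2 ≠ 0 := by
      intro y hy h0
      have h1 := (hV y hy).1
      rw [h0, norm_zero] at h1
      linarith [hR.1]
    have hΨ : ∀ y ∈ closure U, ‖Ψ y‖ =
        Real.exp (d ^ k * (Lk d H k (f (x, y)) - Lk d H k (x, y))) := by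
      intro y hy
      have h1 : ‖(H^[k] (x, y)).2‖ = Real.exp (d ^ k * Lk d H k (x, y)) := by
        rw [← h.exp_Lk, V_norm hR (hV y hy)]
      simp only [Ψ]
      rw [norm_smul, norm_inv, h1, Prod.norm_mk, norm_one, h.exp_Lk, mul_sub, Real.exp_sub]
      field_simp
    have hΨd : DiffContOnCl ℂ Ψ U := by
      refine DifferentiableOn.diffContOnCl fun y hy => DifferentiableAt.differentiableWithinAt ?_
      have h1 : DifferentiableAt ℂ (fun y => H^[k] (x, y)) y := ((h.Hit_diff k) _).comp y (hpd y)
      have h2 : DifferentiableAt ℂ (fun y => H^[k] (f (x, y))) y :=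
        ((h.Hit_diff k) _).comp y (hFd y (hclS hy))
      exact (h1.snd.inv (hne y hy)).smul (h2.prodMk (differentiableAt_const _))
    have hmax := Complex.norm_le_of_forall_mem_frontier_norm_le hUb hΨd
      (C := Real.exp (d ^ k * (s' + 2 * ε))) (by
        intro y hy
        have hyc := frontier_subset_closure hy
        rw [hΨ y hyc, Real.exp_le_exp]
        have h1 := hk1 _ ⟨y, hyc, rfl⟩
        have h2 := hk2 _ ⟨y, hyc, rfl⟩
        have h3 := hfr y hy
        simp only [φ] at h3
        rw [abs_lt] at h1 h2
        gcongr
        linarith) (z := y0) (subset_closure ⟨hδy0, hc1⟩)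
    have hy0c : y0 ∈ closure U := subset_closure ⟨hδy0, hc1⟩
    rw [hΨ y0 hy0c, Real.exp_le_exp] at hmax
    have hm := le_of_mul_le_mul_left hmax hdk
    have h1 := hk1 _ ⟨y0, hy0c, rfl⟩
    have h2 := hk2 _ ⟨y0, hy0c, rfl⟩
    rw [abs_lt] at h1 h2
    have : φ y0 = G (f (x, y0)) - G (x, y0) := rfl
    linarith
  refine le_of_forall_pos_le_add fun ε hε => ?_
  have h1 := claim (max ((G (x, y0) + c) / 2) (c - ε)) (lt_max_of_lt_left (by linarith))
    (max_lt (by linarith) (by linarith))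
  have h2 : c - ε ≤ max ((G (x, y0) + c) / 2) (c - ε) := le_max_right _ _
  linarith

end HD

end caseone

section casetwo

variable {d : ℕ} {a : ℂ} {p : Polynomial ℂ} {H : ℂ × ℂ → ℂ × ℂ} {G : ℂ × ℂ → ℝ}

lemma exists_log_ball {Rr : ℝ} (hRr : 0 < Rr) {h : ℂ → ℂ}
    (hd : DifferentiableOn ℂ h (Metric.ball 0 Rr)) (hne : ∀ s ∈ Metric.ball (0 : ℂ) Rr, h s ≠ 0) :
    ∃ q : ℂ → ℂ, DifferentiableOn ℂ q (Metric.ball 0 Rr) ∧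
      ∀ s ∈ Metric.ball (0 : ℂ) Rr, Complex.exp (q s) = h s := by
  have hd' : DifferentiableOn ℂ (fun s => deriv h s / h s) (Metric.ball 0 Rr) :=
    (hd.deriv Metric.isOpen_ball).div hd hne
  obtain ⟨q, hq0, hq⟩ := hd'.isExactOn_ball.with_val_at 0 (Complex.log (h 0))
  have h0 : (0 : ℂ) ∈ Metric.ball (0 : ℂ) Rr := by simpa using hRr
  have hqd : DifferentiableOn ℂ q (Metric.ball 0 Rr) := fun s hs =>
    (hq s hs).differentiableAt.differentiableWithinAt
  refine ⟨q, hqd, fun s hs => ?_⟩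
  have hder : ∀ s ∈ Metric.ball (0 : ℂ) Rr, HasDerivAt (fun s => h s * Complex.exp (- q s)) 0 s := by
    intro s hs
    have h1 := (hd.differentiableAt (Metric.isOpen_ball.mem_nhds hs)).hasDerivAt
    have h2 := h1.mul (hq s hs).neg.cexp
    refine h2.congr_deriv ?_
    have := hne s hs
    simp only [Pi.neg_apply]
    field_simp
    ring
  have hconst := Metric.isOpen_ball.is_const_of_deriv_eq_zero
    (convex_ball (0 : ℂ) Rr).isPreconnected
    (fun s hs => (hder s hs).differentiableAt.differentiableWithinAt)
    (fun s hs => (hder s hs).deriv) hs h0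
  simp only [hq0, Complex.exp_neg, Complex.exp_log (hne 0 h0), mul_inv_cancel₀ (hne 0 h0)] at hconst
  have := Complex.exp_ne_zero (q s)
  field_simp at hconst
  exact hconst.symm

namespace HD

variable (h : HD d a p H G)
include h

lemma schwarz_G {F : ℂ → ℂ × ℂ} {Rr c : ℝ} (hRr : 1 < Rr)
    (hF : ∀ s ∈ Metric.closedBall (0 : ℂ) Rr, DifferentiableAt ℂ F s)
    (hG : ∀ s ∈ Metric.closedBall (0 : ℂ) Rr, 0 < G (F s) ∧ G (F s) < c) :
    |Real.exp (G (F 1)) - Real.exp (G (F 0))| ≤ 2 * Real.exp (c + 1) / Rr := by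
  obtain ⟨R, hR⟩ := h.exists_dom
  have hcontF : ContinuousOn F (Metric.closedBall (0 : ℂ) Rr) := fun z hz =>
    (hF z hz).continuousAt.continuousWithinAt
  have hcomp : IsCompact (F '' Metric.closedBall (0 : ℂ) Rr) :=
    (isCompact_closedBall _ _).image_of_continuousOn hcontF
  have hlim : Tendsto (fun k => |Real.exp (Lk d H k (F 1)) - Real.exp (Lk d H k (F 0))|) atTop
      (𝓝 |Real.exp (G (F 1)) - Real.exp (G (F 0))|) :=
    (((Real.continuous_exp.tendsto _).comp (h.Lk_tendsto (F 1))).sub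
      ((Real.continuous_exp.tendsto _).comp (h.Lk_tendsto (F 0)))).abs
  refine le_of_tendsto hlim ?_
  filter_upwards [h.unif hcomp one_pos, h.compact_V hR hcomp (by
    rintro _ ⟨s, hs, rfl⟩; exact (hG s hs).1)] with k hk1 hk2
  have hdk : (0 : ℝ) < d ^ k := by have := h.d_pos; positivity
  have hsub : ∀ s ∈ Metric.ball (0 : ℂ) Rr, s ∈ Metric.closedBall (0 : ℂ) Rr :=
    fun s hs => Metric.ball_subset_closedBall hs
  obtain ⟨q, hqd, hq⟩ := exists_log_ball (by linarith) (h := fun s => (H^[k] (F s)).2)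
    (Rr := Rr) (fun s hs => by
      have h1 : DifferentiableAt ℂ (fun s => H^[k] (F s)) s :=
        ((h.Hit_diff k) _).comp s (hF s (hsub s hs))
      exact h1.snd.differentiableWithinAt) (fun s hs h0 => by
      have h1 := (hk2 _ ⟨s, hsub s hs, rfl⟩).1
      rw [h0, norm_zero] at h1
      linarith [hR.1])
  let Φ : ℂ → ℂ := fun s => Complex.exp (q s / d ^ k)
  have hΦd : DifferentiableOn ℂ Φ (Metric.ball 0 Rr) := (hqd.div_const _).cexp
  have hΦ : ∀ s ∈ Metric.ball (0 : ℂ) Rr, ‖Φ s‖ = Real.exp (Lk d H k (F s)) := by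
    intro s hs
    rw [h.V_Lk hR (hk2 _ ⟨s, hsub s hs, rfl⟩), ← hq s hs, Complex.norm_exp (q s), Real.log_exp]
    simp only [Φ, Complex.norm_exp]
    have : q s / (d : ℂ) ^ k = q s / (((d : ℝ) ^ k : ℝ) : ℂ) := by push_cast; rfl
    rw [this, Complex.div_ofReal_re]
  have hΦb : ∀ s ∈ Metric.ball (0 : ℂ) Rr, ‖Φ s‖ ≤ Real.exp (c + 1) := by
    intro s hs
    rw [hΦ s hs, Real.exp_le_exp]
    have h1 := hk1 _ ⟨s, hsub s hs, rfl⟩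
    have h2 := (hG s (hsub s hs)).2
    rw [abs_lt] at h1
    linarith
  have h0 : (0 : ℂ) ∈ Metric.ball (0 : ℂ) Rr := by simp; linarith
  have h1 : (1 : ℂ) ∈ Metric.ball (0 : ℂ) Rr := by simpa using hRr
  have key := Complex.dist_le_div_mul_dist_of_mapsTo_ball (R₂ := 2 * Real.exp (c + 1)) hΦd (by
    intro s hs
    rw [Metric.mem_closedBall, dist_eq_norm]
    have := norm_sub_le (Φ s) (Φ 0)
    have := hΦb s hs
    have := hΦb 0 h0
    linarith) h1
  rw [← hΦ 1 h1, ← hΦ 0 h0]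
  refine (abs_norm_sub_norm_le _ _).trans ?_
  rw [← dist_eq_norm]
  simpa using key

lemma const_sub {c M : ℝ} (hMc : M ≤ c) {g : ℂ × ℂ → ℂ × ℂ}
    (hgd : DifferentiableOn ℂ g {z | G z < c})
    (hg : ∀ z, G z < M → 0 < G (g z) ∧ G (g z) < c) {z z1 : ℂ × ℂ} (hz : G z = 0) (hz1 : G z1 < M) :
    G (g z1) = G (g z) := by
  obtain ⟨B1, hB1⟩ := h.orbit_bdd hz
  set B := max 1 B1 with hBdef
  have hB1' : ∀ n, ‖H^[n] z‖ ≤ B := fun n => (hB1 n).trans (le_max_right _ _)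
  have hB0 : 1 ≤ B := le_max_left _ _
  obtain ⟨C1, hC1, hG⟩ := h.G_upper
  set γ := (M - G z1) / 3 with hγ
  have hγ0 : 0 < γ := by simp only [hγ]; linarith
  have hdn : Tendsto (fun n : ℕ => (d : ℝ) ^ n) atTop atTop :=
    tendsto_pow_atTop_atTop_of_one_lt h.one_lt_d
  have main : ∀ᶠ n : ℕ in atTop, |Real.exp (G (g z1)) - Real.exp (G (g z))| ≤
      2 * Real.exp (c + 1) / Real.exp (d ^ n * γ) := by
    filter_upwards [(hdn.atTop_mul_const hγ0).eventually_gt_atTop (Real.log (3 * B) + C1),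
      h.orbit_growth z1 (show G z1 < G z1 + γ by linarith)] with n hn hgr
    set w := H^[n] z with hw
    set w' := H^[n] z1 with hw'
    let ℓ : ℂ → ℂ × ℂ := fun s => w + s • (w' - w)
    let F : ℂ → ℂ × ℂ := fun s => g ((Hinv a p)^[n] (ℓ s))
    have hdn0 : (0 : ℝ) < d ^ n := by have := h.d_pos; positivity
    set E := Real.exp ((G z1 + γ) * d ^ n) with hE
    have hE1 : 1 ≤ E := Real.one_le_exp (by have := h.hGnonneg z1; positivity)
    have hww : ‖w' - w‖ ≤ 2 * B * E := by
      have := norm_sub_le w' w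
      have := hB1' n
      nlinarith
    set Rr := Real.exp (d ^ n * γ) with hRr
    have hRr1 : 1 < Rr := Real.one_lt_exp_iff.2 (by positivity)
    have hℓ : ∀ s : ℂ, ‖s‖ ≤ Rr → G ((Hinv a p)^[n] (ℓ s)) < M := by
      intro s hs
      have hBE : B ≤ B * E := le_mul_of_one_le_right (by linarith) hE1
      have h1 : ‖ℓ s‖ ≤ 3 * B * E * Rr := by
        calc ‖ℓ s‖ ≤ ‖w‖ + ‖s‖ * ‖w' - w‖ := by
              refine (norm_add_le _ _).trans ?_
              rw [norm_smul]
          _ ≤ B + Rr * (2 * B * E) := by gcongr; exact hB1' n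
          _ ≤ _ := by nlinarith
      have h2 : max ‖ℓ s‖ 1 ≤ 3 * B * E * Rr := max_le h1 (by nlinarith)
      have h3 := hG (ℓ s)
      have h4 : Real.log (max ‖ℓ s‖ 1) ≤ Real.log (3 * B) + (G z1 + γ) * d ^ n + d ^ n * γ := by
        refine (Real.log_le_log (by have : 1 ≤ max ‖ℓ s‖ 1 := le_max_right _ _
                                    linarith) h2).trans ?_
        rw [Real.log_mul (by positivity) (by positivity), Real.log_mul (by positivity)
          (by positivity), hRr, hE, Real.log_exp, Real.log_exp]
      rw [h.G_Hiit, div_lt_iff₀ hdn0]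
      have hM : M = G z1 + 3 * γ := by simp only [hγ]; ring
      rw [hM]
      nlinarith
    have hFd : ∀ s ∈ Metric.closedBall (0 : ℂ) Rr, DifferentiableAt ℂ F s := by
      intro s hs
      have h1 : DifferentiableAt ℂ g ((Hinv a p)^[n] (ℓ s)) :=
        hgd.differentiableAt ((h.isOpen_Om c).mem_nhds
          ((hℓ s (by simpa using hs)).trans_le hMc))
      have h2 : DifferentiableAt ℂ ℓ s := by fun_prop
      exact h1.comp s (((h.Hiit_diff n) _).comp s h2)
    have key := h.schwarz_G hRr1 hFd (c := c) (fun s hs => hg _ (hℓ s (by simpa using hs)))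
    have hF1 : F 1 = g z1 := by
      simp only [F, ℓ, one_smul, add_sub_cancel, hw', h.Hi_H_it]
    have hF0 : F 0 = g z := by
      simp only [F, ℓ, zero_smul, add_zero, hw, h.Hi_H_it]
    rwa [hF1, hF0] at key
  have hlim : Tendsto (fun n : ℕ => 2 * Real.exp (c + 1) / Real.exp ((d : ℝ) ^ n * γ)) atTop (𝓝 0) :=
    tendsto_const_nhds.div_atTop (Real.tendsto_exp_atTop.comp (hdn.atTop_mul_const hγ0))
  have h0 := ge_of_tendsto hlim main
  have h1 := abs_eq_zero.1 (le_antisymm h0 (abs_nonneg _))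
  exact Real.exp_injective (sub_eq_zero.1 h1)

end HD

end casetwo

section nonconst

variable {d : ℕ} {a : ℂ} {p : Polynomial ℂ} {H : ℂ × ℂ → ℂ × ℂ} {G : ℂ × ℂ → ℝ}

namespace HD

variable (h : HD d a p H G)
include h

/-- On the slices of the escape region, `exp G` is the modulus of a holomorphic function. -/
lemma exists_bottcher {R : ℝ} (hR : Dom d a p R) (x : ℂ) :
    ∃ F : ℂ → ℂ, DifferentiableOn ℂ F {y | max R ‖x‖ < ‖y‖} ∧
      ∀ y, max R ‖x‖ < ‖y‖ → ‖F y‖ = Real.exp (G (x, y)) := by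
  have hdp := h.d_pos
  let D : Set ℂ := {y | max R ‖x‖ < ‖y‖}
  have hDo : IsOpen D := isOpen_lt continuous_const continuous_norm
  let Y : ℕ → ℂ → ℂ := fun j y => (H^[j] (x, y)).2
  have hYd : ∀ j, Differentiable ℂ (Y j) := by
    intro j y
    have h1 : DifferentiableAt ℂ (fun y : ℂ => (x, y)) y :=
      (differentiableAt_const _).prodMk differentiableAt_id
    have h2 : DifferentiableAt ℂ (fun y => H^[j] (x, y)) y := ((h.Hit_diff j) _).comp y h1
    exact h2.snd
  have hDV : ∀ y ∈ D, ∀ j, H^[j] (x, y) ∈ VR R := by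
    intro y hy j
    have hy' : max R ‖x‖ < ‖y‖ := hy
    rw [max_lt_iff] at hy'
    exact h.V_it hR (z := (x, y)) ⟨hy'.1, hy'.2⟩ j
  have hY4 : ∀ y ∈ D, ∀ j, 4 < ‖Y j y‖ := fun y hy j => lt_of_le_of_lt hR.1 (hDV y hy j).1
  have hYne : ∀ y ∈ D, ∀ j, Y j y ≠ 0 := fun y hy j h0 => by
    have := hY4 y hy j
    rw [h0, norm_zero] at this
    linarith
  have hq : ∀ y ∈ D, ∀ j, ‖Y (j + 1) y / Y j y ^ d - 1‖ ≤ 1 / 2 := by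
    intro y hy j
    have hV := hDV y hy j
    have h1 := hR.2 _ _ hV.1.le hV.2.le
    have h2 : Y (j + 1) y = p.eval (H^[j] (x, y)).2 - a * (H^[j] (x, y)).1 := by
      simp only [Y, Function.iterate_succ_apply', h.hH]
    have h3 : Y (j + 1) y / Y j y ^ d - 1 = (Y (j + 1) y - Y j y ^ d) / Y j y ^ d := by
      have := hYne y hy j
      field_simp
    have h4 : 0 < ‖Y j y‖ := by linarith [hY4 y hy j]
    rw [h3, norm_div, norm_pow, div_le_iff₀ (by positivity), h2]
    refine h1.trans (le_of_eq ?_)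
    simp only [Y]
    ring
  let T : ℕ → ℂ → ℂ := fun j y => Complex.log (Y (j + 1) y / Y j y ^ d) / d ^ (j + 1)
  have hTd : ∀ j, DifferentiableOn ℂ (T j) D := by
    intro j y hy
    have h1 : DifferentiableAt ℂ (fun y => Y (j + 1) y / Y j y ^ d) y :=
      ((hYd (j + 1)) y).div (((hYd j) y).pow d) (pow_ne_zero _ (hYne y hy j))
    have h2 : Y (j + 1) y / Y j y ^ d ∈ Complex.slitPlane := by
      have := Complex.mem_slitPlane_of_norm_lt_one (z := Y (j + 1) y / Y j y ^ d - 1)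
        (lt_of_le_of_lt (hq y hy j) (by norm_num))
      simpa using this
    exact ((h1.clog h2).div_const _).differentiableWithinAt
  have hTb : ∀ j, ∀ y ∈ D, ‖T j y‖ ≤ (1 / (d : ℝ)) ^ (j + 1) := by
    intro j y hy
    have h1 := Complex.norm_log_one_add_half_le_self (hq y hy j)
    rw [add_sub_cancel] at h1
    have h2 := hq y hy j
    simp only [T]
    rw [norm_div, norm_pow, Complex.norm_natCast, one_div, inv_pow, ← one_div]
    gcongr
    linarith
  have hsumm : Summable fun j : ℕ => (1 / (d : ℝ)) ^ (j + 1) := by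
    refine (summable_nat_add_iff 1).2 (summable_geometric_of_lt_one (by positivity) ?_)
    rw [div_lt_one hdp]
    exact h.one_lt_d
  let η : ℂ → ℂ := fun y => ∑' j, T j y
  have hηd : DifferentiableOn ℂ η D :=
    Complex.differentiableOn_tsum_of_summable_norm hsumm hTd hDo hTb
  refine ⟨fun y => y * Complex.exp (η y), differentiableOn_id.mul hηd.cexp, fun y hy => ?_⟩
  have hTs : HasSum (fun j => T j y) (η y) :=
    (Summable.of_norm_bounded hsumm (fun j => hTb j y hy)).hasSum
  have h1 := (Complex.hasSum_re hTs).tendsto_sum_nat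
  have hpart : ∀ k, ∑ j ∈ Finset.range k, (T j y).re = Lk d H k (x, y) - Real.log ‖y‖ := by
    intro k
    induction k with
    | zero =>
      have := h.V_Lk hR (hDV y hy 0)
      simp [this]
    | succ k ih =>
      rw [Finset.sum_range_succ, ih, h.V_Lk hR (hDV y hy k), h.V_Lk hR (hDV y hy (k + 1))]
      have h2 : (T k y).re = Real.log ‖Y (k + 1) y / Y k y ^ d‖ / d ^ (k + 1) := by
        simp only [T]
        have : ((d : ℂ) ^ (k + 1)) = (((d : ℝ) ^ (k + 1) : ℝ) : ℂ) := by push_cast; rfl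
        rw [this, Complex.div_ofReal_re, Complex.log_re]
      have h3 : 0 < ‖Y k y‖ := by linarith [hY4 y hy k]
      have h4 : 0 < ‖Y (k + 1) y‖ := by linarith [hY4 y hy (k + 1)]
      rw [h2, norm_div, norm_pow, Real.log_div (by positivity) (by positivity), Real.log_pow]
      show Real.log ‖Y k y‖ / d ^ k - Real.log ‖y‖ +
        (Real.log ‖Y (k + 1) y‖ - d * Real.log ‖Y k y‖) / d ^ (k + 1) =
        Real.log ‖Y (k + 1) y‖ / d ^ (k + 1) - Real.log ‖y‖
      field_simp
      ring
  have h2 : Tendsto (fun k => ∑ j ∈ Finset.range k, (T j y).re) atTop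
      (𝓝 (G (x, y) - Real.log ‖y‖)) := by
    simp only [hpart]
    exact (h.Lk_tendsto (x, y)).sub_const _
  have h3 := tendsto_nhds_unique h1 h2
  have hy0 : 0 < ‖y‖ := by
    have : max R ‖x‖ < ‖y‖ := hy
    have := le_max_left R ‖x‖
    linarith [hR.1]
  rw [norm_mul, Complex.norm_exp, h3, Real.exp_sub, Real.exp_log hy0]
  field_simp

lemma not_loc_const {e : ℂ × ℂ} (he : 0 < G e) (hloc : ∀ᶠ z in 𝓝 e, G z = G e) : False := by
  obtain ⟨R, hR⟩ := h.exists_dom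
  obtain ⟨n, hn⟩ := h.exists_V hR he
  have hdn : (0 : ℝ) < d ^ n := by have := h.d_pos; positivity
  obtain ⟨x, y0, hv⟩ : ∃ x y0, H^[n] e = (x, y0) := ⟨_, _, rfl⟩
  have hev : ∀ᶠ w in 𝓝 (x, y0), G w = G (x, y0) := by
    have h1 : Tendsto ((Hinv a p)^[n]) (𝓝 (x, y0)) (𝓝 e) := by
      have := (h.Hiit_diff n).continuous.tendsto (x, y0)
      rwa [← hv, h.Hi_H_it, hv] at this
    filter_upwards [h1.eventually hloc] with w hw
    rw [h.G_Hiit, div_eq_iff hdn.ne'] at hw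
    rw [hw, ← hv, h.G_Hit]
    ring
  have hev' : ∀ᶠ y in 𝓝 y0, G (x, y) = G (x, y0) := by
    have : Tendsto (fun y : ℂ => (x, y)) (𝓝 y0) (𝓝 (x, y0)) :=
      (by fun_prop : Continuous fun y : ℂ => (x, y)).tendsto y0
    exact this.eventually hev
  rw [hv] at hn
  obtain ⟨hn1, hn2⟩ := hn
  simp only at hn1 hn2
  obtain ⟨F, hFd, hF⟩ := h.exists_bottcher hR x
  have hDo : IsOpen {y : ℂ | max R ‖x‖ < ‖y‖} := isOpen_lt continuous_const continuous_norm
  have hy0 : max R ‖x‖ < ‖y0‖ := max_lt hn1 hn2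
  have hloc2 : ∀ᶠ y in 𝓝 y0, F y = F y0 := by
    refine Complex.eventually_eq_of_isLocalMax_norm ?_ ?_
    · filter_upwards [hDo.mem_nhds hy0] with y hy
      exact hFd.differentiableAt (hDo.mem_nhds hy)
    · filter_upwards [hDo.mem_nhds hy0, hev'] with y hy hy2
      simp only [Function.comp, hF y hy, hF y0 hy0, hy2, le_refl]
  set K0 := Real.exp (G (x, y0) + 1) with hK0
  have hK1 : 1 ≤ K0 := Real.one_le_exp (by have := h.hGnonneg (x, y0); linarith)
  have hy04 : 4 < ‖y0‖ := lt_of_le_of_lt hR.1 hn1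
  have hnorm : ‖(K0 : ℂ) * y0‖ = K0 * ‖y0‖ := by
    rw [norm_mul, Complex.norm_real, Real.norm_of_nonneg (by linarith)]
  let Bl := Metric.ball ((K0 : ℂ) * y0) (K0 * ‖y0‖ - max R ‖x‖)
  have hBl : Bl ⊆ {y : ℂ | max R ‖x‖ < ‖y‖} := by
    intro y hy
    have h1 : ‖y - K0 * y0‖ < K0 * ‖y0‖ - max R ‖x‖ := by simpa [Bl, dist_eq_norm] using hy
    have h2 := norm_sub_norm_le ((K0 : ℂ) * y0) y
    rw [hnorm, norm_sub_rev] at h2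
    show max R ‖x‖ < ‖y‖
    linarith
  have hy0B : y0 ∈ Bl := by
    have h1 : y0 - K0 * y0 = ((1 - K0 : ℝ) : ℂ) * y0 := by push_cast; ring
    have h2 : ‖y0 - K0 * y0‖ = (K0 - 1) * ‖y0‖ := by
      rw [h1, norm_mul, Complex.norm_real, Real.norm_eq_abs, abs_of_nonpos (by linarith)]
      ring
    simp only [Bl, Metric.mem_ball, dist_eq_norm, h2]
    linarith
  have hKB : (K0 : ℂ) * y0 ∈ Bl := by
    simp only [Bl, Metric.mem_ball, dist_self]
    nlinarith
  have heq := ((hFd.mono hBl).analyticOnNhd Metric.isOpen_ball).eqOn_of_preconnected_of_eventuallyEq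
    (analyticOnNhd_const (v := F y0)) (convex_ball _ _).isPreconnected hy0B hloc2 hKB
  have h1 := congrArg norm heq
  simp only at h1
  rw [hF _ (hBl hKB), hF _ hy0] at h1
  have h2 := Real.exp_injective h1
  have h3 : max R ‖x‖ < ‖(K0 : ℂ) * y0‖ := hBl hKB
  have h4 := h.G_lower hR (z := (x, (K0 : ℂ) * y0))
    ⟨(le_max_left _ _).trans_lt h3, (le_max_right _ _).trans_lt h3⟩
  simp only [hnorm] at h4
  rw [Real.log_mul (by positivity) (by linarith), hK0, Real.log_exp, ← hK0, h2] at h4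
  have h5 : Real.log 2 < Real.log ‖y0‖ := Real.log_lt_log (by norm_num) (by linarith)
  linarith

end HD

end nonconst

lemma HD.G_eq {d : ℕ} {a : ℂ} {p : Polynomial ℂ} {H : ℂ × ℂ → ℂ × ℂ} {G : ℂ × ℂ → ℝ}
    (h : HD d a p H G) {c : ℝ} (hc : 0 < c) {f g : ℂ × ℂ → ℂ × ℂ}
    (hf : IsBiholoOn f g {z : ℂ × ℂ | G z < c} {z : ℂ × ℂ | G z < c}) :
    ∀ z, G z < c → G (f z) = G z := by
  obtain ⟨hfd, hgd, hfm, hgm, hgf, hfg⟩ := hf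
  obtain ⟨z0, hz0⟩ := h.exists_K
  have hz0c : G z0 < c := by linarith
  have hfK : ∀ z, G z = 0 → G (f z) = G (f z0) := fun z hz =>
    le_antisymm (h.const_K hc hfd hfm hz0 hz) (h.const_K hc hfd hfm hz hz0)
  have hgK : ∀ z, G z = 0 → G (g z) = G (g z0) := fun z hz =>
    le_antisymm (h.const_K hc hgd hgm hz0 hz) (h.const_K hc hgd hgm hz hz0)
  rcases eq_or_lt_of_le (h.hGnonneg (f z0)) with hM | hM
  · have hf0 : ∀ z, G z = 0 → G (f z) = 0 := fun z hz => by rw [hfK z hz, hM]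
    have hg0 : ∀ z, G z = 0 → G (g z) = 0 := fun z hz => by
      rw [hgK z hz, ← hgK (f z0) hM.symm, hgf z0 hz0c, hz0]
    intro z hz
    refine le_antisymm (h.le_of_K hfd hfm hf0 hz) ?_
    have := h.le_of_K hgd hgm hg0 (z := f z) (hfm hz)
    rwa [hgf z hz] at this
  · exfalso
    set M := G (f z0) with hMdef
    have hMc : M < c := hfm hz0c
    have hM' : 0 < G (g z0) := by
      refine lt_of_le_of_ne (h.hGnonneg _) fun h0 => ?_
      have := hfK _ h0.symm
      rw [hfg z0 hz0c, hz0] at this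
      linarith
    have hsub : ∀ w, G w < M → 0 < G (g w) ∧ G (g w) < c := by
      intro w hw
      have hwc : G w < c := hw.trans hMc
      refine ⟨lt_of_le_of_ne (h.hGnonneg _) fun h0 => ?_, hgm hwc⟩
      have := hfK _ h0.symm
      rw [hfg w hwc] at this
      linarith
    have hec : G (g z0) < c := hgm hz0c
    refine h.not_loc_const hM' ?_
    have hfc : ContinuousAt f (g z0) :=
      hfd.continuousOn.continuousAt ((h.isOpen_Om c).mem_nhds hec)
    have hev : ∀ᶠ z in 𝓝 (g z0), G (f z) < M := by
      refine (h.hGcont.continuousAt.comp hfc).eventually (gt_mem_nhds ?_)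
      simp only [Function.comp, hfg z0 hz0c, hz0]
      exact hM
    filter_upwards [hev, (h.isOpen_Om c).mem_nhds hec] with z hz1 hz2
    have := h.const_sub hMc.le hgd hsub hz0 hz1
    rwa [hgf z hz2] at this

/-- Let `c > 0` and let `f` be an automorphism of `Ω_c = {G⁺_H < c}`.
Then `f(K⁺) = K⁺`, `G⁺_H ∘ f = G⁺_H` on `Ω_c`, and `f(Ω_b) = Ω_b` for every
`0 < b < c`. In particular, the restriction of `f` to `Ω'_c = {0 < G⁺_H < c}` is an
automorphism of `Ω'_c`. -/
theorem stmt_1 (d : ℕ) (hd : 2 ≤ d) (a : ℂ) (ha : a ≠ 0)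
    (p : Polynomial ℂ) (hpm : p.Monic) (hpd : p.natDegree = d)
    (hpc : p.coeff (d - 1) = 0)
    (H : ℂ × ℂ → ℂ × ℂ) (hH : ∀ z : ℂ × ℂ, H z = (z.2, p.eval z.2 - a * z.1))
    (G : ℂ × ℂ → ℝ) (hGcont : Continuous G) (hGnonneg : ∀ z, 0 ≤ G z)
    (hGlim : ∀ z : ℂ × ℂ,
      Tendsto (fun n : ℕ => Real.log (max ‖H^[n] z‖ 1) / (d : ℝ) ^ n) atTop (𝓝 (G z)))
    (K : Set (ℂ × ℂ))
    (hK : K = {z : ℂ × ℂ | Bornology.IsBounded (Set.range fun n : ℕ => H^[n] z)})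
    (hKG : K = {z : ℂ × ℂ | G z = 0})
    (c : ℝ) (hc : 0 < c)
    (f g : ℂ × ℂ → ℂ × ℂ)
    (hf : IsBiholoOn f g {z : ℂ × ℂ | G z < c} {z : ℂ × ℂ | G z < c}) :
    f '' K = K ∧
    (∀ z ∈ {z : ℂ × ℂ | G z < c}, G (f z) = G z) ∧
    (∀ b : ℝ, 0 < b → b < c →
      f '' {z : ℂ × ℂ | G z < b} = {z : ℂ × ℂ | G z < b}) ∧
    IsBiholoOn f g {z : ℂ × ℂ | 0 < G z ∧ G z < c}
      {z : ℂ × ℂ | 0 < G z ∧ G z < c} := by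
  have h : HD d a p H G := ⟨hd, ha, hpm, hpd, hH, hGcont, hGnonneg, hGlim, fun z => by
    have h1 : z ∈ K ↔ Bornology.IsBounded (Set.range fun n : ℕ => H^[n] z) := by rw [hK]; rfl
    have h2 : z ∈ K ↔ G z = 0 := by rw [hKG]; rfl
    rw [← h1, h2]⟩
  have hfG := h.G_eq hc hf
  have hgG := h.G_eq hc (f := g) (g := f)
    ⟨hf.2.1, hf.1, hf.2.2.2.1, hf.2.2.1, hf.2.2.2.2.2, hf.2.2.2.2.1⟩
  obtain ⟨hfd, hgd, hfm, hgm, hgf, hfg⟩ := hf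
  refine ⟨?_, hfG, ?_, ?_⟩
  · rw [hKG]
    ext w
    constructor
    · rintro ⟨z, hz, rfl⟩
      have hz' : G z = 0 := hz
      show G (f z) = 0
      rw [hfG z (by linarith), hz']
    · intro hw
      have hw' : G w = 0 := hw
      refine ⟨g w, ?_, hfg w (show G w < c by linarith)⟩
      show G (g w) = 0
      rw [hgG w (by linarith), hw']
  · intro b hb hbc
    ext w
    constructor
    · rintro ⟨z, hz, rfl⟩
      have hz' : G z < b := hz
      show G (f z) < b
      rwa [hfG z (by linarith)]
    · intro hw
      have hw' : G w < b := hw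
      refine ⟨g w, ?_, hfg w (show G w < c by linarith)⟩
      show G (g w) < b
      rwa [hgG w (by linarith)]
  · refine ⟨hfd.mono fun z hz => hz.2, hgd.mono fun z hz => hz.2, ?_, ?_,
      fun z hz => hgf z hz.2, fun z hz => hfg z hz.2⟩
    · intro z hz
      show 0 < G (f z) ∧ G (f z) < c
      rw [hfG z hz.2]
      exact hz
    · intro z hz
      show 0 < G (g z) ∧ G (g z) < c
      rw [hgG z hz.2]
      exact hz
end
end

section
/- Suppose f : ℂ² → ℂ² is a biholomorphism of ℂ² onto itself (a holomorphic automorphism of ℂ²) and f(Ω_c) = Ω_c for some c > 0. Then G⁺_H ∘ f = G⁺_H on all of ℂ²; in particular f(Ω_b) = Ω_b for every b > 0 and f(K⁺) = K⁺. -/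
open Filter Topology Set

noncomputable section

section Helpers

open InnerProductSpace Metric


/-- weak maximum principle -/
theorem aux_maxP {W : Set ℂ} (hW : IsOpen W) (hb : Bornology.IsBounded W) {h : ℂ → ℝ}
    (hc : ContinuousOn h (closure W)) (hh : ∀ z ∈ W, HarmonicAt h z)
    (hf : ∀ z ∈ frontier W, h z ≤ 0) : ∀ z ∈ W, h z ≤ 0 := by
  intro z0 hz0
  by_contra hpos
  push Not at hpos
  have hK : IsCompact (closure W) := hb.isCompact_closure
  obtain ⟨z, hz, hmax⟩ := hK.exists_isMaxOn ⟨z0, subset_closure hz0⟩ hc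
  have hmax' : ∀ w ∈ closure W, h w ≤ h z := fun w hw => hmax hw
  have hzpos : 0 < h z := lt_of_lt_of_le hpos (hmax' z0 (subset_closure hz0))
  have hKM : IsCompact (closure W ∩ h ⁻¹' {h z}) := by
    apply hK.of_isClosed_subset _ inter_subset_left
    exact hc.preimage_isClosed_of_isClosed isClosed_closure isClosed_singleton
  obtain ⟨z1, hz1, hre⟩ := hKM.exists_isMaxOn ⟨z, hz, rfl⟩ (Complex.continuous_re.continuousOn)
  have hre' : ∀ w ∈ closure W, h w = h z → w.re ≤ z1.re := fun w hw hw2 => hre ⟨hw, hw2⟩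
  have h1 : h z1 = h z := hz1.2
  have hz1W : z1 ∈ W := by
    by_contra hn
    have : z1 ∈ frontier W := by
      rw [hW.frontier_eq]; exact ⟨hz1.1, hn⟩
    have := hf z1 this
    linarith
  obtain ⟨r, hr, hball⟩ := Metric.isOpen_iff.1 hW z1 hz1W
  obtain ⟨F, hF, hFe⟩ := HarmonicOnNhd.exists_analyticOnNhd_ball_re_eq (f := h) (z := z1) (R := r)
    (fun w hw => hh w (hball hw))
  have hev : ∀ᶠ w in 𝓝 z1, w ∈ ball z1 r := ball_mem_nhds z1 hr
  have key := Complex.eventually_eq_of_isLocalMax_norm (f := fun w => Complex.exp (F w)) (c := z1)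
    (by
      filter_upwards [hev] with w hw
      exact (hF w hw).differentiableAt.cexp)
    (by
      filter_upwards [hev] with w hw
      simp only [Function.comp, Complex.norm_exp]
      have e1 := hFe hw
      have e2 := hFe (mem_ball_self hr)
      simp only at e1 e2
      rw [e1, e2, h1]
      exact Real.exp_le_exp.2 (hmax' w (subset_closure (hball hw))))
  obtain ⟨ε, hε, hkey⟩ := Metric.eventually_nhds_iff_ball.1 (key.and hev)
  have hm : z1 + ((ε / 2 : ℝ) : ℂ) ∈ ball z1 ε := by
    rw [mem_ball_iff_norm]; simp only [add_sub_cancel_left, Complex.norm_real, Real.norm_eq_abs]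
    rw [abs_of_pos (by linarith)]; linarith
  obtain ⟨k1, k2⟩ := hkey _ hm
  have e1 := hFe k2
  have e2 := hFe (mem_ball_self hr)
  simp only at e1 e2
  have k3 := congrArg norm k1
  simp only [Complex.norm_exp] at k3
  have k4 := Real.exp_injective k3
  rw [e1, e2, h1] at k4
  have := hre' _ (subset_closure (hball k2)) k4
  simp at this
  linarith

theorem aux_harnack {c w : ℂ} {R : ℝ} {v : ℂ → ℝ} (hv : HarmonicOnNhd v (closedBall c R))
    (hn : ∀ z ∈ closedBall c R, 0 ≤ v z) (hw : w ∈ ball c R) :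
    v w ≤ (R + ‖w - c‖) / (R - ‖w - c‖) * v c := by
  have hR : 0 < R := pos_of_mem_ball hw
  have hvc : ContinuousOn v (sphere c |R|) := by
    apply hv.continuousOn.mono
    rw [abs_of_pos hR]; exact sphere_subset_closedBall
  have e1 := hv.circleAverage_re_herglotzRieszKernel_smul hw
  have e2 := InnerProductSpace.HarmonicOnNhd.circleAverage_eq (f := v) (c := c) (R := R) (by rwa [abs_of_pos hR])
  rw [← e1, ← e2, ← smul_eq_mul, ← Real.circleAverage_fun_smul]
  apply Real.circleAverage_mono
  · apply ContinuousOn.circleIntegrable'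
    apply ContinuousOn.smul _ hvc
    exact Complex.continuous_re.comp_continuousOn (continuousOn_herglotzRieszKernel_sphere hw)
  · apply ContinuousOn.circleIntegrable'
    exact hvc.const_smul ((R + ‖w - c‖) / (R - ‖w - c‖))
  · intro x hx
    rw [abs_of_pos hR] at hx
    simp only [Pi.smul_apply', smul_eq_mul, Function.comp]
    apply mul_le_mul_of_nonneg_right _ (hn x (sphere_subset_closedBall hx))
    exact re_herglotzRieszKernel_le hx hw

theorem aux_ident {z w : ℂ} {r : ℝ} {h : ℂ → ℝ} (hh : ∀ x ∈ ball z r, HarmonicAt h x)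
    (hw : w ∈ ball z r) (h0 : h =ᶠ[𝓝 w] 0) : ∀ x ∈ ball z r, h x = 0 := by
  have : AnalyticOnNhd ℝ h (ball z r) := fun x hx => HarmonicAt.analyticAt (hh x hx)
  exact fun x hx => this.eqOn_zero_of_preconnected_of_eventuallyEq_zero
    (convex_ball z r).isPreconnected hw h0 hx

/-- continuous, nonnegative, harmonic where positive -/
def Hm (h : ℂ → ℝ) : Prop :=
  Continuous h ∧ (∀ y, 0 ≤ h y) ∧ ∀ y, 0 < h y → HarmonicAt h y

theorem aux_lin {h1 h2 : ℂ → ℝ} {y : ℂ} (H1 : HarmonicAt h1 y) (H2 : HarmonicAt h2 y) (α β γ : ℝ) :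
    HarmonicAt (fun y => α * h1 y + β * h2 y + γ) y := by
  have := ((H1.const_smul (c := α)).add (H2.const_smul (c := β))).add (harmonicAt_const γ)
  exact this

theorem aux_extend {h1 h2 : ℂ → ℝ} (H1 : Hm h1) (H2 : Hm h2) {c l : ℝ} (hc : 0 < c) (hl : 0 < l)
    (hl1 : l ≤ 1) (hb : Bornology.IsBounded {y | h1 y ≤ c})
    (he : ∀ y, c ≤ h1 y → h2 y - c = l * (h1 y - c)) :
    ∀ y, 0 < h1 y → h2 y = l * h1 y + (1 - l) * c := by
  obtain ⟨c1, n1, p1⟩ := H1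
  obtain ⟨c2, n2, p2⟩ := H2
  set e : ℂ → ℝ := fun y => 1 * h2 y + (-l) * h1 y + (-(1 - l) * c) with hedef
  have ce : Continuous e := by fun_prop
  set A : Set ℂ := {y | 0 < h1 y ∧ e =ᶠ[𝓝 y] 0} with hA
  have hAo : IsOpen A := by
    have : A = {y | 0 < h1 y} ∩ {y | ∀ᶠ x in 𝓝 y, e x = 0} := rfl
    rw [this]
    exact (isOpen_lt continuous_const c1).inter isOpen_setOfPred_eventually_nhds
  have hAc : ∀ y, 0 < h1 y → y ∈ closure A → y ∈ A := by
    intro y hy hyc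
    have e0 : e y = 0 := by
      have : closure A ⊆ {y | e y = 0} := by
        apply closure_minimal _ (isClosed_eq ce continuous_const)
        intro x hx
        exact hx.2.self_of_nhds
      exact this hyc
    have h2y : 0 < h2 y := by
      simp only [hedef] at e0
      have : 0 < l * h1 y := by positivity
      have : 0 ≤ (1 - l) * c := mul_nonneg (by linarith) hc.le
      linarith
    have : {x | 0 < h1 x} ∩ {x | 0 < h2 x} ∈ 𝓝 y :=
      ((isOpen_lt continuous_const c1).inter (isOpen_lt continuous_const c2)).mem_nhds ⟨hy, h2y⟩
    obtain ⟨r, hr, hrb⟩ := Metric.mem_nhds_iff.1 this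
    obtain ⟨w, hw, hwA⟩ := mem_closure_iff_nhds.1 hyc (ball y r) (ball_mem_nhds y hr)
    have := aux_ident (h := e) (fun x hx => aux_lin (p2 x (hrb hx).2) (p1 x (hrb hx).1) _ _ _) hw hwA.2
    refine ⟨hy, ?_⟩
    filter_upwards [ball_mem_nhds y hr] with x hx using this x hx
  have hcA : ∀ y, c < h1 y → y ∈ A := by
    intro y hy
    refine ⟨hc.trans hy, ?_⟩
    filter_upwards [(isOpen_lt continuous_const c1).mem_nhds hy] with x hx
    have := he x (le_of_lt hx)
    simp only [hedef, Pi.zero_apply]; linarith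
  have hcover : {y | 0 < h1 y} \ A = {y | 0 < h1 y} \ closure A := by
    ext y
    constructor
    · rintro ⟨a, b⟩; exact ⟨a, fun h => b (hAc y a h)⟩
    · rintro ⟨a, b⟩; exact ⟨a, fun h => b (subset_closure h)⟩
  have hBo : IsOpen ({y | 0 < h1 y} \ A) := by
    rw [hcover]; exact (isOpen_lt continuous_const c1).sdiff isClosed_closure
  have hBb : Bornology.IsBounded ({y | 0 < h1 y} \ A) := by
    apply hb.subset
    rintro y ⟨_, h⟩
    by_contra hn
    exact h (hcA y (not_le.1 hn))
  have := aux_maxP hBo hBb c1.continuousOn (fun z hz => p1 z hz.1) (by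
    intro z hz
    rw [hBo.frontier_eq] at hz
    by_contra hn
    push Not at hn
    have hzA : z ∈ A := by
      by_contra h; exact hz.2 ⟨hn, h⟩
    obtain ⟨w, hw, hwB⟩ := mem_closure_iff_nhds.1 hz.1 A (hAo.mem_nhds hzA)
    exact hwB.2 hw)
  intro y hy
  have hyA : y ∈ A := by
    by_contra h
    have := this y ⟨hy, h⟩
    linarith
  have := hyA.2.self_of_nhds
  simp only [hedef, Pi.zero_apply] at this
  linarith

theorem aux_twoconst {U : ℂ → ℝ} (HU : Hm U) {y0 : ℂ} {ρ R δ M : ℝ} (hρ : 0 < ρ) (hρR : ρ < R)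
    (hδ : 0 < δ) (hδM : δ ≤ M) (h1 : ∀ y, ‖y - y0‖ = ρ → U y ≤ δ)
    (h2 : ∀ y, ‖y - y0‖ = R → U y ≤ M) :
    ∀ y, ρ < ‖y - y0‖ → ‖y - y0‖ < R →
      U y ≤ δ + (M - δ) * (Real.log (‖y - y0‖ / ρ) / Real.log (R / ρ)) := by
  obtain ⟨c1, n1, p1⟩ := HU
  set β := (M - δ) / Real.log (R / ρ) with hβ
  have hlog : 0 < Real.log (R / ρ) := Real.log_pos (by rwa [lt_div_iff₀ hρ, one_mul])
  have hβ0 : 0 ≤ β := div_nonneg (by linarith) hlog.le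
  set W : Set ℂ := {y | 0 < U y ∧ ρ < ‖y - y0‖ ∧ ‖y - y0‖ < R} with hW
  have hWo : IsOpen W := by
    have i1 : IsOpen {y | 0 < U y} := isOpen_lt continuous_const c1
    have i2 : IsOpen {y : ℂ | ρ < ‖y - y0‖} := isOpen_lt continuous_const (by fun_prop)
    have i3 : IsOpen {y : ℂ | ‖y - y0‖ < R} := isOpen_lt (by fun_prop) continuous_const
    exact i1.inter (i2.inter i3)
  have hWb : Bornology.IsBounded W := by
    apply (isBounded_ball (x := y0) (r := R)).subset
    intro y hy
    rw [mem_ball_iff_norm]; exact hy.2.2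
  have hcl : closure W ⊆ {y | ρ ≤ ‖y - y0‖ ∧ ‖y - y0‖ ≤ R} := by
    have i2 : IsClosed {y : ℂ | ρ ≤ ‖y - y0‖} := isClosed_le continuous_const (by fun_prop)
    have i3 : IsClosed {y : ℂ | ‖y - y0‖ ≤ R} := isClosed_le (by fun_prop) continuous_const
    exact closure_minimal (fun y hy => ⟨hy.2.1.le, hy.2.2.le⟩) (i2.inter i3)
  have key := aux_maxP (h := fun y => 1 * U y + (-β) * Real.log ‖y - y0‖ + (β * Real.log ρ - δ))
    hWo hWb (by
      have : ContinuousOn (fun y : ℂ => Real.log ‖y - y0‖) (closure W) := by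
        apply ContinuousOn.log (by fun_prop)
        intro y hy
        have := (hcl hy).1
        linarith
      fun_prop) (by
      intro z hz
      apply aux_lin (p1 z hz.1)
      apply AnalyticAt.harmonicAt_log_norm (f := fun y => y - y0)
      · fun_prop
      · have := hz.2.1
        rw [← norm_pos_iff]; linarith) (by
      intro z hz
      rw [hWo.frontier_eq] at hz
      obtain ⟨a, b⟩ := hcl hz.1
      have lz : Real.log ρ ≤ Real.log ‖z - y0‖ := Real.log_le_log hρ a
      have lz' : β * Real.log ρ ≤ β * Real.log ‖z - y0‖ := mul_le_mul_of_nonneg_left lz hβ0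
      rcases a.eq_or_lt with a | a
      · have := h1 z a.symm
        linarith
      rcases b.eq_or_lt with b | b
      · have h3 := h2 z b
        have : β * Real.log (R / ρ) = M - δ := by rw [hβ]; field_simp
        rw [Real.log_div (by linarith) (by linarith)] at this
        rw [b]
        linarith
      · have : U z ≤ 0 := by
          by_contra h
          exact hz.2 ⟨not_le.1 h, a, b⟩
        linarith)
  intro y hy1 hy2
  have e : (M - δ) * (Real.log (‖y - y0‖ / ρ) / Real.log (R / ρ)) =
      β * Real.log ‖y - y0‖ - β * Real.log ρ := by
    rw [hβ, Real.log_div (by linarith) (by linarith)]; ring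
  rw [e]
  by_cases hU : 0 < U y
  · have := key y ⟨hU, hy1, hy2⟩
    linarith
  · have lz : Real.log ρ ≤ Real.log ‖y - y0‖ := Real.log_le_log hρ hy1.le
    have lz' : β * Real.log ρ ≤ β * Real.log ‖y - y0‖ := mul_le_mul_of_nonneg_left lz hβ0
    linarith


theorem aux_slice {h1 h2 : ℂ → ℝ} (H1 : Hm h1) (H2 : Hm h2)
    (E1 : Hm (fun w => h1 (Complex.exp w))) (E2 : Hm (fun w => h2 (Complex.exp w)))
    {c R0 : ℝ} (hc : 0 < c) (hiff : ∀ y, h1 y < c ↔ h2 y < c)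
    (hlog : ∀ y, R0 ≤ ‖y‖ → |h1 y - Real.log ‖y‖| ≤ 1) :
    ∃ l : ℝ, 0 ≤ l ∧ ∀ y, c ≤ h1 y → h2 y - c = l * (h1 y - c) := by
  obtain ⟨c1, n1, p1⟩ := H1
  obtain ⟨c2, n2, p2⟩ := H2
  set E : Set ℂ := closure {y | h1 y < c} with hE
  have hE1 : E ⊆ {y | h1 y ≤ c} :=
    closure_minimal (fun y hy => (show h1 y < c from hy).le) (isClosed_le c1 continuous_const)
  have hE2 : E ⊆ {y | h2 y ≤ c} :=
    closure_minimal (fun y hy => ((hiff y).1 hy).le) (isClosed_le c2 continuous_const)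
  have hx1 : ∀ y, y ∈ Eᶜ → c ≤ h1 y := by
    intro y hy
    by_contra hn
    exact hy (subset_closure (not_le.1 hn))
  have hiff' : ∀ y, c ≤ h1 y → c ≤ h2 y := fun y hy => by
    by_contra hn
    exact absurd ((hiff y).2 (not_le.1 hn)) (not_lt.2 hy)
  set R1 : ℝ := max R0 (Real.exp (c + 3)) with hR1
  have R1pos : 0 < R1 := lt_of_lt_of_le (Real.exp_pos _) (le_max_right _ _)
  have hlogge : ∀ y : ℂ, R1 ≤ ‖y‖ → c + 3 ≤ Real.log ‖y‖ := by
    intro y hy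
    rw [Real.le_log_iff_exp_le (by linarith)]
    exact (le_max_right _ _).trans hy
  have hlog2 : ∀ y : ℂ, R1 ≤ ‖y‖ → Real.log ‖y‖ - 1 ≤ h1 y ∧ h1 y ≤ Real.log ‖y‖ + 1 := by
    intro y hy
    have := abs_le.1 (hlog y ((le_max_left _ _).trans hy))
    constructor <;> linarith
  have hbig : ∀ y : ℂ, R1 ≤ ‖y‖ → y ∈ Eᶜ := by
    intro y hy hyE
    have h3 : h1 y ≤ c := hE1 hyE
    linarith [hlogge y hy, (hlog2 y hy).1]
  have cmp : ∀ α β r : ℝ, (∀ y : ℂ, ‖y‖ = r → α * h2 y + β * h1 y + (-(α + β) * c) ≤ 0) →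
      ∀ y ∈ Eᶜ, ‖y‖ < r → α * h2 y + β * h1 y + (-(α + β) * c) ≤ 0 := by
    intro α β r hr y hy hyr
    have hWo : IsOpen (Eᶜ ∩ ball (0 : ℂ) r) := isClosed_closure.isOpen_compl.inter isOpen_ball
    refine aux_maxP (h := fun y => α * h2 y + β * h1 y + (-(α + β) * c)) hWo
      (isBounded_ball.subset inter_subset_right) (by fun_prop) ?_ ?_ y ⟨hy, by simpa using hyr⟩
    · intro z hz
      have := hx1 z hz.1
      exact aux_lin (p2 z (by linarith [hiff' z this])) (p1 z (by linarith)) _ _ _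
    · intro z hz
      rw [hWo.frontier_eq] at hz
      have hzr : ‖z‖ ≤ r := by
        have : z ∈ closedBall (0 : ℂ) r :=
          closure_minimal (inter_subset_right.trans ball_subset_closedBall) isClosed_closedBall hz.1
        simpa using this
      rcases hzr.eq_or_lt with hzr | hzr
      · exact hr z hzr
      · have hzE : z ∈ E := by
          by_contra h
          exact hz.2 ⟨h, by simpa using hzr⟩
        have a1 : h1 z ≤ c := hE1 hzE
        have a2 : h2 z ≤ c := hE2 hzE
        have a3 : c ≤ h1 z := by
          have : closure (Eᶜ ∩ ball (0 : ℂ) r) ⊆ {y | c ≤ h1 y} :=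
            closure_minimal (fun y hy => hx1 y hy.1) (isClosed_le continuous_const c1)
          exact this hz.1
        have a4 := hiff' z a3
        have b1 : h1 z = c := le_antisymm a1 a3
        have b2 : h2 z = c := le_antisymm a2 a4
        simp only [b1, b2]
        apply le_of_eq; ring
  set S : Set ℝ := {l | 0 ≤ l ∧ ∀ y ∈ Eᶜ, l * (h1 y - c) ≤ h2 y - c} with hS
  have hS0 : (0 : ℝ) ∈ S := by
    refine ⟨le_rfl, fun y hy => ?_⟩
    linarith [hiff' y (hx1 y hy)]
  have hSb : BddAbove S := by
    refine ⟨h2 (R1 : ℂ) - c, fun l hl => ?_⟩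
    have hn : ‖(R1 : ℂ)‖ = R1 := by simp [abs_of_pos R1pos]
    have a1 := hl.2 (R1 : ℂ) (hbig _ hn.ge)
    have a2 : 1 ≤ h1 (R1 : ℂ) - c := by
      linarith [hlogge _ hn.ge, (hlog2 _ hn.ge).1]
    nlinarith [hl.1]
  set l := sSup S with hl
  have hl0 : 0 ≤ l := le_csSup hSb hS0
  have hlS : ∀ y ∈ Eᶜ, l * (h1 y - c) ≤ h2 y - c := by
    intro y hy
    have a1 := hx1 y hy
    have a2 := hiff' y a1
    rcases a1.eq_or_lt with a | a
    · rw [← a]; simp; exact a2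
    · rw [← le_div_iff₀ (by linarith)]
      apply csSup_le ⟨0, hS0⟩
      intro m hm
      rw [le_div_iff₀ (by linarith)]
      exact hm.2 y hy
  have main : ∀ ε > 0, ∀ y ∈ Eᶜ, h2 y - c - l * (h1 y - c) ≤ 6 * ε * (h1 y - c) := by
    intro ε hε y hy
    set r0 : ℝ := max (‖y‖ + 1) (R1 * Real.exp (4 * Real.pi)) with hr0
    have hr0R : R1 ≤ r0 := by
      refine le_trans ?_ (le_max_right _ _)
      have : 1 ≤ Real.exp (4 * Real.pi) := Real.one_le_exp (by positivity)
      nlinarith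
    obtain ⟨y1, hy1, hy1q⟩ : ∃ y1 : ℂ, r0 ≤ ‖y1‖ ∧
        h2 y1 - c - l * (h1 y1 - c) < ε * (h1 y1 - c) := by
      by_contra hn
      push Not at hn
      have : l + ε ∈ S := by
        refine ⟨by linarith, fun z hz => ?_⟩
        by_cases hzr : r0 ≤ ‖z‖
        · linarith [hn z hzr]
        · have := cmp (-1) (l + ε) r0 (fun w hw => by linarith [hn w hw.ge]) z hz (not_le.1 hzr)
          linarith
      have := le_csSup hSb this
      linarith
    have hyr : ‖y‖ < ‖y1‖ := by
      have := le_max_left (‖y‖ + 1) (R1 * Real.exp (4 * Real.pi))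
      linarith
    have hy1R : R1 ≤ ‖y1‖ := hr0R.trans hy1
    have := cmp 1 (-(l + 6 * ε)) ‖y1‖ (fun w hw => by
      have hwR : R1 ≤ ‖w‖ := hw ▸ hy1R
      have y1n : y1 ≠ 0 := by rw [← norm_pos_iff]; linarith
      have wn : w ≠ 0 := by rw [← norm_pos_iff]; linarith
      have s12 : h1 y1 - c ≤ 2 * (h1 w - c) := by
        have := hlogge y1 hy1R
        have := hlog2 y1 hy1R
        have h3 := hlog2 w hwR
        rw [hw] at h3
        linarith
      set v : ℂ → ℝ := fun z => 1 * h2 (Complex.exp z) + (-l) * h1 (Complex.exp z) + (l - 1) * c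
        with hv
      have hin : ∀ z ∈ closedBall (Complex.log y1) (4 * Real.pi), Complex.exp z ∈ Eᶜ := by
        intro z hz
        apply hbig
        rw [Complex.norm_exp]
        rw [mem_closedBall_iff_norm] at hz
        have a1 := (abs_le.1 (Complex.abs_re_le_norm (z - Complex.log y1))).1
        rw [Complex.sub_re, Complex.log_re] at a1
        have a2 : R1 * Real.exp (4 * Real.pi) ≤ ‖y1‖ := (le_max_right _ _).trans hy1
        have a3 := Real.log_le_log (by positivity) a2
        rw [Real.log_mul R1pos.ne' (Real.exp_pos _).ne', Real.log_exp] at a3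
        rw [← Real.log_le_iff_le_exp R1pos]
        linarith
      have hnorm : ‖Complex.log w - Complex.log y1‖ ≤ 2 * Real.pi := by
        have : Complex.log w - Complex.log y1 = ((w.arg - y1.arg : ℝ) : ℂ) * Complex.I := by
          apply Complex.ext <;> simp [Complex.log_re, Complex.log_im, hw]
        rw [this, norm_mul, Complex.norm_I, mul_one, Complex.norm_real, Real.norm_eq_abs, abs_le]
        have := Complex.arg_le_pi w
        have := Complex.arg_le_pi y1
        have := Complex.neg_pi_lt_arg w
        have := Complex.neg_pi_lt_arg y1
        constructor <;> linarith
      have hpi := Real.pi_pos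
      have hk := aux_harnack (c := Complex.log y1) (w := Complex.log w) (R := 4 * Real.pi) (v := v)
        (by
          intro z hz
          have := hx1 _ (hin z hz)
          exact aux_lin (E2.2.2 z (by linarith [hiff' _ this])) (E1.2.2 z (by linarith)) _ _ _)
        (by
          intro z hz
          have := hlS _ (hin z hz)
          simp only [hv]; linarith)
        (by rw [mem_ball_iff_norm]; linarith)
      have hv1 : v (Complex.log y1) = h2 y1 - c - l * (h1 y1 - c) := by
        simp only [hv, Complex.exp_log y1n]; ring
      have hv2 : v (Complex.log w) = h2 w - c - l * (h1 w - c) := by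
        simp only [hv, Complex.exp_log wn]; ring
      have h3 : (4 * Real.pi + ‖Complex.log w - Complex.log y1‖) /
          (4 * Real.pi - ‖Complex.log w - Complex.log y1‖) ≤ 3 := by
        rw [div_le_iff₀ (by linarith)]; linarith
      have h4 := mul_le_mul_of_nonneg_right h3
        (show 0 ≤ v (Complex.log y1) by rw [hv1]; linarith [hlS y1 (hbig y1 hy1R)])
      rw [hv2] at hk
      rw [hv1] at hk h4
      have h5 := mul_le_mul_of_nonneg_left s12 hε.le
      linarith) y hy hyr
    linarith
  refine ⟨l, hl0, fun y hy => ?_⟩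
  by_cases hyE : y ∈ E
  · have b1 : h1 y = c := le_antisymm (hE1 hyE) hy
    have b2 : h2 y = c := le_antisymm (hE2 hyE) (hiff' y hy)
    rw [b1, b2]; simp
  · apply le_antisymm _ (hlS y hyE)
    have h3 : ∀ ε > 0, h2 y - c - l * (h1 y - c) ≤ 0 + ε := by
      intro ε hε
      have hp : 0 < 6 * (h1 y - c + 1) := by linarith
      refine (main (ε / (6 * (h1 y - c + 1))) (by positivity) y hyE).trans ?_
      have : 6 * (ε / (6 * (h1 y - c + 1))) * (h1 y - c) = ε * ((h1 y - c) / (h1 y - c + 1)) := by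
        field_simp
      rw [this, zero_add]
      apply mul_le_of_le_one_right hε.le
      rw [div_le_one (by linarith)]; linarith
    have := le_of_forall_pos_le_add h3
    linarith


theorem aux_poly {d : ℕ} (hd : 2 ≤ d) (a : ℂ) (p : Polynomial ℂ) (hpm : p.Monic)
    (hpd : p.natDegree = d) :
    ∃ R : ℝ, 4 ≤ R ∧ ∀ x y : ℂ, R < ‖y‖ → ‖x‖ < ‖y‖ →
      ‖(p.eval y - a * x) / y ^ d - 1‖ ≤ 1 / 2 := by
  set C : ℝ := (∑ i ∈ Finset.range d, ‖p.coeff i‖) + ‖a‖ with hC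
  have hC0 : 0 ≤ C := by positivity
  refine ⟨4 + 2 * C, by linarith, fun x y hy hx => ?_⟩
  have hy1 : 1 ≤ ‖y‖ := by linarith
  have hy0 : y ≠ 0 := by rw [← norm_pos_iff]; linarith
  have hlead : p.coeff d = 1 := by rw [← hpd]; exact hpm
  have e : p.eval y - a * x - y ^ d = (∑ i ∈ Finset.range d, p.coeff i * y ^ i) - a * x := by
    rw [Polynomial.eval_eq_sum_range, hpd, Finset.sum_range_succ, hlead]; ring
  have b : ‖p.eval y - a * x - y ^ d‖ ≤ C * ‖y‖ ^ (d - 1) := by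
    rw [e, hC, add_mul, Finset.sum_mul]
    refine (norm_sub_le _ _).trans (add_le_add ((norm_sum_le _ _).trans ?_) ?_)
    · apply Finset.sum_le_sum
      intro i hi
      rw [norm_mul, norm_pow]
      have : i ≤ d - 1 := by have := Finset.mem_range.1 hi; omega
      gcongr
    · rw [norm_mul]
      gcongr
      refine hx.le.trans ?_
      exact le_self_pow₀ hy1 (by omega)
  have e2 : (p.eval y - a * x) / y ^ d - 1 = (p.eval y - a * x - y ^ d) / y ^ d := by
    field_simp
  rw [e2, norm_div, norm_pow, div_le_iff₀ (by positivity)]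
  refine b.trans ?_
  have : ‖y‖ ^ d = ‖y‖ ^ (d - 1) * ‖y‖ := by
    rw [← pow_succ]; congr 1; omega
  rw [this]
  have : 0 ≤ ‖y‖ ^ (d - 1) := by positivity
  nlinarith

theorem aux_green {d : ℕ} (hd : 2 ≤ d) (a : ℂ)
    (p : Polynomial ℂ) (hpm : p.Monic) (hpd : p.natDegree = d)
    (H : ℂ × ℂ → ℂ × ℂ) (hH : ∀ z : ℂ × ℂ, H z = (z.2, p.eval z.2 - a * z.1))
    (G : ℂ × ℂ → ℝ) (hGcont : Continuous G) (hGnonneg : ∀ z, 0 ≤ G z)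
    (hGH : ∀ n z, G (H^[n] z) = (d : ℝ) ^ n * G z)
    (hGlim : ∀ z : ℂ × ℂ,
      Tendsto (fun n : ℕ => Real.log (max ‖H^[n] z‖ 1) / (d : ℝ) ^ n) atTop (𝓝 (G z)))
    (hKG : ∀ z, 0 < G z → ¬ Bornology.IsBounded (Set.range fun n : ℕ => H^[n] z)) :
    ∃ R : ℝ, 4 ≤ R ∧
      (∀ z : ℂ × ℂ, R < ‖z.2‖ → ‖z.1‖ < ‖z.2‖ → |G z - Real.log ‖z.2‖| ≤ 1) ∧
      (∀ φ : ℂ → ℂ × ℂ, Differentiable ℂ φ → Hm (fun t => G (φ t))) := by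
  obtain ⟨R, hR, hP⟩ := aux_poly hd a p hpm hpd
  have hd0 : (0 : ℝ) < d := by positivity
  have hd2 : (2 : ℝ) ≤ d := by exact_mod_cast hd
  have hHd : Differentiable ℂ H := by
    have : H = fun z : ℂ × ℂ => (z.2, p.eval z.2 - a * z.1) := funext hH
    rw [this]
    have : Differentiable ℂ (fun z : ℂ × ℂ => p.eval z.2) := p.differentiable.comp differentiable_snd
    fun_prop
  have hHn : ∀ n, Differentiable ℂ (H^[n]) := by
    intro n
    induction n with
    | zero => exact differentiable_id
    | succ n ih => rw [Function.iterate_succ]; exact ih.comp hHd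
  set V : Set (ℂ × ℂ) := {z | R < ‖z.2‖ ∧ ‖z.1‖ < ‖z.2‖} with hV
  have hVo : IsOpen V := by
    have i1 : IsOpen {z : ℂ × ℂ | R < ‖z.2‖} := isOpen_lt continuous_const (by fun_prop)
    have i2 : IsOpen {z : ℂ × ℂ | ‖z.1‖ < ‖z.2‖} := isOpen_lt (by fun_prop) (by fun_prop)
    exact i1.inter i2
  have hq : ∀ z ∈ V, ‖(H z).2 / z.2 ^ d - 1‖ ≤ 1 / 2 := by
    intro z hz
    rw [hH]; exact hP _ _ hz.1 hz.2
  have hVH : ∀ z ∈ V, H z ∈ V := by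
    intro z hz
    have h1 := hq z hz
    have hz1 : R < ‖z.2‖ := hz.1
    have hzn : z.2 ≠ 0 := by rw [← norm_pos_iff]; linarith
    have h2 : (1 : ℝ) / 2 ≤ ‖(H z).2 / z.2 ^ d‖ := by
      have := norm_sub_norm_le (1 : ℂ) (1 - (H z).2 / z.2 ^ d)
      rw [norm_sub_rev (1 : ℂ) ((H z).2 / z.2 ^ d), sub_sub_cancel, norm_one] at this
      linarith
    rw [norm_div, norm_pow, le_div_iff₀ (by positivity)] at h2
    have h3 : ‖z.2‖ ^ 2 ≤ ‖z.2‖ ^ d := pow_le_pow_right₀ (by linarith) hd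
    have h4 : ‖z.2‖ < ‖(H z).2‖ := by nlinarith
    refine ⟨by linarith, ?_⟩
    rw [show (H z).1 = z.2 by rw [hH]]
    exact h4
  have hVn : ∀ n, ∀ z ∈ V, H^[n] z ∈ V := by
    intro n
    induction n with
    | zero => intro z hz; exact hz
    | succ n ih => intro z hz; rw [Function.iterate_succ_apply]; exact ih _ (hVH z hz)
  set T : ℕ → ℂ × ℂ → ℂ := fun n z =>
    Complex.log ((H^[n+1] z).2 / (H^[n] z).2 ^ d) / (d : ℂ) ^ (n + 1) with hT
  have hqn : ∀ n, ∀ z ∈ V, ‖(H^[n+1] z).2 / (H^[n] z).2 ^ d - 1‖ ≤ 1 / 2 := by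
    intro n z hz
    rw [Function.iterate_succ_apply']
    exact hq _ (hVn n z hz)
  have hTb : ∀ n, ∀ z ∈ V, ‖T n z‖ ≤ 1 / 2 / 2 ^ n := by
    intro n z hz
    have h1 := hqn n z hz
    have h2 := Complex.norm_log_one_add_half_le_self h1
    rw [add_sub_cancel] at h2
    simp only [hT, norm_div, norm_pow, Complex.norm_natCast]
    rw [div_div, ← pow_succ']
    apply div_le_div₀ (by norm_num) (by linarith) (by positivity)
    gcongr
  have hsum : Summable (fun n : ℕ => (1 : ℝ) / 2 / 2 ^ n) := summable_geometric_two' 1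
  have htsum : ∑' n : ℕ, (1 : ℝ) / 2 / 2 ^ n = 1 := tsum_geometric_two' 1
  have hGV : ∀ z ∈ V, G z = Real.log ‖z.2‖ + (∑' n, T n z).re := by
    intro z hz
    have hs : Summable (fun n => T n z) := Summable.of_norm_bounded hsum (fun n => hTb n z hz)
    have h1 := (Complex.continuous_re.tendsto _).comp hs.hasSum.tendsto_sum_nat
    have h2 : Tendsto (fun n : ℕ => Real.log ‖z.2‖ + (∑ i ∈ Finset.range n, T i z).re) atTop
        (𝓝 (Real.log ‖z.2‖ + (∑' n, T n z).re)) := h1.const_add _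
    refine tendsto_nhds_unique (hGlim z) (h2.congr fun n => ?_)
    have h3 : ∀ n, Real.log ‖z.2‖ + (∑ i ∈ Finset.range n, T i z).re =
        Real.log ‖(H^[n] z).2‖ / (d : ℝ) ^ n := by
      intro n
      induction n with
      | zero => simp
      | succ n ih =>
        rw [Finset.sum_range_succ, Complex.add_re, ← add_assoc, ih]
        have hT' : (T n z).re = Real.log ‖(H^[n+1] z).2 / (H^[n] z).2 ^ d‖ / (d : ℝ) ^ (n + 1) := by
          simp only [hT]
          rw [show ((d : ℂ) ^ (n + 1)) = (((d : ℝ) ^ (n + 1) : ℝ) : ℂ) by push_cast; rfl,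
            Complex.div_ofReal_re, Complex.log_re]
        have v1 : (4 : ℝ) < ‖(H^[n] z).2‖ := by linarith [(hVn n z hz).1]
        have v2 : (4 : ℝ) < ‖(H^[n+1] z).2‖ := by linarith [(hVn (n+1) z hz).1]
        rw [hT', norm_div, norm_pow, Real.log_div (by linarith) (by positivity), Real.log_pow]
        field_simp
        ring
    rw [h3]
    congr 1
    have hn := hVn n z hz
    have n1 : R < ‖(H^[n] z).2‖ := hn.1
    have n2 : ‖(H^[n] z).1‖ < ‖(H^[n] z).2‖ := hn.2
    rw [Prod.norm_def, max_eq_right n2.le, max_eq_left (by linarith)]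
  refine ⟨R, hR, ?_, ?_⟩
  · intro z h1 h2
    rw [hGV z ⟨h1, h2⟩, add_sub_cancel_left]
    refine (Complex.abs_re_le_norm _).trans ?_
    rw [← htsum]
    exact tsum_of_norm_bounded hsum.hasSum (fun n => hTb n z ⟨h1, h2⟩)
  · intro φ hφ
    refine ⟨hGcont.comp hφ.continuous, fun t => hGnonneg _, fun t0 ht0 => ?_⟩
    obtain ⟨N, hN⟩ : ∃ N, H^[N] (φ t0) ∈ V := by
      by_contra hno
      push Not at hno
      apply hKG _ ht0
      set M := max R ‖φ t0‖ with hM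
      have hb : ∀ n, ‖H^[n] (φ t0)‖ ≤ M := by
        intro n
        induction n with
        | zero => exact le_max_right _ _
        | succ n ih =>
          have h1 := hno (n + 1)
          have h2 : ‖(H^[n+1] (φ t0)).1‖ ≤ M := by
            rw [Function.iterate_succ_apply', hH]
            exact (norm_snd_le _).trans ih
          rw [Prod.norm_def]
          apply max_le h2
          by_contra hn
          push Not at hn
          exact h1 ⟨(le_max_left _ _).trans_lt hn, h2.trans_lt hn⟩
      rw [isBounded_iff_forall_norm_le]
      exact ⟨M, by rintro _ ⟨n, rfl⟩; exact hb n⟩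
    set ψ : ℂ → ℂ × ℂ := fun t => H^[N] (φ t) with hψ
    have hψd : Differentiable ℂ ψ := (hHn N).comp hφ
    set U : Set ℂ := ψ ⁻¹' V with hU
    have hUo : IsOpen U := hVo.preimage hψd.continuous
    have ht0U : t0 ∈ U := hN
    have hTd : ∀ n, DifferentiableOn ℂ (fun t => T n (ψ t)) U := by
      intro n t ht
      apply DifferentiableAt.differentiableWithinAt
      simp only [hT]
      have d1 : DifferentiableAt ℂ (fun t => (H^[n+1] (ψ t)).2) t :=
        (((hHn (n+1)).comp hψd).snd) t
      have d2 : DifferentiableAt ℂ (fun t => (H^[n] (ψ t)).2) t :=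
        (((hHn n).comp hψd).snd) t
      have v1 : (4 : ℝ) < ‖(H^[n] (ψ t)).2‖ := by linarith [(hVn n _ ht).1]
      have v0 : (H^[n] (ψ t)).2 ≠ 0 := by rw [← norm_pos_iff]; linarith
      apply DifferentiableAt.div_const
      apply DifferentiableAt.clog (d1.div (d2.pow d) (pow_ne_zero _ v0))
      left
      have h1 := hqn n _ ht
      have h2 := (abs_le.1 ((Complex.abs_re_le_norm _).trans h1)).1
      simp only [Complex.sub_re, Complex.one_re] at h2
      simp only [Pi.div_apply, Pi.pow_apply]
      linarith
    have hS := Complex.differentiableOn_tsum_of_summable_norm hsum hTd hUo (fun n t ht => hTb n _ ht)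
    have hSa : AnalyticAt ℂ (fun t => ∑' n, T n (ψ t)) t0 := hS.analyticAt (hUo.mem_nhds ht0U)
    have hya : AnalyticAt ℂ (fun t => (ψ t).2) t0 := (hψd.snd).analyticAt t0
    have hy0 : (ψ t0).2 ≠ 0 := by
      have : R < ‖(ψ t0).2‖ := hN.1
      rw [← norm_pos_iff]; linarith
    have := aux_lin (hya.harmonicAt_log_norm hy0) hSa.harmonicAt_re (1 / (d : ℝ) ^ N)
      (1 / (d : ℝ) ^ N) 0
    refine (harmonicAt_congr_nhds ?_).1 this
    filter_upwards [hUo.mem_nhds ht0U] with t ht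
    have h1 := hGV _ ht
    simp only [hψ] at h1 ⊢
    rw [hGH] at h1
    have : (d : ℝ) ^ N ≠ 0 := by positivity
    field_simp
    linarith


theorem aux_lambda (G : ℂ × ℂ → ℝ) {R : ℝ} (hR : 4 ≤ R)
    (hlog : ∀ z : ℂ × ℂ, R < ‖z.2‖ → ‖z.1‖ < ‖z.2‖ → |G z - Real.log ‖z.2‖| ≤ 1)
    (hHm : ∀ φ : ℂ → ℂ × ℂ, Differentiable ℂ φ → Hm (fun t => G (φ t)))
    (f : ℂ × ℂ → ℂ × ℂ) (hf : Differentiable ℂ f) {c : ℝ} (hc : 0 < c)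
    (hiff : ∀ z, G z < c ↔ G (f z) < c) :
    ∃ l : ℝ, 0 ≤ l ∧ ∀ z, c ≤ G z → G (f z) - c = l * (G z - c) := by
  have hsl : ∀ x : ℂ, ∃ l : ℝ, 0 ≤ l ∧
      ∀ y, c ≤ G (x, y) → G (f (x, y)) - c = l * (G (x, y) - c) := by
    intro x
    have dx : Differentiable ℂ (fun y : ℂ => (x, y)) := by fun_prop
    have dxe : Differentiable ℂ (fun y : ℂ => (x, Complex.exp y)) := by fun_prop
    refine aux_slice (h1 := fun y => G (x, y)) (h2 := fun y => G (f (x, y))) (R0 := R + ‖x‖ + 1)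
      (hHm _ dx) (hHm _ (hf.comp dx)) (hHm _ dxe) (hHm _ (hf.comp dxe)) hc
      (fun y => hiff _) ?_
    intro y hy
    have := norm_nonneg x
    exact hlog (x, y) (by simp only; linarith) (by simp only; linarith)
  choose l hl0 hl using hsl
  have hle : ∀ x x', l x ≤ l x' := by
    intro x x'
    set k := ‖x - x'‖ with hk
    have hk0 : 0 ≤ k := norm_nonneg _
    have hlt : Tendsto (fun y : ℝ => Real.log y) atTop atTop := Real.tendsto_log_atTop
    have t1 : Tendsto (fun y : ℝ => l x * (1 - (1 + c) / Real.log y)) atTop (𝓝 (l x * (1 - 0))) :=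
      ((hlt.const_div_atTop (1 + c)).const_sub 1).const_mul _
    have t2 : Tendsto (fun y : ℝ => l x' * ((1 + 2 * k / (y - (‖x'‖ + 1 + k))) *
        (1 + (1 - c) / Real.log y))) atTop (𝓝 (l x' * ((1 + 0) * (1 + 0)))) := by
      refine Tendsto.const_mul _ (Tendsto.mul ?_ ?_)
      · refine Tendsto.const_add _ (Tendsto.const_div_atTop ?_ _)
        exact tendsto_atTop_add_const_right _ _ tendsto_id
      · exact (hlt.const_div_atTop (1 - c)).const_add 1
    have : l x * (1 - 0) ≤ l x' * ((1 + 0) * (1 + 0)) := by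
      refine le_of_tendsto_of_tendsto t1 t2 ?_
      filter_upwards [eventually_gt_atTop (R + 1), eventually_gt_atTop (‖x'‖ + 1 + k),
        hlt.eventually_gt_atTop (c + 1)] with y hy1 hy2 hy3
      have hypos : 0 < y := by linarith
      have hyn : ‖(y : ℂ)‖ = y := by simp [abs_of_pos hypos]
      set ρ := y - ‖x'‖ - 1 with hρ
      have hball : ∀ w ∈ closedBall x' ρ, |G (w, (y : ℂ)) - Real.log y| ≤ 1 := by
        intro w hw
        have hw' : ‖w‖ < y := by
          rw [mem_closedBall_iff_norm] at hw
          have := norm_le_norm_add_norm_sub' w x'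
          linarith
        have := hlog (w, (y : ℂ)) (by simp only [hyn]; linarith) (by simpa only [hyn] using hw')
        simpa only [hyn] using this
      have hballc : ∀ w ∈ closedBall x' ρ, c ≤ G (w, (y : ℂ)) := by
        intro w hw
        linarith [(abs_le.1 (hball w hw)).1]
      have hballf : ∀ w ∈ closedBall x' ρ, c ≤ G (f (w, (y : ℂ))) := by
        intro w hw
        by_contra hn
        exact absurd ((hiff _).2 (not_le.1 hn)) (not_lt.2 (hballc w hw))
      have dy : Differentiable ℂ (fun w : ℂ => f (w, (y : ℂ))) := by fun_prop
      have HU := hHm _ dy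
      have hx : x ∈ ball x' ρ := by
        rw [mem_ball_iff_norm]; linarith
      have hx' : x' ∈ closedBall x' ρ := mem_closedBall_self (by linarith)
      have hk1 := aux_harnack (c := x') (w := x) (R := ρ)
        (v := fun w => 1 * G (f (w, (y : ℂ))) + 0 * G (f (w, (y : ℂ))) + (-c))
        (by
          intro w hw
          have := HU.2.2 w (by linarith [hballf w hw])
          exact aux_lin this this _ _ _)
        (by intro w hw; linarith [hballf w hw]) hx
      simp only [one_mul, zero_mul, add_zero, ← sub_eq_add_neg] at hk1
      rw [hl x _ (hballc x (ball_subset_closedBall hx)), hl x' _ (hballc x' hx'), ← hk] at hk1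
      have b1 := (abs_le.1 (hball x (ball_subset_closedBall hx))).1
      have b2 := (abs_le.1 (hball x' hx')).2
      have hlp : 0 < Real.log y := by linarith
      have e1 : l x * (1 - (1 + c) / Real.log y) = (l x * (Real.log y - 1 - c)) / Real.log y := by
        field_simp
        ring
      have e2 : l x' * ((1 + 2 * k / (y - (‖x'‖ + 1 + k))) * (1 + (1 - c) / Real.log y)) =
          ((ρ + k) / (ρ - k) * (l x' * (Real.log y + 1 - c))) / Real.log y := by
        have : y - (‖x'‖ + 1 + k) = ρ - k := by rw [hρ]; ring
        rw [this]
        have : ρ - k ≠ 0 := by rw [hρ]; intro h; linarith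
        field_simp
        ring
      simp only [e1, e2]
      apply div_le_div_of_nonneg_right _ hlp.le
      calc l x * (Real.log y - 1 - c) ≤ l x * (G (x, (y : ℂ)) - c) :=
            mul_le_mul_of_nonneg_left (by linarith) (hl0 x)
        _ ≤ _ := hk1
        _ ≤ _ := by
            apply mul_le_mul_of_nonneg_left _ (div_nonneg (by linarith) (by linarith))
            exact mul_le_mul_of_nonneg_left (by linarith) (hl0 x')
    linarith
  refine ⟨l 0, hl0 0, fun z hz => ?_⟩
  have := hl z.1 z.2 hz
  rw [le_antisymm (hle z.1 0) (hle 0 z.1)] at this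
  exact this

theorem aux_lip (F : ℂ × ℂ → ℂ × ℂ) (hF : ContDiff ℂ 1 F) (M : ℝ) :
    ∃ L : ℝ, 1 ≤ L ∧ ∀ z w, ‖z‖ ≤ M → ‖w‖ ≤ M → ‖F z - F w‖ ≤ L * ‖z - w‖ := by
  obtain ⟨C, hC⟩ := (isCompact_closedBall (0 : ℂ × ℂ) M).exists_bound_of_continuousOn
    (hF.continuous_fderiv one_ne_zero).continuousOn
  refine ⟨max 1 C, le_max_left _ _, fun z w hz hw => ?_⟩
  exact (convex_closedBall (0 : ℂ × ℂ) M).norm_image_sub_le_of_norm_fderiv_le (𝕜 := ℂ)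
    (fun x _ => (hF.differentiable one_ne_zero) x)
    (fun x hx => (hC x hx).trans (le_max_right _ _))
    (mem_closedBall_zero_iff.2 hw) (mem_closedBall_zero_iff.2 hz)

theorem aux_one {d : ℕ} (hd : 2 ≤ d) (G : ℂ × ℂ → ℝ) (hGcont : Continuous G)
    (hGnonneg : ∀ z, 0 ≤ G z) {R : ℝ} (hR : 4 ≤ R)
    (hlog : ∀ z : ℂ × ℂ, R < ‖z.2‖ → ‖z.1‖ < ‖z.2‖ → |G z - Real.log ‖z.2‖| ≤ 1)
    (hHm : ∀ φ : ℂ → ℂ × ℂ, Differentiable ℂ φ → Hm (fun t => G (φ t)))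
    (H J : ℂ × ℂ → ℂ × ℂ) (hJc : ContDiff ℂ 1 J) (hHI : ∀ z, H (J z) = z)
    (hIH : ∀ z, J (H z) = z) (hGH : ∀ n z, G (H^[n] z) = (d : ℝ) ^ n * G z)
    (hbd : ∀ z, G z = 0 → ∃ M : ℝ, ∀ n, ‖H^[n] z‖ ≤ M)
    (f : ℂ × ℂ → ℂ × ℂ) (hf : Differentiable ℂ f) {c : ℝ} (hc : 0 < c)
    {z0 : ℂ × ℂ} (hz0 : G (f z0) = 0)
    {l : ℝ} (hl : ∀ z, c ≤ G z → G (f z) - c = l * (G z - c)) (hlpos : 0 < l) (hl1 : l ≤ 1) :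
    l = 1 ∧ ∀ z, 0 < G z → G (f z) = G z := by
  have hd2 : (2 : ℝ) ≤ d := by exact_mod_cast hd
  have hI : Differentiable ℂ J := hJc.differentiable one_ne_zero
  have hd0 : (0 : ℝ) < d := by linarith
  have hext : ∀ z, 0 < G z → G (f z) = l * G z + (1 - l) * c := by
    rintro ⟨x, y⟩ hz
    have dx : Differentiable ℂ (fun y : ℂ => (x, y)) := by fun_prop
    refine aux_extend (h1 := fun y => G (x, y)) (h2 := fun y => G (f (x, y)))
      (hHm _ dx) (hHm _ (hf.comp dx)) hc hlpos hl1 ?_ (fun y hy => hl _ hy) y hz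
    apply (isBounded_closedBall (x := (0 : ℂ)) (r := R + ‖x‖ + 1 + Real.exp (c + 1))).subset
    intro w hw
    rw [mem_closedBall_zero_iff]
    by_contra hn
    push Not at hn
    have hx := norm_nonneg x
    have he := Real.exp_pos (c + 1)
    have h1 := hlog (x, w) (by simp only; linarith) (by simp only; linarith)
    have h2 : c + 1 < Real.log ‖w‖ := by
      rw [Real.lt_log_iff_exp_lt (by linarith)]; linarith
    have h3 : G (x, w) ≤ c := hw
    have := (abs_le.1 h1).1
    simp only at this
    linarith
  have hl_eq : l = 1 := by
    by_contra hne
    have hlt : l < 1 := lt_of_le_of_ne hl1 hne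
    set η := (1 - l) * c with hη
    have hη0 : 0 < η := mul_pos (by linarith) hc
    have hGz0 : G z0 = 0 := by
      by_contra h
      have hp : 0 < G z0 := lt_of_le_of_ne (hGnonneg _) (Ne.symm h)
      have := hext z0 hp
      have : 0 < l * G z0 := by positivity
      linarith
    obtain ⟨M, hM⟩ := hbd z0 hGz0
    have hM0 : 0 ≤ M := (norm_nonneg _).trans (hM 0)
    have hnear : {z | G (f z) < η / 2} ∈ 𝓝 z0 :=
      (isOpen_lt (hGcont.comp hf.continuous) continuous_const).mem_nhds
        (by rw [mem_ofPred_eq, Function.comp_apply, hz0]; linarith)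
    obtain ⟨r', hr', hrb'⟩ := Metric.mem_nhds_iff.1 hnear
    set r := min (r' / 2) 1 with hr
    have hr0 : 0 < r := by positivity
    have hr1 : r ≤ 1 := min_le_right _ _
    have hrb : ∀ z, ‖z - z0‖ ≤ r → G (f z) ≤ η / 2 := by
      intro z hz
      apply le_of_lt
      have : z ∈ ball z0 r' := by
        rw [mem_ball_iff_norm]
        have := min_le_left (r' / 2) 1
        linarith
      exact hrb' this
    obtain ⟨L, hL1, hL⟩ := aux_lip J hJc (M + 1)
    have hL0 : 0 < L := by linarith
    have hback : ∀ n, ∀ w, ‖w - H^[n] z0‖ ≤ r / L ^ n → ‖J^[n] w - z0‖ ≤ r := by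
      intro n
      induction n with
      | zero => intro w hw; simpa using hw
      | succ n ih =>
        intro w hw
        rw [Function.iterate_succ_apply]
        apply ih
        have h1 : r / L ^ (n + 1) ≤ 1 :=
          (div_le_self hr0.le (one_le_pow₀ hL1)).trans hr1
        have h2 : ‖w‖ ≤ M + 1 := by
          have := norm_le_norm_add_norm_sub' w (H^[n+1] z0)
          linarith [hM (n + 1)]
        have h3 := hL w (H^[n+1] z0) h2 (by linarith [hM (n + 1)])
        rw [Function.iterate_succ_apply' H, hIH, ← Function.iterate_succ_apply' H] at h3
        refine h3.trans ?_
        calc L * ‖w - H^[n+1] z0‖ ≤ L * (r / L ^ (n + 1)) := mul_le_mul_of_nonneg_left hw hL0.le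
          _ = r / L ^ n := by rw [pow_succ]; field_simp
    have hHIn : ∀ n w, H^[n] (J^[n] w) = w := by
      intro n w
      exact (Function.LeftInverse.iterate (fun z => hHI z) n) w
    have hIn : ∀ n, Differentiable ℂ (J^[n]) := by
      intro n
      induction n with
      | zero => exact differentiable_id
      | succ n ih => rw [Function.iterate_succ]; exact ih.comp hI
    set Q : ℝ := 2 * (R + 2 * M + 1) with hQ
    set C : ℝ := Real.log (Q + M) + 1 with hC
    have hC0 : 0 ≤ C := by
      have : 0 ≤ Real.log (Q + M) := Real.log_nonneg (by linarith)
      linarith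
    have hest : ∀ n : ℕ, η / 2 * Real.log 2 ≤ C * (Real.log (Q / r) + n * Real.log L) / d ^ n := by
      intro n
      have hx : ‖(H^[n] z0).1‖ ≤ M := (norm_fst_le _).trans (hM n)
      have hy : ‖(H^[n] z0).2‖ ≤ M := (norm_snd_le _).trans (hM n)
      set x := (H^[n] z0).1 with hxd
      set y0 := (H^[n] z0).2 with hyd
      have hpair : H^[n] z0 = (x, y0) := rfl
      set ρ := r / L ^ n with hρ
      have hLn : 0 < L ^ n := by positivity
      have hρ0 : 0 < ρ := by positivity
      have hρ1 : ρ ≤ 1 := (div_le_self hr0.le (one_le_pow₀ hL1)).trans hr1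
      have dU : Differentiable ℂ (fun y : ℂ => f (J^[n] (x, y))) := by
        have : Differentiable ℂ (fun y : ℂ => (x, y)) := by fun_prop
        exact hf.comp ((hIn n).comp this)
      have hdn : (0 : ℝ) < (d : ℝ) ^ n := by positivity
      have hfar : ∀ y : ℂ, Q / 2 ≤ ‖y - y0‖ → ‖y - y0‖ ≤ Q →
          0 < G (x, y) ∧ G (x, y) ≤ C ∧
          G (f (J^[n] (x, y))) = l * (G (x, y) / d ^ n) + η := by
        intro y h1 h2
        have h3 : Q / 2 - M ≤ ‖y‖ := by
          have := norm_sub_le y y0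
          linarith
        have h4 : ‖y‖ ≤ Q + M := by
          have := norm_le_norm_add_norm_sub' y y0
          linarith
        have h5 := abs_le.1 (hlog (x, y) (by simp only; linarith) (by simp only; linarith))
        simp only at h5
        have h6 : 1 < Real.log ‖y‖ := by
          rw [Real.lt_log_iff_exp_lt (by linarith)]
          linarith [Real.exp_one_lt_d9]
        have h7 : Real.log ‖y‖ ≤ Real.log (Q + M) := Real.log_le_log (by linarith) h4
        have h8 : 0 < G (x, y) := by linarith
        have h9 : G (J^[n] (x, y)) = G (x, y) / d ^ n := by
          have := hGH n (J^[n] (x, y))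
          rw [hHIn] at this
          rw [this]; field_simp
        refine ⟨h8, by linarith, ?_⟩
        rw [hext _ (by rw [h9]; positivity), h9]
      have key := aux_twoconst (hHm _ dU) (y0 := y0) (ρ := ρ) (R := Q) (δ := η / 2)
        (M := η + C / d ^ n) hρ0 (by linarith) (by linarith)
        (by have : 0 ≤ C / (d : ℝ) ^ n := by positivity
            linarith)
        (by
          intro y hyρ
          apply hrb
          apply hback n
          rw [hpair, Prod.mk_sub_mk, Prod.norm_def]
          simp [hyρ, hρ0.le, hρ.le])
        (by
          intro y hyQ
          obtain ⟨g1, g2, g3⟩ := hfar y (by linarith) hyQ.le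
          rw [g3]
          have h1 : l * (G (x, y) / d ^ n) ≤ 1 * (C / d ^ n) := by
            gcongr
          linarith)
      have hQ0 : 0 < Q := by linarith
      have hnm : ‖(y0 + ((Q / 2 : ℝ) : ℂ)) - y0‖ = Q / 2 := by
        rw [add_sub_cancel_left, Complex.norm_real, Real.norm_eq_abs, abs_of_pos (by linarith)]
      have key2 := key (y0 + ((Q / 2 : ℝ) : ℂ)) (by rw [hnm]; linarith) (by rw [hnm]; linarith)
      obtain ⟨g1, g2, g3⟩ := hfar (y0 + ((Q / 2 : ℝ) : ℂ)) (by rw [hnm]) (by rw [hnm]; linarith)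
      rw [hnm] at key2
      have g4 : η ≤ G (f (J^[n] (x, y0 + ((Q / 2 : ℝ) : ℂ)))) := by
        rw [g3]
        have : 0 < l * (G (x, y0 + ((Q / 2 : ℝ) : ℂ)) / d ^ n) := by positivity
        linarith
      have key3 := g4.trans key2
      set Λ := Real.log (Q / ρ) with hΛ
      have hΛpos : 0 < Λ := Real.log_pos (by rw [lt_div_iff₀ hρ0]; linarith)
      have e1 : Real.log (Q / 2 / ρ) = Λ - Real.log 2 := by
        rw [hΛ, show Q / 2 / ρ = (Q / ρ) / 2 by ring, Real.log_div (by positivity) (by norm_num)]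
      have e2 : Real.log (Q / r) + n * Real.log L = Λ := by
        rw [hΛ, hρ, show Q / (r / L ^ n) = (Q / r) * L ^ n by field_simp,
          Real.log_mul (by positivity) (by positivity), Real.log_pow]
      rw [e2]
      rw [e1] at key3
      have hl2 : 0 < Real.log 2 := Real.log_pos (by norm_num)
      have hCn : 0 ≤ C / (d : ℝ) ^ n := by positivity
      have e3 : η * Λ ≤ η / 2 * Λ + (η + C / d ^ n - η / 2) * (Λ - Real.log 2) := by
        have := mul_le_mul_of_nonneg_right key3 hΛpos.le
        refine this.trans (le_of_eq ?_)
        field_simp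
      have e4 : C * Λ / d ^ n = C / d ^ n * Λ := by ring
      rw [e4]
      nlinarith [mul_nonneg hCn hl2.le]
    have hlim : Tendsto (fun n : ℕ => C * (Real.log (Q / r) + n * Real.log L) / (d : ℝ) ^ n) atTop
        (𝓝 0) := by
      have hlt1 : |(1 / (d : ℝ))| < 1 := by
        rw [abs_of_pos (by positivity), div_lt_one hd0]; linarith
      have t0 := tendsto_pow_const_mul_const_pow_of_abs_lt_one 0 hlt1
      have t1 := tendsto_pow_const_mul_const_pow_of_abs_lt_one 1 hlt1
      have := (t0.const_mul (C * Real.log (Q / r))).add (t1.const_mul (C * Real.log L))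
      simp only [mul_zero, add_zero] at this
      refine this.congr fun n => ?_
      rw [one_div, inv_pow]
      field_simp
      try ring
    have := ge_of_tendsto' hlim hest
    have hl2 : 0 < Real.log 2 := Real.log_pos (by norm_num)
    have : 0 < η / 2 * Real.log 2 := by positivity
    linarith
  refine ⟨hl_eq, fun z hz => ?_⟩
  rw [hext z hz, hl_eq]; ring


theorem aux_final (d : ℕ) (hd : 2 ≤ d) (a : ℂ) (ha : a ≠ 0)
    (p : Polynomial ℂ) (hpm : p.Monic) (hpd : p.natDegree = d)
    (H : ℂ × ℂ → ℂ × ℂ) (hH : ∀ z : ℂ × ℂ, H z = (z.2, p.eval z.2 - a * z.1))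
    (G : ℂ × ℂ → ℝ) (hGcont : Continuous G) (hGnonneg : ∀ z, 0 ≤ G z)
    (hGlim : ∀ z : ℂ × ℂ,
      Tendsto (fun n : ℕ => Real.log (max ‖H^[n] z‖ 1) / (d : ℝ) ^ n) atTop (𝓝 (G z)))
    (hKb : ∀ z, G z = 0 ↔ Bornology.IsBounded (Set.range fun n : ℕ => H^[n] z))
    (f g : ℂ × ℂ → ℂ × ℂ)
    (hfdiff : Differentiable ℂ f) (hgdiff : Differentiable ℂ g)
    (hgf : ∀ z : ℂ × ℂ, g (f z) = z) (hfg : ∀ z : ℂ × ℂ, f (g z) = z)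
    (c : ℝ) (hc : 0 < c) (hiff : ∀ z, G z < c ↔ G (f z) < c) :
    ∀ z : ℂ × ℂ, G (f z) = G z := by
  have hd2 : (2 : ℝ) ≤ d := by exact_mod_cast hd
  have hd0 : (0 : ℝ) < d := by linarith
  have hG1 : ∀ z, G (H z) = d * G z := by
    intro z
    have t1 := hGlim (H z)
    have t2 := (((tendsto_add_atTop_iff_nat 1).2 (hGlim z)).const_mul (d : ℝ))
    refine tendsto_nhds_unique t1 (t2.congr fun n => ?_)
    rw [Function.iterate_succ_apply, pow_succ]
    field_simp
  have hGH : ∀ n z, G (H^[n] z) = (d : ℝ) ^ n * G z := by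
    intro n
    induction n with
    | zero => intro z; simp
    | succ n ih => intro z; rw [Function.iterate_succ_apply, ih, hG1, pow_succ]; ring
  have hKG : ∀ z, 0 < G z → ¬ Bornology.IsBounded (Set.range fun n : ℕ => H^[n] z) := by
    intro z hz hb
    exact hz.ne' ((hKb z).2 hb)
  have hbd : ∀ z, G z = 0 → ∃ M : ℝ, ∀ n, ‖H^[n] z‖ ≤ M := by
    intro z hz
    obtain ⟨M, hM⟩ := isBounded_iff_forall_norm_le.1 ((hKb z).1 hz)
    exact ⟨M, fun n => hM _ ⟨n, rfl⟩⟩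
  obtain ⟨R, hR, hlog, hHm⟩ := aux_green hd a p hpm hpd H hH G hGcont hGnonneg hGH hGlim hKG
  let J : ℂ × ℂ → ℂ × ℂ := fun z => ((p.eval z.1 - z.2) / a, z.1)
  have hJc : ContDiff ℂ 1 J := by
    have hp : ContDiff ℂ 1 (fun z : ℂ × ℂ => p.eval z.1) := by
      have := (Polynomial.contDiff_aeval (𝕜 := ℂ) p 1).comp (contDiff_fst (𝕜 := ℂ) (E := ℂ) (F := ℂ))
      simpa [Function.comp_def, Polynomial.coe_aeval_eq_eval] using this
    exact ((hp.sub contDiff_snd).div_const a).prodMk contDiff_fst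
  have hHJ : ∀ z, H (J z) = z := by
    rintro ⟨x, y⟩
    rw [hH]
    simp only [J, Prod.mk.injEq, true_and]
    field_simp
    ring
  have hJH : ∀ z, J (H z) = z := by
    rintro ⟨x, y⟩
    rw [hH]
    simp only [J, Prod.mk.injEq, and_true]
    field_simp
    ring
  have hiffg : ∀ z, G z < c ↔ G (g z) < c := by
    intro z
    rw [hiff (g z), hfg]
  -- a fixed point
  obtain ⟨zs, hzs⟩ : ∃ zs, G zs = 0 := by
    have hdeg : (p - Polynomial.C (a + 1) * Polynomial.X).degree ≠ 0 := by
      have h1 : (Polynomial.C (a + 1) * Polynomial.X).degree < p.degree := by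
        refine lt_of_le_of_lt (Polynomial.degree_C_mul_X_le _) ?_
        rw [Polynomial.degree_eq_natDegree hpm.ne_zero, hpd]
        exact_mod_cast (by omega : 1 < d)
      rw [Polynomial.degree_sub_eq_left_of_degree_lt h1,
        Polynomial.degree_eq_natDegree hpm.ne_zero, hpd]
      exact_mod_cast (by omega : d ≠ 0)
    obtain ⟨x, hx⟩ := IsAlgClosed.exists_root _ hdeg
    simp only [Polynomial.IsRoot, Polynomial.eval_sub, Polynomial.eval_mul, Polynomial.eval_C,
      Polynomial.eval_X] at hx
    have hfix : H (x, x) = (x, x) := by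
      rw [hH]
      simp only [Prod.mk.injEq, true_and]
      linear_combination hx
    have := hG1 (x, x)
    rw [hfix] at this
    have h2 : ((d : ℝ) - 1) * G (x, x) = 0 := by linarith
    rcases mul_eq_zero.1 h2 with h | h
    · linarith
    · exact ⟨_, h⟩
  obtain ⟨l, hl0, hl⟩ := aux_lambda G hR hlog hHm f hfdiff hc hiff
  obtain ⟨m, hm0, hm⟩ := aux_lambda G hR hlog hHm g hgdiff hc hiffg
  have hlm : m * l = 1 := by
    set y : ℝ := R + 1 + Real.exp (c + 1) with hy
    have he := Real.exp_pos (c + 1)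
    have hyp : 0 < y := by linarith
    have hyn : ‖(y : ℂ)‖ = y := by simp [abs_of_pos hyp]
    have h1 := hlog (0, (y : ℂ)) (by simp only [hyn]; linarith)
      (by simp only [hyn, norm_zero]; linarith)
    simp only [hyn] at h1
    have h2 : c + 1 < Real.log y := by
      rw [Real.lt_log_iff_exp_lt hyp]; linarith
    have h3 : c < G (0, (y : ℂ)) := by linarith [(abs_le.1 h1).1]
    have h4 : c ≤ G (f (0, (y : ℂ))) := by
      by_contra hn
      exact absurd ((hiff _).2 (not_le.1 hn)) (not_lt.2 h3.le)
    have h5 := hm _ h4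
    rw [hgf, hl _ h3.le] at h5
    have h6 : G (0, (y : ℂ)) - c ≠ 0 := by intro h; linarith
    apply mul_right_cancel₀ h6
    linarith
  have hlpos : 0 < l := lt_of_le_of_ne hl0 (by rintro rfl; simp at hlm)
  have hmpos : 0 < m := lt_of_le_of_ne hm0 (by rintro rfl; simp at hlm)
  have hzf : G (f (g zs)) = 0 := by rw [hfg, hzs]
  have hzg : G (g (f zs)) = 0 := by rw [hgf, hzs]
  have Of := fun h => aux_one hd G hGcont hGnonneg hR hlog hHm H J hJc hHJ hJH hGH hbd f hfdiff hc
    hzf hl hlpos h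
  have Og := fun h => aux_one hd G hGcont hGnonneg hR hlog hHm H J hJc hHJ hJH hGH hbd g hgdiff hc
    hzg hm hmpos h
  have hl1 : l = 1 := by
    rcases le_total l 1 with h | h
    · exact (Of h).1
    · have hm1 : m ≤ 1 := by nlinarith
      have := (Og hm1).1
      rw [this, one_mul] at hlm
      exact hlm
  have hm1 : m = 1 := by rw [hl1, mul_one] at hlm; exact hlm
  have Ff := (Of hl1.le).2
  have Fg := (Og hm1.le).2
  intro z
  rcases (hGnonneg z).eq_or_lt with h | h
  · rcases (hGnonneg (f z)).eq_or_lt with h' | h'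
    · rw [← h, ← h']
    · have := Fg _ h'
      rw [hgf] at this
      exact this.symm
  · exact Ff z h


end Helpers

/-- Suppose `f : ℂ² → ℂ²` is a holomorphic automorphism of `ℂ²`
(with holomorphic inverse `g`) and `f(Ω_c) = Ω_c` for some `c > 0`. Then
`G⁺_H ∘ f = G⁺_H` on all of `ℂ²`; in particular `f(Ω_b) = Ω_b` for every `b > 0`
and `f(K⁺) = K⁺`. -/
theorem stmt_3 (d : ℕ) (hd : 2 ≤ d) (a : ℂ) (ha : a ≠ 0)
    (p : Polynomial ℂ) (hpm : p.Monic) (hpd : p.natDegree = d)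
    (hpc : p.coeff (d - 1) = 0)
    (H : ℂ × ℂ → ℂ × ℂ) (hH : ∀ z : ℂ × ℂ, H z = (z.2, p.eval z.2 - a * z.1))
    (G : ℂ × ℂ → ℝ) (hGcont : Continuous G) (hGnonneg : ∀ z, 0 ≤ G z)
    (hGlim : ∀ z : ℂ × ℂ,
      Tendsto (fun n : ℕ => Real.log (max ‖H^[n] z‖ 1) / (d : ℝ) ^ n) atTop (𝓝 (G z)))
    (K : Set (ℂ × ℂ))
    (hK : K = {z : ℂ × ℂ | Bornology.IsBounded (Set.range fun n : ℕ => H^[n] z)})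
    (hKG : K = {z : ℂ × ℂ | G z = 0})
    (f g : ℂ × ℂ → ℂ × ℂ)
    (hfdiff : Differentiable ℂ f) (hgdiff : Differentiable ℂ g)
    (hgf : ∀ z : ℂ × ℂ, g (f z) = z) (hfg : ∀ z : ℂ × ℂ, f (g z) = z)
    (c : ℝ) (hc : 0 < c)
    (hfc : f '' {z : ℂ × ℂ | G z < c} = {z : ℂ × ℂ | G z < c}) :
    (∀ z : ℂ × ℂ, G (f z) = G z) ∧
    (∀ b : ℝ, 0 < b → f '' {z : ℂ × ℂ | G z < b} = {z : ℂ × ℂ | G z < b}) ∧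
    f '' K = K := by
  have hKb : ∀ z, G z = 0 ↔ Bornology.IsBounded (Set.range fun n : ℕ => H^[n] z) := by
    intro z
    have e := hKG.symm.trans hK
    exact Set.ext_iff.1 e z
  have hiff : ∀ z, G z < c ↔ G (f z) < c := by
    intro z
    constructor
    · intro h
      have : f z ∈ f '' {z : ℂ × ℂ | G z < c} := ⟨z, h, rfl⟩
      rw [hfc] at this
      exact this
    · intro h
      have h1 : f z ∈ f '' {z : ℂ × ℂ | G z < c} := by rw [hfc]; exact h
      obtain ⟨w, hw, hwz⟩ := h1
      have : w = z := by rw [← hgf w, hwz, hgf]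
      rw [← this]; exact hw
  have key := aux_final d hd a ha p hpm hpd H hH G hGcont hGnonneg hGlim hKb f g hfdiff hgdiff
    hgf hfg c hc hiff
  have keyg : ∀ z, G (g z) = G z := by
    intro z
    rw [← key (g z), hfg]
  refine ⟨key, ?_, ?_⟩
  · intro b _
    ext z
    constructor
    · rintro ⟨w, hw, rfl⟩
      have hw' : G w < b := hw
      show G (f w) < b
      rw [key]; exact hw'
    · intro hz
      have hz' : G z < b := hz
      exact ⟨g z, (by show G (g z) < b; rw [keyg]; exact hz'), hfg z⟩
  · rw [hKG]
    ext z
    constructor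
    · rintro ⟨w, hw, rfl⟩
      have hw' : G w = 0 := hw
      show G (f w) = 0
      rw [key]; exact hw'
    · intro hz
      have hz' : G z = 0 := hz
      exact ⟨g z, (by show G (g z) = 0; rw [keyg]; exact hz'), hfg z⟩
end
end

section
/- Let c, c' > 0 and let φ : Ω_c → Ω_{c'} be a biholomorphism. Then φ preserves the set of points with bounded forward orbit: φ(K⁺) = K⁺. -/
open Filter Topology Set

noncomputable section

structure Hen (d : ℕ) (a : ℂ) (p : Polynomial ℂ) (H : ℂ × ℂ → ℂ × ℂ) (G : ℂ × ℂ → ℝ) : Prop where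
  hd : 2 ≤ d
  ha : a ≠ 0
  hpm : p.Monic
  hpd : p.natDegree = d
  hH : ∀ z : ℂ × ℂ, H z = (z.2, p.eval z.2 - a * z.1)
  hGc : Continuous G
  hG0 : ∀ z, 0 ≤ G z
  hGl : ∀ z : ℂ × ℂ,
      Tendsto (fun n : ℕ => Real.log (max ‖H^[n] z‖ 1) / (d : ℝ) ^ n) atTop (𝓝 (G z))
  hK : ∀ z, G z = 0 ↔ Bornology.IsBounded (Set.range fun n : ℕ => H^[n] z)

namespace Hen

variable {d : ℕ} {a : ℂ} {p : Polynomial ℂ} {H : ℂ × ℂ → ℂ × ℂ} {G : ℂ × ℂ → ℝ}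

lemma poly_bound (q : Polynomial ℂ) (m : ℕ) (hq : q.natDegree ≤ m) (y : ℂ) (s : ℝ)
    (hs : 1 ≤ s) (hy : ‖y‖ ≤ s) :
    ‖q.eval y‖ ≤ (∑ i ∈ Finset.range (m + 1), ‖q.coeff i‖) * s ^ m := by
  rw [Polynomial.eval_eq_sum_range' (Nat.lt_succ_of_le hq), Finset.sum_mul]
  refine (norm_sum_le _ _).trans (Finset.sum_le_sum fun i hi => ?_)
  rw [norm_mul, norm_pow]
  have hi' : i ≤ m := Nat.lt_succ_iff.mp (Finset.mem_range.mp hi)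
  gcongr
  exact (pow_le_pow_left₀ (norm_nonneg _) hy i).trans (pow_le_pow_right₀ hs hi')

lemma dpos (h : Hen d a p H G) : (0 : ℝ) < d := by
  have := h.hd
  positivity

lemma d2 (h : Hen d a p H G) : (2 : ℝ) ≤ d := by
  exact_mod_cast h.hd

/-- upper growth -/
lemma exists_C (h : Hen d a p H G) : ∃ C : ℝ, 0 ≤ C ∧ ∀ z,
    Real.log (max ‖H z‖ 1) ≤ d * Real.log (max ‖z‖ 1) + C := by
  set B := (∑ i ∈ Finset.range (d + 1), ‖p.coeff i‖) + ‖a‖ + 1 with hB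
  have hB1 : 1 ≤ B := by
    have : 0 ≤ (∑ i ∈ Finset.range (d + 1), ‖p.coeff i‖) := Finset.sum_nonneg fun _ _ => norm_nonneg _
    have := norm_nonneg a
    linarith
  refine ⟨Real.log B, Real.log_nonneg hB1, fun z => ?_⟩
  set s := max ‖z‖ 1 with hs
  have hs1 : 1 ≤ s := le_max_right _ _
  have hz : ‖z‖ ≤ s := le_max_left _ _
  have hz1 : ‖z.1‖ ≤ s := (norm_fst_le z).trans hz
  have hz2 : ‖z.2‖ ≤ s := (norm_snd_le z).trans hz
  have hd1 : 1 ≤ d := by have := h.hd; omega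
  have hsd : s ≤ s ^ d := le_self_pow₀ hs1 (by omega)
  have hsd1 : 1 ≤ s ^ d := one_le_pow₀ hs1
  have key : max ‖H z‖ 1 ≤ B * s ^ d := by
    have hp := poly_bound p d h.hpd.le z.2 s hs1 hz2
    have hS : 0 ≤ (∑ i ∈ Finset.range (d + 1), ‖p.coeff i‖) := Finset.sum_nonneg fun _ _ => norm_nonneg _
    have hna := norm_nonneg a
    apply max_le
    · rw [h.hH, Prod.norm_def]
      apply max_le
      · simp only
        nlinarith
      · simp only
        refine (norm_sub_le _ _).trans ?_
        rw [norm_mul]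
        have : ‖a‖ * ‖z.1‖ ≤ ‖a‖ * s ^ d := by gcongr; linarith
        rw [hB]; nlinarith
    · nlinarith
  calc Real.log (max ‖H z‖ 1) ≤ Real.log (B * s ^ d) :=
        Real.log_le_log (by positivity) key
    _ = d * Real.log s + Real.log B := by
        rw [Real.log_mul (by positivity) (by positivity), Real.log_pow]; ring

lemma G_H (h : Hen d a p H G) (z : ℂ × ℂ) : G (H z) = d * G z := by
  have h1 := h.hGl (H z)
  have h2 := ((h.hGl z).comp (tendsto_add_atTop_nat 1)).const_mul (d : ℝ)
  refine tendsto_nhds_unique h1 (h2.congr fun n => ?_)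
  have := h.dpos
  simp only [Function.comp, Function.iterate_succ_apply]
  rw [pow_succ]; field_simp

lemma G_iter (h : Hen d a p H G) (n : ℕ) (z : ℂ × ℂ) : G (H^[n] z) = d ^ n * G z := by
  induction n generalizing z with
  | zero => simp
  | succ n ih => rw [Function.iterate_succ_apply, ih, h.G_H]; ring

/-- the inverse -/
def Hi (a : ℂ) (p : Polynomial ℂ) (z : ℂ × ℂ) : ℂ × ℂ := ((p.eval z.1 - z.2) / a, z.1)

lemma Hi_H (h : Hen d a p H G) (z : ℂ × ℂ) : Hi a p (H z) = z := by
  have := h.ha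
  rw [h.hH]; unfold Hi; ext <;> simp; field_simp

lemma H_Hi (h : Hen d a p H G) (z : ℂ × ℂ) : H (Hi a p z) = z := by
  have := h.ha
  rw [h.hH]; unfold Hi; ext <;> simp; field_simp; ring

lemma H_Hi_iter (h : Hen d a p H G) (n : ℕ) (z : ℂ × ℂ) : H^[n] ((Hi a p)^[n] z) = z :=
  Function.LeftInverse.iterate h.H_Hi n z

lemma Hi_H_iter (h : Hen d a p H G) (n : ℕ) (z : ℂ × ℂ) : (Hi a p)^[n] (H^[n] z) = z :=
  Function.LeftInverse.iterate h.Hi_H n z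

lemma G_Hi_iter (h : Hen d a p H G) (n : ℕ) (z : ℂ × ℂ) : G ((Hi a p)^[n] z) = G z / d ^ n := by
  have := h.dpos
  rw [eq_div_iff (by positivity), mul_comm, ← h.G_iter, h.H_Hi_iter]

lemma contDiff_Hi : ContDiff ℂ 1 (Hi a p) := by
  unfold Hi
  have : ContDiff ℂ 1 (fun x : ℂ => p.eval x) := p.contDiff_aeval 1
  have h2 : ContDiff ℂ 1 (fun z : ℂ × ℂ => p.eval z.1) := this.comp contDiff_fst
  exact ((h2.sub contDiff_snd).div_const a).prodMk contDiff_fst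

lemma diff_Hi : Differentiable ℂ (Hi a p) := contDiff_Hi.differentiable (by norm_num)

lemma diff_H (h : Hen d a p H G) : Differentiable ℂ H := by
  have : H = fun z : ℂ × ℂ => (z.2, p.eval z.2 - a * z.1) := funext h.hH
  rw [this]
  have h2 : Differentiable ℂ (fun z : ℂ × ℂ => p.eval z.2) := p.differentiable.comp differentiable_snd
  exact differentiable_snd.prodMk (h2.sub (differentiable_fst.const_mul a))

lemma diff_H_iter (h : Hen d a p H G) (n : ℕ) : Differentiable ℂ (H^[n]) := h.diff_H.iterate n

/-- decreasing approximations -/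
def hn (d : ℕ) (H : ℂ × ℂ → ℂ × ℂ) (C : ℝ) (n : ℕ) (z : ℂ × ℂ) : ℝ :=
  (Real.log (max ‖H^[n] z‖ 1) + C) / (d : ℝ) ^ n

lemma hn_anti (h : Hen d a p H G) {C : ℝ} (hC0 : 0 ≤ C)
    (hC : ∀ z, Real.log (max ‖H z‖ 1) ≤ d * Real.log (max ‖z‖ 1) + C) (z : ℂ × ℂ) :
    Antitone fun n => hn d H C n z := by
  have hd := h.dpos
  have hd2 := h.d2
  refine antitone_nat_of_succ_le fun n => ?_
  unfold hn
  rw [div_le_div_iff₀ (by positivity) (by positivity), Function.iterate_succ_apply', pow_succ]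
  have := hC (H^[n] z)
  have hp : (0 : ℝ) < d ^ n := by positivity
  have : Real.log (max ‖H (H^[n] z)‖ 1) + C ≤ d * (Real.log (max ‖H^[n] z‖ 1) + C) := by nlinarith
  nlinarith

lemma hn_tendsto (h : Hen d a p H G) (C : ℝ) (z : ℂ × ℂ) :
    Tendsto (fun n => hn d H C n z) atTop (𝓝 (G z)) := by
  have hd2 := h.d2
  have h1 : Tendsto (fun n : ℕ => C / (d : ℝ) ^ n) atTop (𝓝 0) :=
    tendsto_const_nhds.div_atTop (tendsto_pow_atTop_atTop_of_one_lt (by linarith))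
  have := (h.hGl z).add h1
  simpa [hn, add_div] using this

lemma G_le_hn (h : Hen d a p H G) {C : ℝ} (hC0 : 0 ≤ C)
    (hC : ∀ z, Real.log (max ‖H z‖ 1) ≤ d * Real.log (max ‖z‖ 1) + C) (n : ℕ) (z : ℂ × ℂ) :
    G z ≤ hn d H C n z :=
  (h.hn_anti hC0 hC z).le_of_tendsto (h.hn_tendsto C z) n

lemma cont_hn (h : Hen d a p H G) (C : ℝ) (n : ℕ) : Continuous (hn d H C n) := by
  unfold hn
  have := (h.diff_H_iter n).continuous
  refine Continuous.div_const (Continuous.add (Continuous.log (by fun_prop) fun z => ?_) continuous_const) _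
  have : (1 : ℝ) ≤ max ‖H^[n] z‖ 1 := le_max_right _ _
  positivity

lemma compact_lt (h : Hen d a p H G) {C : ℝ} (hC0 : 0 ≤ C)
    (hC : ∀ z, Real.log (max ‖H z‖ 1) ≤ d * Real.log (max ‖z‖ 1) + C)
    {Q : Set (ℂ × ℂ)} (hQ : IsCompact Q) {A : ℝ} (hA : ∀ z ∈ Q, G z < A) :
    ∃ N, ∀ n ≥ N, ∀ z ∈ Q, hn d H C n z < A := by
  obtain ⟨N, hN⟩ := hQ.elim_directed_cover (fun n => {z | hn d H C n z < A})
    (fun n => isOpen_lt (h.cont_hn C n) continuous_const)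
    (fun z hz => by
      have := ((h.hn_tendsto C z).eventually_lt_const (hA z hz)).exists
      simpa using this)
    (directed_of_isDirected_le fun i j hij z hz => lt_of_le_of_lt (h.hn_anti hC0 hC z hij) hz)
  exact ⟨N, fun n hn z hz => lt_of_le_of_lt (h.hn_anti hC0 hC z hn) (hN hz)⟩

lemma three_circle (h : Hen d a p H G) {U : Set ℂ} {f : ℂ → ℂ × ℂ}
    (hf : DifferentiableOn ℂ f U) {r R A B : ℝ} (hr : 0 < r) (hr1 : r < 1) (hR : 1 < R)
    (hUR : Metric.closedBall 0 R ⊆ U)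
    (hA : ∀ ζ : ℂ, ‖ζ‖ = r → G (f ζ) < A) (hB : ∀ ζ : ℂ, ‖ζ‖ = R → G (f ζ) < B) :
    G (f 1) ≤ (1 - (-Real.log r) / (Real.log R - Real.log r)) * A +
      (-Real.log r) / (Real.log R - Real.log r) * B := by
  obtain ⟨C, hC0, hC⟩ := h.exists_C
  have hfc : ContinuousOn f (Metric.closedBall 0 R) := hf.continuousOn.mono hUR
  have comp : ∀ s : ℝ, s ≤ R → IsCompact (f '' Metric.sphere 0 s) := fun s hs =>
    (isCompact_sphere 0 s).image_of_continuousOn (hfc.mono fun x hx => by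
      simp at hx ⊢; linarith)
  obtain ⟨N1, h1⟩ := h.compact_lt hC0 hC (comp r (by linarith)) (A := A) (by
    rintro _ ⟨ζ, hζ, rfl⟩; exact hA ζ (by simpa using hζ))
  obtain ⟨N2, h2⟩ := h.compact_lt hC0 hC (comp R le_rfl) (A := B) (by
    rintro _ ⟨ζ, hζ, rfl⟩; exact hB ζ (by simpa using hζ))
  set m := max N1 N2
  have hd := h.dpos
  have hdm : (0 : ℝ) < d ^ m := by positivity
  set F : ℂ → ℂ × (ℂ × ℂ) := fun s => (1, H^[m] (f (Complex.exp s))) with hF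
  have hFn : ∀ s, ‖F s‖ = max ‖H^[m] (f (Complex.exp s))‖ 1 := fun s => by
    rw [hF, Prod.norm_def]; simp [max_comm]
  have hlt : Real.log r < Real.log R := Real.log_lt_log hr (by linarith)
  have hmem : ∀ s ∈ Complex.HadamardThreeLines.verticalClosedStrip (Real.log r) (Real.log R),
      Complex.exp s ∈ Metric.closedBall (0 : ℂ) R := by
    intro s hs
    have hs' : s.re ≤ Real.log R := hs.2
    rw [mem_closedBall_zero_iff, Complex.norm_exp]
    calc Real.exp s.re ≤ Real.exp (Real.log R) := Real.exp_le_exp.mpr hs'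
      _ = R := Real.exp_log (by linarith)
  have hcl : closure (Complex.HadamardThreeLines.verticalStrip (Real.log r) (Real.log R)) ⊆
      Complex.HadamardThreeLines.verticalClosedStrip (Real.log r) (Real.log R) :=
    closure_minimal (fun s hs => ⟨hs.1.le, hs.2.le⟩) (isClosed_Icc.preimage Complex.continuous_re)
  have hFd : DifferentiableOn ℂ F
      (Complex.exp ⁻¹' U) := by
    refine (differentiableOn_const _).prodMk ?_
    refine (h.diff_H_iter m).comp_differentiableOn (hf.comp Complex.differentiable_exp.differentiableOn ?_)
    exact fun x hx => hx
  have hsub : Complex.HadamardThreeLines.verticalClosedStrip (Real.log r) (Real.log R) ⊆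
      Complex.exp ⁻¹' U := fun s hs => hUR (hmem s hs)
  have hdc : DiffContOnCl ℂ F (Complex.HadamardThreeLines.verticalStrip (Real.log r) (Real.log R)) :=
    (hFd.mono (hcl.trans hsub)).diffContOnCl
  have hbdd : BddAbove ((norm ∘ F) '' Complex.HadamardThreeLines.verticalClosedStrip (Real.log r) (Real.log R)) := by
    have hcc : ContinuousOn (fun ζ => max ‖H^[m] (f ζ)‖ 1) (Metric.closedBall 0 R) :=
      (((h.diff_H_iter m).continuous.comp_continuousOn hfc).norm).sup continuousOn_const
    obtain ⟨M, hM⟩ := (isCompact_closedBall (0 : ℂ) R).bddAbove_image hcc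
    refine ⟨M, ?_⟩
    rintro _ ⟨s, hs, rfl⟩
    simp only [Function.comp, hFn]
    exact hM ⟨_, hmem s hs, rfl⟩
  have conv : ∀ (z : ℂ × ℂ) (A : ℝ), hn d H C m z < A → max ‖H^[m] z‖ 1 ≤ Real.exp (d ^ m * A - C) := by
    intro z A hz
    unfold hn at hz
    rw [div_lt_iff₀ hdm] at hz
    have : (0 : ℝ) < max ‖H^[m] z‖ 1 := lt_of_lt_of_le one_pos (le_max_right _ _)
    rw [← Real.log_le_iff_le_exp this]
    linarith
  have main := Complex.HadamardThreeLines.norm_le_interp_of_mem_verticalClosedStrip' (f := F) (z := 0)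
    (a := Real.exp (d ^ m * A - C)) (b := Real.exp (d ^ m * B - C)) hlt
    ⟨by simpa using (Real.log_neg hr hr1).le, by simpa using (Real.log_pos hR).le⟩ hdc hbdd
    (by
      intro s hs
      have hs : s.re = Real.log r := hs
      rw [hFn]
      refine conv _ _ (h1 m (le_max_left _ _) _ ⟨_, ?_, rfl⟩)
      simp [Complex.norm_exp, hs, Real.exp_log hr])
    (by
      intro s hs
      have hs : s.re = Real.log R := hs
      rw [hFn]
      refine conv _ _ (h2 m (le_max_right _ _) _ ⟨_, ?_, rfl⟩)
      simp [Complex.norm_exp, hs, Real.exp_log (by linarith : 0 < R)])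
  rw [hFn] at main
  simp only [Complex.exp_zero, Complex.zero_re, zero_sub] at main
  set θ := -Real.log r / (Real.log R - Real.log r)
  rw [← Real.exp_mul, ← Real.exp_mul, ← Real.exp_add] at main
  have hpos : (0 : ℝ) < max ‖H^[m] (f 1)‖ 1 := lt_of_lt_of_le one_pos (le_max_right _ _)
  rw [← Real.log_le_iff_le_exp hpos] at main
  refine (h.G_le_hn hC0 hC m (f 1)).trans ?_
  unfold hn
  rw [div_le_iff₀ hdm]
  nlinarith

end Hen

namespace Hen

variable {d : ℕ} {a : ℂ} {p : Polynomial ℂ} {H : ℂ × ℂ → ℂ × ℂ} {G : ℂ × ℂ → ℝ}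

lemma lip_Hi (a : ℂ) (p : Polynomial ℂ) (M : ℝ) : ∃ L : ℝ, 1 ≤ L ∧
    ∀ z w : ℂ × ℂ, ‖z‖ ≤ M → ‖w‖ ≤ M → ‖Hi a p z - Hi a p w‖ ≤ L * ‖z - w‖ := by
  have hc : Continuous (fun z => ‖fderiv ℂ (Hi a p) z‖) :=
    ((contDiff_Hi (a := a) (p := p)).continuous_fderiv (by norm_num)).norm
  obtain ⟨B, hB⟩ := (isCompact_closedBall (0 : ℂ × ℂ) M).bddAbove_image hc.continuousOn
  refine ⟨max B 1, le_max_right _ _, fun z w hz hw => ?_⟩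
  refine (convex_closedBall (0 : ℂ × ℂ) M).norm_image_sub_le_of_norm_fderiv_le (𝕜 := ℂ)
    (f := Hi a p) (fun x _ => diff_Hi x) (fun x hx => ?_) (by simpa using hw) (by simpa using hz)
  exact (hB ⟨x, hx, rfl⟩).trans (le_max_left _ _)

lemma back (h : Hen d a p H G) {M L : ℝ} (hL : 1 ≤ L)
    (hl : ∀ z w : ℂ × ℂ, ‖z‖ ≤ M + 1 → ‖w‖ ≤ M + 1 → ‖Hi a p z - Hi a p w‖ ≤ L * ‖z - w‖)
    {z0 : ℂ × ℂ} (hz0 : ∀ n, ‖H^[n] z0‖ ≤ M) {η : ℝ} (hη0 : 0 ≤ η) (hη : η ≤ 1) (n : ℕ) :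
    ∀ z, ‖z - H^[n] z0‖ ≤ η / L ^ n → ‖(Hi a p)^[n] z - z0‖ ≤ η := by
  induction n with
  | zero => intro z hz; simpa using hz
  | succ n ih =>
    intro z hz
    rw [Function.iterate_succ_apply]
    apply ih
    have e : H^[n] z0 = Hi a p (H^[n+1] z0) := by
      rw [Function.iterate_succ_apply', h.Hi_H]
    have hLn : 1 ≤ L ^ (n + 1) := one_le_pow₀ hL
    have h1 : η / L ^ (n+1) ≤ 1 := (div_le_one (by positivity)).mpr (hη.trans hLn)
    have h2 : ‖z‖ ≤ M + 1 := by
      have := norm_add_le (z - H^[n+1] z0) (H^[n+1] z0)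
      rw [sub_add_cancel] at this
      linarith [hz0 (n+1)]
    rw [e]
    refine (hl _ _ h2 ((hz0 _).trans (by linarith))).trans ?_
    calc L * ‖z - H^[n+1] z0‖ ≤ L * (η / L ^ (n+1)) := by gcongr
      _ = η / L ^ n := by rw [pow_succ]; field_simp

lemma tendsto_aux (α β γ D : ℝ) (hγ : 0 < γ) (hD : 1 < D) :
    Tendsto (fun n : ℕ => (α + n * β) / (D ^ n * γ + (α + n * β))) atTop (𝓝 0) := by
  have h1 : Tendsto (fun n : ℕ => (n : ℝ) / D ^ n) atTop (𝓝 0) := by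
    simpa using tendsto_pow_const_div_const_pow_of_one_lt 1 hD
  have h2 : Tendsto (fun n : ℕ => α / D ^ n) atTop (𝓝 0) :=
    tendsto_const_nhds.div_atTop (tendsto_pow_atTop_atTop_of_one_lt hD)
  have h3 : Tendsto (fun n : ℕ => α / D ^ n + (n : ℝ) / D ^ n * β) atTop (𝓝 0) := by
    simpa using h2.add (h1.mul_const β)
  have h4 := h3.div (h3.const_add γ) (by simpa using hγ.ne')
  simp only [add_zero, zero_div] at h4
  refine h4.congr fun n => ?_
  have : 0 < D ^ n := by positivity
  simp only [Pi.div_apply]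
  have e1 : α / D ^ n + (n : ℝ) / D ^ n * β = (α + n * β) / D ^ n := by ring
  have e2 : γ + (α + n * β) / D ^ n = (D ^ n * γ + (α + n * β)) / D ^ n := by field_simp
  rw [e1, e2, div_div_div_cancel_right₀ this.ne']

lemma const_on_K (h : Hen d a p H G) {c c' : ℝ} (hc' : 0 < c') {ψ : ℂ × ℂ → ℂ × ℂ}
    (hψ : DifferentiableOn ℂ ψ {z | G z < c'}) (hm : MapsTo ψ {z | G z < c'} {z | G z < c})
    {z0 w0 : ℂ × ℂ} (hz0 : G z0 = 0) (hw0 : G w0 = 0) : G (ψ w0) ≤ G (ψ z0) := by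
  refine le_of_forall_pos_le_add fun ε hε => ?_
  obtain ⟨C, hC0, hC⟩ := h.exists_C
  have hop : ∀ s : ℝ, IsOpen {z | G z < s} := fun s => isOpen_lt h.hGc continuous_const
  have hd2 := h.d2
  have hd := h.dpos
  have hcont : ContinuousAt (fun z => G (ψ z)) z0 :=
    h.hGc.continuousAt.comp (hψ.continuousOn.continuousAt ((hop c').mem_nhds (by simpa [hz0] using hc')))
  obtain ⟨η', hη', hb⟩ := Metric.eventually_nhds_iff.mp
    (hcont.eventually_lt_const (show G (ψ z0) < G (ψ z0) + ε by linarith))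
  set η := min (η' / 2) 1
  have hη0 : 0 < η := by positivity
  have hη1 : η ≤ 1 := min_le_right _ _
  have hb' : ∀ z, ‖z - z0‖ ≤ η → G (ψ z) < G (ψ z0) + ε := fun z hz => hb (by
    rw [dist_eq_norm]
    have : η ≤ η' / 2 := min_le_left _ _
    linarith)
  obtain ⟨M1, hM1⟩ := ((h.hK z0).mp hz0).exists_norm_le
  obtain ⟨M2, hM2⟩ := ((h.hK w0).mp hw0).exists_norm_le
  set M := max (max M1 M2) 1
  have hM : 1 ≤ M := le_max_right _ _
  have hzM : ∀ n, ‖H^[n] z0‖ ≤ M := fun n =>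
    (hM1 _ ⟨n, rfl⟩).trans ((le_max_left _ _).trans (le_max_left _ _))
  have hwM : ∀ n, ‖H^[n] w0‖ ≤ M := fun n =>
    (hM2 _ ⟨n, rfl⟩).trans ((le_max_right _ _).trans (le_max_left _ _))
  obtain ⟨L, hL, hl⟩ := lip_Hi a p (M + 1)
  have hθ := tendsto_aux (Real.log (2 * M / η)) (Real.log L) (c' / 2) d (by positivity) (by linarith)
  have hlim := ((hθ.const_sub 1).mul_const (G (ψ z0) + ε)).add (hθ.mul_const c)
  simp only [sub_zero, one_mul, zero_mul, add_zero] at hlim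
  refine ge_of_tendsto hlim ?_
  have hbig : Tendsto (fun n : ℕ => (d : ℝ) ^ n * (c' / 2)) atTop atTop :=
    (tendsto_pow_atTop_atTop_of_one_lt (by linarith)).atTop_mul_const (by positivity)
  filter_upwards [hbig.eventually_gt_atTop (Real.log (3 * M) + C)] with n hn
  have hdn : (0 : ℝ) < d ^ n := by positivity
  have hLn : 1 ≤ L ^ n := one_le_pow₀ hL
  set r := η / (2 * M * L ^ n) with hr
  set R := Real.exp (d ^ n * (c' / 2)) with hR
  have hr0 : 0 < r := by positivity
  have hr1 : r < 1 := by
    rw [hr, div_lt_one (by positivity)]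
    nlinarith
  have hR1 : 1 < R := by
    rw [hR, Real.one_lt_exp_iff]; positivity
  set ℓ : ℂ → ℂ × ℂ := fun ζ => H^[n] z0 + ζ • (H^[n] w0 - H^[n] z0) with hℓ
  have hℓd : Differentiable ℂ ℓ := by rw [hℓ]; fun_prop
  have hdiff : ‖H^[n] w0 - H^[n] z0‖ ≤ 2 * M := by
    refine (norm_sub_le _ _).trans ?_
    linarith [hzM n, hwM n]
  have hin : ∀ ζ : ℂ, ‖ζ‖ ≤ R → G ((Hi a p)^[n] (ℓ ζ)) < c' := by
    intro ζ hζ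
    rw [h.G_Hi_iter, div_lt_iff₀ hdn]
    have h1 := h.G_le_hn hC0 hC 0 (ℓ ζ)
    simp only [Hen.hn, Function.iterate_zero, id_eq, pow_zero, div_one] at h1
    have h2 : ‖ℓ ζ‖ ≤ 3 * M * R := by
      have := norm_add_le (H^[n] z0) (ζ • (H^[n] w0 - H^[n] z0))
      rw [norm_smul] at this
      have h3 : ‖ζ‖ * ‖H^[n] w0 - H^[n] z0‖ ≤ R * (2 * M) := by gcongr
      have := hzM n
      simp only [hℓ]
      nlinarith
    have h3 : max ‖ℓ ζ‖ 1 ≤ 3 * M * R := max_le h2 (by nlinarith)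
    have h4 : Real.log (max ‖ℓ ζ‖ 1) ≤ Real.log (3 * M) + d ^ n * (c' / 2) := by
      refine (Real.log_le_log (lt_of_lt_of_le one_pos (le_max_right _ _)) h3).trans ?_
      rw [Real.log_mul (by positivity) (by positivity), hR, Real.log_exp]
    linarith
  have key := h.three_circle (U := {ζ | G ((Hi a p)^[n] (ℓ ζ)) < c'})
    (f := fun ζ => ψ ((Hi a p)^[n] (ℓ ζ))) (A := G (ψ z0) + ε) (B := c)
    (hψ.comp (((diff_Hi.iterate n).comp hℓd).differentiableOn) (fun ζ hζ => hζ)) hr0 hr1 hR1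
    (fun ζ hζ => hin ζ (by simpa using hζ))
    (fun ζ hζ => by
      apply hb'
      refine h.back hL hl hzM hη0.le hη1 n _ ?_
      simp only [hℓ, add_sub_cancel_left, norm_smul, hζ]
      calc r * ‖H^[n] w0 - H^[n] z0‖ ≤ r * (2 * M) := by gcongr
        _ = η / L ^ n := by rw [hr]; field_simp)
    (fun ζ hζ => hm (hin ζ hζ.le))
  have e1 : ℓ 1 = H^[n] w0 := by simp [hℓ]
  simp only [e1, h.Hi_H_iter] at key
  have e2 : -Real.log r = Real.log (2 * M / η) + n * Real.log L := by
    rw [hr, Real.log_div (by positivity) (by positivity), Real.log_mul (by positivity) (by positivity),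
      Real.log_pow, Real.log_div (by positivity) (by positivity)]
    ring
  have e3 : Real.log R - Real.log r = d ^ n * (c' / 2) + (Real.log (2 * M / η) + n * Real.log L) := by
    rw [sub_eq_add_neg, e2, hR, Real.log_exp]
  rw [e3, e2] at key
  exact key

end Hen

namespace Hen

variable {d : ℕ} {a : ℂ} {p : Polynomial ℂ} {H : ℂ × ℂ → ℂ × ℂ} {G : ℂ × ℂ → ℝ}

/-- the escape region -/
def V (R0 : ℝ) : Set (ℂ × ℂ) := {z | R0 < ‖z.2‖ ∧ ‖z.1‖ < ‖z.2‖}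

lemma isOpen_V (R0 : ℝ) : IsOpen (V R0) :=
  (isOpen_lt continuous_const continuous_snd.norm).inter
    (isOpen_lt continuous_fst.norm continuous_snd.norm)

/-- admissible radius -/
def Adm (d : ℕ) (H : ℂ × ℂ → ℂ × ℂ) (R0 : ℝ) : Prop :=
  2 ≤ R0 ∧ ∀ z ∈ V R0, ‖(H z).2 / z.2 ^ d - 1‖ ≤ 1 / 2 ∧ H z ∈ V R0

lemma exists_R0 (h : Hen d a p H G) : ∃ R0, Adm d H R0 := by
  set S := ∑ i ∈ Finset.range (d - 1 + 1), ‖p.eraseLead.coeff i‖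
  have hS : 0 ≤ S := Finset.sum_nonneg fun _ _ => norm_nonneg _
  set B := S + ‖a‖
  have hB : 0 ≤ B := add_nonneg hS (norm_nonneg a)
  refine ⟨2 * B + 2, by linarith, ?_⟩
  rintro ⟨x, y⟩ ⟨h1, h2⟩
  simp only at h1 h2
  have hy2 : 2 < ‖y‖ := by linarith
  have hy : y ≠ 0 := by rw [← norm_pos_iff]; linarith
  obtain ⟨k, hk⟩ : ∃ k, d = k + 2 := ⟨d - 2, by have := h.hd; omega⟩
  have hq := poly_bound p.eraseLead (d - 1)
    (p.eraseLead_natDegree_le.trans (by rw [h.hpd])) y ‖y‖ (by linarith) le_rfl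
  have hp : p.eval y = p.eraseLead.eval y + y ^ d := by
    conv_lhs => rw [← p.eraseLead_add_C_mul_X_pow]
    simp [h.hpd, h.hpm.leadingCoeff]
  have e : (H (x, y)).2 / y ^ d - 1 = (p.eraseLead.eval y - a * x) / y ^ d := by
    rw [h.hH]; simp only [hp]; field_simp; ring
  have hfirst : ‖(H (x, y)).2 / y ^ d - 1‖ ≤ 1 / 2 := by
    rw [e, norm_div, norm_pow, div_le_iff₀ (by positivity)]
    refine (norm_sub_le _ _).trans ?_
    rw [norm_mul]
    have hyk : ‖y‖ ≤ ‖y‖ ^ (d - 1) := le_self_pow₀ (by linarith) (by omega)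
    have : ‖a‖ * ‖x‖ ≤ ‖a‖ * ‖y‖ ^ (d - 1) := by gcongr; linarith
    have e2 : ‖y‖ ^ d = ‖y‖ * ‖y‖ ^ (d - 1) := by rw [hk]; simp [pow_succ]; ring
    have hpos : 0 < ‖y‖ ^ (d - 1) := by positivity
    have e3 : B * ‖y‖ ^ (d-1) ≤ 1 / 2 * (‖y‖ * ‖y‖ ^ (d - 1)) := by nlinarith
    rw [e2]
    calc _ ≤ S * ‖y‖ ^ (d-1) + ‖a‖ * ‖y‖ ^ (d-1) := add_le_add hq this
      _ = B * ‖y‖ ^ (d-1) := by ring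
      _ ≤ _ := e3
  refine ⟨hfirst, ?_⟩
  have hbig : ‖y‖ < ‖(H (x, y)).2‖ := by
    have h3 : 1 / 2 ≤ ‖(H (x, y)).2 / y ^ d‖ := by
      have := norm_sub_norm_le (1 : ℂ) (1 - (H (x, y)).2 / y ^ d)
      rw [norm_one, sub_sub_cancel, norm_sub_rev] at this
      linarith
    rw [norm_div, norm_pow, le_div_iff₀ (by positivity)] at h3
    have : ‖y‖ * ‖y‖ ≤ ‖y‖ ^ d := by
      rw [← sq]; exact pow_le_pow_right₀ (by linarith) h.hd
    nlinarith
  refine ⟨h1.trans hbig, ?_⟩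
  have : (H (x, y)).1 = y := by rw [h.hH]
  rw [this]; exact hbig

variable {R0 : ℝ}

lemma V_iter (hR : Adm d H R0) {z : ℂ × ℂ} (hz : z ∈ V R0) (n : ℕ) : H^[n] z ∈ V R0 := by
  induction n with
  | zero => exact hz
  | succ n ih => rw [Function.iterate_succ_apply']; exact (hR.2 _ ih).2

/-- terms of the Boettcher series -/
def bt (d : ℕ) (H : ℂ × ℂ → ℂ × ℂ) (n : ℕ) (z : ℂ × ℂ) : ℂ :=
  ((1 / (d : ℝ) ^ (n + 1) : ℝ) : ℂ) * Complex.log ((H^[n+1] z).2 / (H^[n] z).2 ^ d)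

lemma bt_bound (h : Hen d a p H G) (hR : Adm d H R0) {z : ℂ × ℂ} (hz : z ∈ V R0) (n : ℕ) :
    ‖bt d H n z‖ ≤ 1 / (d : ℝ) ^ (n + 1) := by
  have := h.dpos
  have h1 := (hR.2 _ (V_iter hR hz n)).1
  rw [← Function.iterate_succ_apply' H] at h1
  have h2 := Complex.norm_log_one_add_half_le_self h1
  rw [add_sub_cancel] at h2
  unfold bt
  rw [norm_mul, Complex.norm_real, Real.norm_of_nonneg (by positivity)]
  have : ‖Complex.log ((H^[n+1] z).2 / (H^[n] z).2 ^ d)‖ ≤ 1 := by linarith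
  exact mul_le_of_le_one_right (by positivity) this

lemma summ (h : Hen d a p H G) : Summable (fun n : ℕ => 1 / (d : ℝ) ^ (n + 1)) := by
  have hd := h.d2
  have := (summable_nat_add_iff 1).mpr (summable_geometric_of_lt_one (r := 1 / (d : ℝ)) (by positivity)
    (by rw [div_lt_one (by linarith)]; linarith))
  simpa [one_div, inv_pow] using this

lemma G_eq (h : Hen d a p H G) (hR : Adm d H R0) {z : ℂ × ℂ} (hz : z ∈ V R0) :
    G z = Real.log ‖z.2‖ + (∑' n, bt d H n z).re := by
  have hd := h.dpos
  have hs : Summable (fun n => bt d H n z) :=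
    Summable.of_norm_bounded h.summ (fun n => h.bt_bound hR hz n)
  have h1 := (Complex.hasSum_re hs.hasSum).tendsto_sum_nat
  have h2 := h.hGl z
  have hV := fun n => V_iter hR hz n
  have e : ∀ n, Real.log (max ‖H^[n] z‖ 1) = Real.log ‖(H^[n] z).2‖ := fun n => by
    have h3 := hV n
    have := hR.1
    have h4 : R0 < ‖(H^[n] z).2‖ := h3.1
    rw [Prod.norm_def, max_eq_right h3.2.le, max_eq_left (by linarith)]
  have hne : ∀ n, (H^[n] z).2 ≠ 0 := fun n => by
    have h3 := (hV n).1
    have := hR.1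
    rw [← norm_pos_iff]; linarith
  have e2 : ∀ N, ∑ n ∈ Finset.range N, (bt d H n z).re =
      Real.log ‖(H^[N] z).2‖ / d ^ N - Real.log ‖z.2‖ := by
    intro N
    induction N with
    | zero => simp
    | succ N ih =>
      rw [Finset.sum_range_succ, ih]
      unfold bt
      rw [Complex.re_ofReal_mul, Complex.log_re, norm_div, norm_pow,
        Real.log_div (norm_ne_zero_iff.mpr (hne _)) (pow_ne_zero _ (norm_ne_zero_iff.mpr (hne _))), Real.log_pow]
      rw [pow_succ]
      field_simp
      ring
  simp only [e2] at h1
  simp only [e] at h2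
  have := tendsto_nhds_unique h1 (h2.sub_const (Real.log ‖z.2‖))
  linarith

lemma G_lower (h : Hen d a p H G) (hR : Adm d H R0) : ∃ B : ℝ, ∀ z ∈ V R0, Real.log ‖z.2‖ - B ≤ G z := by
  refine ⟨∑' n : ℕ, 1 / (d : ℝ) ^ (n + 1), fun z hz => ?_⟩
  have := tsum_of_norm_bounded h.summ.hasSum (fun n => h.bt_bound hR hz n)
  have h2 := (Complex.abs_re_le_norm _).trans this
  rw [h.G_eq hR hz]
  linarith [(abs_le.mp h2).1]

lemma boet (h : Hen d a p H G) (hR : Adm d H R0) {U : Set ℂ} (hU : IsOpen U) {γ : ℂ → ℂ × ℂ}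
    (hγ : DifferentiableOn ℂ γ U) (hm : MapsTo γ U (V R0)) :
    ∃ g : ℂ → ℂ, DifferentiableOn ℂ g U ∧ ∀ ζ ∈ U, g ζ ≠ 0 ∧ G (γ ζ) = Real.log ‖g ζ‖ := by
  have hR2 := hR.1
  have hd1 : ∀ n, DifferentiableOn ℂ (fun ζ => (H^[n] (γ ζ)).2) U := fun n =>
    differentiable_snd.comp_differentiableOn ((h.diff_H_iter n).comp_differentiableOn hγ)
  have hne : ∀ n, ∀ ζ ∈ U, (H^[n] (γ ζ)).2 ≠ 0 := fun n ζ hζ => by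
    have h3 := (V_iter hR (hm hζ) n).1
    rw [← norm_pos_iff]; linarith
  have hbd : ∀ n, DifferentiableOn ℂ (fun ζ => bt d H n (γ ζ)) U := fun n => by
    unfold bt
    refine DifferentiableOn.const_mul (DifferentiableOn.clog ?_ fun ζ hζ => ?_) _
    · exact (hd1 (n+1)).div ((hd1 n).pow d) fun ζ hζ => pow_ne_zero _ (hne n ζ hζ)
    · have h1 := (hR.2 _ (V_iter hR (hm hζ) n)).1
      rw [← Function.iterate_succ_apply' H] at h1
      have := Complex.mem_slitPlane_of_norm_lt_one (lt_of_le_of_lt h1 (by norm_num))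
      rwa [add_sub_cancel] at this
  have hT := Complex.differentiableOn_tsum_of_summable_norm h.summ hbd hU
    (fun n ζ hζ => h.bt_bound hR (hm hζ) n)
  refine ⟨fun ζ => (γ ζ).2 * Complex.exp (∑' n, bt d H n (γ ζ)), (hd1 0).mul hT.cexp, fun ζ hζ => ?_⟩
  have h0 : (γ ζ).2 ≠ 0 := hne 0 ζ hζ
  refine ⟨mul_ne_zero h0 (Complex.exp_ne_zero _), ?_⟩
  rw [norm_mul, Real.log_mul (norm_ne_zero_iff.mpr h0) (norm_ne_zero_iff.mpr (Complex.exp_ne_zero _)),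
    Complex.norm_exp, Real.log_exp, h.G_eq hR (hm hζ)]

lemma escape (h : Hen d a p H G) {z : ℂ × ℂ} (hz : 0 < G z) : ∃ n, H^[n] z ∈ V R0 := by
  by_contra hcon
  push Not at hcon
  have : ∀ n, ‖H^[n] z‖ ≤ max R0 ‖z‖ := by
    intro n
    induction n with
    | zero => simp
    | succ n ih =>
      have h1 := hcon (n+1)
      have e : (H^[n+1] z).1 = (H^[n] z).2 := by rw [Function.iterate_succ_apply', h.hH]
      have h2 : ‖(H^[n+1] z).1‖ ≤ max R0 ‖z‖ := by
        rw [e]; exact (norm_snd_le _).trans ih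
      rw [Prod.norm_def]
      refine max_le h2 ?_
      by_contra h3
      push Not at h3
      exact h1 ⟨lt_of_le_of_lt (le_max_left _ _) h3, lt_of_le_of_lt h2 h3⟩
  have hb : G z = 0 := (h.hK z).mpr (isBounded_iff_forall_norm_le.mpr ⟨_, by rintro _ ⟨n, rfl⟩; exact this n⟩)
  linarith

lemma escape_compact (h : Hen d a p H G) (hR : Adm d H R0) {Q : Set (ℂ × ℂ)} (hQ : IsCompact Q)
    (hpos : ∀ z ∈ Q, 0 < G z) : ∃ N, ∀ z ∈ Q, H^[N] z ∈ V R0 := by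
  obtain ⟨N, hN⟩ := hQ.elim_directed_cover (fun n => H^[n] ⁻¹' V R0)
    (fun n => (isOpen_V R0).preimage (h.diff_H_iter n).continuous)
    (fun z hz => by
      have := h.escape (R0 := R0) (hpos z hz)
      simpa using this)
    (directed_of_isDirected_le fun i j hij z hz => by
      obtain ⟨k, rfl⟩ := Nat.exists_eq_add_of_le hij
      have := V_iter hR hz k
      rwa [← Function.iterate_add_apply, add_comm] at this)
  exact ⟨N, fun z hz => hN hz⟩

lemma harnack_log {g : ℂ → ℂ} {R : ℝ} (hR : 1 < R) (hg : DifferentiableOn ℂ g (Metric.ball 0 R))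
    (h0 : ∀ ζ ∈ Metric.ball (0 : ℂ) R, g ζ ≠ 0)
    (h1 : ∀ ζ ∈ Metric.ball (0 : ℂ) R, 0 < Real.log ‖g ζ‖) :
    Real.log ‖g 1‖ ≤ Real.log ‖g 0‖ + 2 * Real.log ‖g 0‖ / (R - 1) := by
  have m0 : (0 : ℂ) ∈ Metric.ball (0 : ℂ) R := by simp; linarith
  have m1 : (1 : ℂ) ∈ Metric.ball (0 : ℂ) R := by simp; linarith
  have hdg : DifferentiableOn ℂ (fun ζ => deriv g ζ / g ζ) (Metric.ball 0 R) :=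
    (hg.deriv Metric.isOpen_ball).div hg h0
  obtain ⟨L, hL0, hL⟩ := hdg.isExactOn_ball.with_val_at 0 (Complex.log (g 0))
  have hexp : ∀ ζ ∈ Metric.ball (0 : ℂ) R, Complex.exp (L ζ) = g ζ := by
    have hder : ∀ ζ ∈ Metric.ball (0 : ℂ) R,
        HasDerivAt (fun ζ => Complex.exp (-(L ζ)) * g ζ) 0 ζ := fun ζ hζ => by
      have hh := ((hL ζ hζ).neg.cexp).mul
        ((hg.differentiableAt (Metric.isOpen_ball.mem_nhds hζ)).hasDerivAt)
      refine hh.congr_deriv ?_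
      have e : deriv g ζ / g ζ * g ζ = deriv g ζ := div_mul_cancel₀ _ (h0 ζ hζ)
      linear_combination -(Complex.exp (-(L ζ))) * e
    intro ζ hζ
    have := (convex_ball (0 : ℂ) R).is_const_of_fderivWithin_eq_zero (𝕜 := ℂ)
      (f := fun ζ => Complex.exp (-(L ζ)) * g ζ)
      (fun x hx => (hder x hx).differentiableAt.differentiableWithinAt)
      (fun x hx => by
        rw [fderivWithin_of_isOpen Metric.isOpen_ball hx]
        ext; simp [(hder x hx).deriv]) hζ m0
    simp only [hL0, Complex.exp_neg, Complex.exp_log (h0 0 m0)] at this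
    rw [inv_mul_cancel₀ (h0 0 m0), inv_mul_eq_one₀ (Complex.exp_ne_zero _)] at this
    exact this
  have hre : ∀ ζ ∈ Metric.ball (0 : ℂ) R, (L ζ).re = Real.log ‖g ζ‖ := fun ζ hζ => by
    rw [← hexp ζ hζ, Complex.norm_exp, Real.log_exp]
  have := Complex.borelCaratheodory_zero (f := fun ζ => L 0 - L ζ) (M := Real.log ‖g 0‖) (R := R)
    (z := 1) (h1 0 m0)
    (fun ζ hζ => ((hL ζ hζ).differentiableAt.const_sub _).differentiableWithinAt)
    (fun ζ hζ => by
      have := h1 ζ hζ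
      simp only [mem_ofPred_eq, Complex.sub_re, hre ζ hζ, hre 0 m0]; linarith)
    (by linarith) m1 (by simp)
  rw [norm_one, mul_one] at this
  have h2 := (Complex.abs_re_le_norm _).trans this
  simp only [Complex.sub_re, hre 1 m1, hre 0 m0] at h2
  linarith [(abs_le.mp h2).1]

lemma harnack (h : Hen d a p H G) {f : ℂ → ℂ × ℂ} {U : Set ℂ} {R : ℝ} (hR : 1 < R)
    (hf : DifferentiableOn ℂ f U) (hUR : Metric.closedBall 0 R ⊆ U)
    (hpos : ∀ ζ ∈ Metric.closedBall (0 : ℂ) R, 0 < G (f ζ)) :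
    G (f 1) ≤ G (f 0) + 2 * G (f 0) / (R - 1) := by
  obtain ⟨R0, hR0⟩ := h.exists_R0
  obtain ⟨N, hN⟩ := h.escape_compact hR0
    ((isCompact_closedBall (0 : ℂ) R).image_of_continuousOn (hf.continuousOn.mono hUR))
    (by rintro _ ⟨ζ, hζ, rfl⟩; exact hpos ζ hζ)
  have hsub : Metric.ball (0 : ℂ) R ⊆ Metric.closedBall 0 R := Metric.ball_subset_closedBall
  obtain ⟨g, hg, hg2⟩ := h.boet hR0 Metric.isOpen_ball (γ := fun ζ => H^[N] (f ζ)) (U := Metric.ball 0 R)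
    ((h.diff_H_iter N).comp_differentiableOn (hf.mono (hsub.trans hUR)))
    (fun ζ hζ => hN _ ⟨ζ, hsub hζ, rfl⟩)
  have hdN : (0 : ℝ) < d ^ N := by have := h.dpos; positivity
  have hG : ∀ ζ ∈ Metric.ball (0 : ℂ) R, Real.log ‖g ζ‖ = d ^ N * G (f ζ) := fun ζ hζ => by
    rw [← (hg2 ζ hζ).2, h.G_iter]
  have m0 : (0 : ℂ) ∈ Metric.ball (0 : ℂ) R := by simp; linarith
  have m1 : (1 : ℂ) ∈ Metric.ball (0 : ℂ) R := by simp; linarith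
  have := harnack_log hR hg (fun ζ hζ => (hg2 ζ hζ).1) (fun ζ hζ => by
    rw [hG ζ hζ]; exact mul_pos hdN (hpos ζ (hsub hζ)))
  rw [hG 0 m0, hG 1 m1] at this
  have e : (d : ℝ) ^ N * G (f 0) + 2 * (d ^ N * G (f 0)) / (R - 1) =
    d ^ N * (G (f 0) + 2 * G (f 0) / (R - 1)) := by ring
  rw [e] at this
  exact le_of_mul_le_mul_left this hdN

lemma not_const (h : Hen d a p H G) {W : Set (ℂ × ℂ)} (hW : IsOpen W) {z : ℂ × ℂ} (hz : z ∈ W)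
    {t : ℝ} (ht : 0 < t) (hc : ∀ w ∈ W, G w = t) : False := by
  obtain ⟨R0, hR0⟩ := h.exists_R0
  obtain ⟨N, hN⟩ := h.escape (R0 := R0) (z := z) (by rw [hc z hz]; exact ht)
  have hR2 := hR0.1
  obtain ⟨B, hB⟩ := h.G_lower hR0
  set z1 := H^[N] z with hz1
  set x := z1.1
  set ρ := max R0 ‖x‖
  have hρ : 0 < ρ := lt_of_lt_of_le (by linarith) (le_max_left _ _)
  set U : Set ℂ := {s | Real.log ρ < s.re} with hU
  have hUo : IsOpen U := isOpen_lt continuous_const Complex.continuous_re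
  set γ : ℂ → ℂ × ℂ := fun s => (x, Complex.exp s) with hγ
  have hγd : Differentiable ℂ γ := (differentiable_const _).prodMk Complex.differentiable_exp
  have hmaps : MapsTo γ U (V R0) := fun s hs => by
    have hs : Real.log ρ < s.re := hs
    have h1 : ρ < ‖Complex.exp s‖ := by
      rw [Complex.norm_exp, ← Real.log_lt_iff_lt_exp hρ]; exact hs
    exact ⟨lt_of_le_of_lt (le_max_left _ _) h1, lt_of_le_of_lt (le_max_right _ _) h1⟩
  obtain ⟨g, hg, hg2⟩ := h.boet hR0 hUo hγd.differentiableOn hmaps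
  set s1 := Complex.log z1.2
  have hy0 : z1.2 ≠ 0 := by
    rw [← norm_pos_iff]; linarith [hN.1]
  have hs1 : s1 ∈ U := by
    simp only [hU, mem_ofPred_eq, s1, Complex.log_re]
    exact Real.log_lt_log hρ (max_lt hN.1 hN.2)
  have hγs : γ s1 = z1 := by
    simp only [hγ, s1, Complex.exp_log hy0, x]
  have hev : ∀ᶠ s in 𝓝 s1, ‖g s‖ = ‖g s1‖ := by
    have hcont : ContinuousAt (fun s => (Hi a p)^[N] (γ s)) s1 :=
      ((diff_Hi.iterate N).continuous.comp hγd.continuous).continuousAt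
    have e : (Hi a p)^[N] (γ s1) = z := by rw [hγs, hz1, h.Hi_H_iter]
    have hval : ∀ s ∈ U, (Hi a p)^[N] (γ s) ∈ W → Real.log ‖g s‖ = d ^ N * t := fun s hs hw => by
      rw [← (hg2 s hs).2, ← hc _ hw, h.G_Hi_iter]
      have := h.dpos
      field_simp
    filter_upwards [hUo.mem_nhds hs1, hcont.preimage_mem_nhds (hW.mem_nhds (by simpa only [e] using hz))]
      with s hs hw
    have h1 := hval s hs hw
    rw [← hval s1 hs1 (by rw [e]; exact hz)] at h1
    exact Real.log_injOn_pos (norm_pos_iff.mpr (hg2 s hs).1) (norm_pos_iff.mpr (hg2 s1 hs1).1) h1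
  have hgl : ∀ᶠ s in 𝓝 s1, g s = g s1 := Complex.eventually_eq_of_isLocalMax_norm
    (by filter_upwards [hUo.mem_nhds hs1] with s hs using hg.differentiableAt (hUo.mem_nhds hs))
    (by filter_upwards [hev] with s hs; exact hs.le)
  have hall : EqOn g (fun _ => g s1) U :=
    (hg.analyticOnNhd hUo).eqOn_of_preconnected_of_eventuallyEq
      analyticOnNhd_const (convex_halfSpace_re_gt _).isPreconnected hs1 hgl
  set τ := Real.log ‖g s1‖
  set s2 : ℂ := ((max (Real.log ρ) (τ + B) + 1 : ℝ) : ℂ)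
  have hs2 : s2 ∈ U := by
    simp only [hU, mem_ofPred_eq, s2, Complex.ofReal_re]
    linarith [le_max_left (Real.log ρ) (τ + B)]
  have h3 := hB _ (hmaps hs2)
  rw [(hg2 s2 hs2).2, hall hs2] at h3
  simp only [hγ, Complex.norm_exp, Real.log_exp, s2, Complex.ofReal_re] at h3
  linarith [le_max_right (Real.log ρ) (τ + B)]

end Hen

namespace Hen

variable {d : ℕ} {a : ℂ} {p : Polynomial ℂ} {H : ℂ × ℂ → ℂ × ℂ} {G : ℂ × ℂ → ℝ}

lemma norm_iter_le (h : Hen d a p H G) {s : ℝ} {z : ℂ × ℂ} (hz : G z < s) :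
    ∀ᶠ n : ℕ in atTop, ‖H^[n] z‖ ≤ Real.exp (d ^ n * s) := by
  filter_upwards [(h.hGl z).eventually_lt_const hz] with n hn
  have hdn : (0 : ℝ) < d ^ n := by have := h.dpos; positivity
  rw [div_lt_iff₀ hdn] at hn
  have h1 : (0 : ℝ) < max ‖H^[n] z‖ 1 := lt_of_lt_of_le one_pos (le_max_right _ _)
  refine (le_max_left _ 1).trans ?_
  rw [← Real.log_le_iff_le_exp h1]
  linarith

lemma liouville (h : Hen d a p H G) {t : ℝ} (ht : 0 < t) {ψ : ℂ × ℂ → ℂ × ℂ}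
    (hψ : DifferentiableOn ℂ ψ {z | G z < t}) (hpos : ∀ w, G w < t → 0 < G (ψ w))
    {z w : ℂ × ℂ} (hz : G z < t / 2) (hw : G w < t / 2) : G (ψ w) ≤ G (ψ z) := by
  obtain ⟨C, hC0, hC⟩ := h.exists_C
  have hd2 := h.d2
  have hd := h.dpos
  have hbig : Tendsto (fun n : ℕ => (d : ℝ) ^ n * (t / 4)) atTop atTop :=
    (tendsto_pow_atTop_atTop_of_one_lt (by linarith)).atTop_mul_const (by positivity)
  have hRt : Tendsto (fun n : ℕ => Real.exp ((d : ℝ) ^ n * (t / 4)) - 1) atTop atTop :=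
    tendsto_atTop_add_const_right _ (-1) (Real.tendsto_exp_atTop.comp hbig)
  have hlim : Tendsto (fun n : ℕ => G (ψ z) + 2 * G (ψ z) /
      (Real.exp ((d : ℝ) ^ n * (t / 4)) - 1)) atTop (𝓝 (G (ψ z) + 0)) :=
    tendsto_const_nhds.add (tendsto_const_nhds.div_atTop hRt)
  rw [add_zero] at hlim
  refine ge_of_tendsto hlim ?_
  filter_upwards [hbig.eventually_gt_atTop (Real.log 3 + C), h.norm_iter_le hz,
    h.norm_iter_le hw] with n hn hzn hwn
  have hdn : (0 : ℝ) < d ^ n := by positivity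
  set R := Real.exp (d ^ n * (t / 4)) with hR
  set E := Real.exp (d ^ n * (t / 2)) with hE
  have hR1 : 1 < R := by
    rw [hR, Real.one_lt_exp_iff]; positivity
  have hE1 : 1 < E := by
    rw [hE, Real.one_lt_exp_iff]; positivity
  set ℓ : ℂ → ℂ × ℂ := fun ζ => H^[n] z + ζ • (H^[n] w - H^[n] z) with hℓ
  have hℓd : Differentiable ℂ ℓ := by rw [hℓ]; fun_prop
  have hdiff : ‖H^[n] w - H^[n] z‖ ≤ 2 * E := by
    refine (norm_sub_le _ _).trans ?_
    linarith
  have hin : ∀ ζ : ℂ, ‖ζ‖ ≤ R → G ((Hi a p)^[n] (ℓ ζ)) < t := by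
    intro ζ hζ
    rw [h.G_Hi_iter, div_lt_iff₀ hdn]
    have h1 := h.G_le_hn hC0 hC 0 (ℓ ζ)
    simp only [Hen.hn, Function.iterate_zero, id_eq, pow_zero, div_one] at h1
    have h2 : ‖ℓ ζ‖ ≤ 3 * E * R := by
      have := norm_add_le (H^[n] z) (ζ • (H^[n] w - H^[n] z))
      rw [norm_smul] at this
      have h3 : ‖ζ‖ * ‖H^[n] w - H^[n] z‖ ≤ R * (2 * E) := by gcongr
      simp only [hℓ]
      nlinarith
    have h3 : max ‖ℓ ζ‖ 1 ≤ 3 * E * R := max_le h2 (by nlinarith)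
    have h4 : Real.log (max ‖ℓ ζ‖ 1) ≤ Real.log 3 + d ^ n * (t / 2) + d ^ n * (t / 4) := by
      refine (Real.log_le_log (lt_of_lt_of_le one_pos (le_max_right _ _)) h3).trans ?_
      rw [Real.log_mul (by positivity) (by positivity),
        Real.log_mul (by positivity) (by positivity), hR, hE, Real.log_exp, Real.log_exp]
    linarith
  have key := h.harnack (U := {ζ | G ((Hi a p)^[n] (ℓ ζ)) < t})
    (f := fun ζ => ψ ((Hi a p)^[n] (ℓ ζ))) hR1
    (hψ.comp (((diff_Hi.iterate n).comp hℓd).differentiableOn) (fun ζ hζ => hζ))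
    (fun ζ hζ => hin ζ (by simpa using hζ))
    (fun ζ hζ => hpos _ (hin ζ (by simpa using hζ)))
  have e0 : ℓ 0 = H^[n] z := by simp [hℓ]
  have e1 : ℓ 1 = H^[n] w := by simp [hℓ]
  simpa only [e0, e1, h.Hi_H_iter] using key

lemma main_half (h : Hen d a p H G) {c c' : ℝ} (hc : 0 < c) (hc' : 0 < c')
    {φ ψ : ℂ × ℂ → ℂ × ℂ} (hφ : IsBiholoOn φ ψ {z | G z < c} {z | G z < c'})
    (w0 : ℂ × ℂ) (hw0 : G w0 = 0) : G (ψ w0) = 0 := by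
  obtain ⟨dφ, dψ, mφ, mψ, hψφ, hφψ⟩ := hφ
  have hop : ∀ s : ℝ, IsOpen {z | G z < s} := fun s => isOpen_lt h.hGc continuous_const
  by_contra hne
  have ht : 0 < G (ψ w0) := lt_of_le_of_ne (h.hG0 _) (Ne.symm hne)
  have hw0c : G w0 < c := by rw [hw0]; exact hc
  have hw0c' : G w0 < c' := by rw [hw0]; exact hc'
  have ht' : 0 < G (φ w0) := by
    refine lt_of_le_of_ne (h.hG0 _) fun h0 => ?_
    have h1 := h.const_on_K hc' dψ mψ (z0 := φ w0) (w0 := w0) h0.symm hw0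
    rw [hψφ w0 hw0c] at h1
    linarith
  have htc : G (φ w0) < c' := mφ hw0c
  have hpos : ∀ w, G w < G (φ w0) → 0 < G (ψ w) := fun w hw => by
    refine lt_of_le_of_ne (h.hG0 _) fun h0 => ?_
    have h1 := h.const_on_K hc dφ mφ (z0 := ψ w) (w0 := w0) h0.symm hw0
    rw [hφψ w (hw.trans htc)] at h1
    linarith
  have dψ' : DifferentiableOn ℂ ψ {z | G z < G (φ w0)} :=
    dψ.mono fun z hz => lt_trans hz htc
  have hw2 : G w0 < G (φ w0) / 2 := by linarith
  refine h.not_const (dφ.continuousOn.isOpen_inter_preimage (hop c) (hop (G (φ w0) / 2)))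
    (z := ψ w0) ⟨mψ hw0c', ?_⟩ ht ?_
  · change G (φ (ψ w0)) < _
    rw [hφψ w0 hw0c']; exact hw2
  · rintro z ⟨hz, hz2⟩
    have h1 := h.liouville ht' dψ' hpos hz2 hw2
    have h2 := h.liouville ht' dψ' hpos hw2 hz2
    rw [hψφ z hz] at h1 h2
    exact le_antisymm h2 h1

end Hen

/-- Let `c, c' > 0` and let `φ : Ω_c → Ω_{c'}` be a biholomorphism.
Then `φ` preserves the set of points with bounded forward orbit: `φ(K⁺) = K⁺`. -/
theorem stmt_4 (d : ℕ) (hd : 2 ≤ d) (a : ℂ) (ha : a ≠ 0)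
    (p : Polynomial ℂ) (hpm : p.Monic) (hpd : p.natDegree = d)
    (hpc : p.coeff (d - 1) = 0)
    (H : ℂ × ℂ → ℂ × ℂ) (hH : ∀ z : ℂ × ℂ, H z = (z.2, p.eval z.2 - a * z.1))
    (G : ℂ × ℂ → ℝ) (hGcont : Continuous G) (hGnonneg : ∀ z, 0 ≤ G z)
    (hGlim : ∀ z : ℂ × ℂ,
      Tendsto (fun n : ℕ => Real.log (max ‖H^[n] z‖ 1) / (d : ℝ) ^ n) atTop (𝓝 (G z)))
    (K : Set (ℂ × ℂ))
    (hK : K = {z : ℂ × ℂ | Bornology.IsBounded (Set.range fun n : ℕ => H^[n] z)})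
    (hKG : K = {z : ℂ × ℂ | G z = 0})
    (c c' : ℝ) (hc : 0 < c) (hc' : 0 < c')
    (φ ψ : ℂ × ℂ → ℂ × ℂ)
    (hφ : IsBiholoOn φ ψ {z : ℂ × ℂ | G z < c} {z : ℂ × ℂ | G z < c'}) :
    φ '' K = K := by
  have h : Hen d a p H G := ⟨hd, ha, hpm, hpd, hH, hGcont, hGnonneg, hGlim, fun z => by
    have := hKG.symm.trans hK
    exact Set.ext_iff.mp this z⟩
  have hφ' : IsBiholoOn ψ φ {z : ℂ × ℂ | G z < c'} {z : ℂ × ℂ | G z < c} :=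
    ⟨hφ.2.1, hφ.1, hφ.2.2.2.1, hφ.2.2.1, hφ.2.2.2.2.2, hφ.2.2.2.2.1⟩
  have h1 := h.main_half hc hc' hφ
  have h2 := h.main_half hc' hc hφ'
  subst hKG
  apply Set.Subset.antisymm
  · rintro _ ⟨z, hz, rfl⟩
    exact h2 z hz
  · intro w hw
    have hw' : G w = 0 := hw
    exact ⟨ψ w, h1 w hw, hφ.2.2.2.2.2 w (show G w < c' by rw [hw']; exact hc')⟩
end
end
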